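/- (Hölder continuity) Let p be a good heat kernel for L^κ. Then for every T ≥ 1 and every γ ∈ (0, α₁) with γ ≤ 1, there is a constant c₁ > 0 such that for all t ∈ (0,T] and x, x′, y ∈ ℝ^d with x ≠ y or x′ ≠ y, |p(t,x,y) − p(t,x′,y)| ≤ c₁ |x−x′|^γ t Φ⁻¹(t)^{−γ} max{𝔊(t,x−y), 𝔊(t,x′−y)}. -/

import Mathlib

open MeasureTheory Filter Set

attribute [local instance] Classical.propDecidable

noncomputable def Phi (φ : ℝ → ℝ) (r : ℝ) : ℝ :=
  if r ≤ 1 then r ^ 2 / (2 * ∫ s in Set.Ioo (0:ℝ) r, s / φ s)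
  else (1 / (2 * ∫ s in Set.Ioo (0:ℝ) 1, s / φ s)) * r ^ 2

noncomputable def theta (d : ℕ) (φ : ℝ → ℝ) (b β : ℝ) (r : ℝ) : ℝ :=
  if r ≤ 1 then 1 / (r ^ d * Phi φ r)
  else if β < 1 then Real.exp (-b * r ^ β)
  else r ^ (-(d : ℝ) - 1) * Real.exp (-(b / 5) * r)

noncomputable def Gfun (d : ℕ) (φ : ℝ → ℝ) (b β : ℝ) (Φinv : ℝ → ℝ)
    (t : ℝ) (x : EuclideanSpace ℝ (Fin d)) : ℝ :=
  if x = 0 then 1 / (t * Φinv t ^ d)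
  else min (1 / (t * Φinv t ^ d)) (theta d φ b β ‖x‖)

noncomputable def Gtil (d : ℕ) (φ : ℝ → ℝ) (Φinv : ℝ → ℝ)
    (t : ℝ) (x : EuclideanSpace ℝ (Fin d)) : ℝ :=
  if x = 0 then 1 / (t * Φinv t ^ d)
  else min (1 / (t * Φinv t ^ d)) (1 / (‖x‖ ^ d * Phi φ ‖x‖))

noncomputable def Leps (d : ℕ)
    (κ : EuclideanSpace ℝ (Fin d) → EuclideanSpace ℝ (Fin d) → ℝ) (J : ℝ → ℝ)
    (ε : ℝ) (f : EuclideanSpace ℝ (Fin d) → ℝ) (x : EuclideanSpace ℝ (Fin d)) : ℝ :=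
  ∫ z in {z : EuclideanSpace ℝ (Fin d) | ε < ‖z‖}, (f (x + z) - f x) * (κ x z * J ‖z‖)

structure PhiInvSpec (φ Φinv : ℝ → ℝ) : Prop where
  pos : ∀ t : ℝ, 0 < t → 0 < Φinv t
  right_inv : ∀ t : ℝ, 0 < t → Phi φ (Φinv t) = t
  left_inv : ∀ r : ℝ, 0 < r → Φinv (Phi φ r) = r

structure HKAssumptions (d : ℕ) (φ J : ℝ → ℝ) (a₁ α₁ C₀ a b β : ℝ)
    (κ : EuclideanSpace ℝ (Fin d) → EuclideanSpace ℝ (Fin d) → ℝ)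
    (κ₀ κ₁ κ₂ δ : ℝ) : Prop where
  hd : 1 ≤ d
  φ_cont : ContinuousOn φ (Set.Icc 0 1)
  φ_mono : StrictMonoOn φ (Set.Icc 0 1)
  φ_zero : φ 0 = 0
  a₁_pos : 0 < a₁
  α₁_pos : 0 < α₁
  α₁_le : α₁ ≤ 2
  hLS : ∀ r R : ℝ, 0 < r → r ≤ R → R ≤ 1 → a₁ * (R / r) ^ α₁ ≤ φ R / φ r
  hI : MeasureTheory.IntegrableOn (fun s => s / φ s) (Set.Ioo (0:ℝ) 1)
  hC₀ : C₀ = ∫ s in Set.Ioo (0:ℝ) 1, s / φ s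
  J_pos : ∀ r : ℝ, 0 < r → 0 < J r
  J_cont : ContinuousOn J (Set.Ioi 0)
  J_anti : AntitoneOn J (Set.Ioi 0)
  J_diff : ∀ r : ℝ, 0 < r → DifferentiableAt ℝ J r
  ha : 1 ≤ a
  hb : 0 < b
  β_pos : 0 < β
  β_le : β ≤ 1
  hJ1_low : ∀ r : ℝ, 0 < r → r ≤ 1 → a⁻¹ / (r ^ d * φ r) ≤ J r
  hJ1_up : ∀ r : ℝ, 0 < r → r ≤ 1 → J r ≤ a / (r ^ d * φ r)
  hJ1_exp : ∀ r : ℝ, 1 < r → J r ≤ a * Real.exp (-b * r ^ β)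
  hJ2 : AntitoneOn (fun r => -(deriv J r) / r) (Set.Ioi 0)
  κ_meas : Measurable (Function.uncurry κ)
  κ₀_pos : 0 < κ₀
  κ₁_pos : 0 < κ₁
  κ₂_pos : 0 < κ₂
  δ_pos : 0 < δ
  δ_lt : δ < 1
  κ_low : ∀ x z, κ₀ ≤ κ x z
  κ_up : ∀ x z, κ x z ≤ κ₁
  κ_sym : ∀ x z, κ x z = κ x (-z)
  κ_holder : ∀ x y z, |κ x z - κ y z| ≤ κ₂ * ‖x - y‖ ^ δ

structure GoodHeatKernel (d : ℕ) (φ J : ℝ → ℝ) (b β : ℝ) (Φinv : ℝ → ℝ)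
    (κ : EuclideanSpace ℝ (Fin d) → EuclideanSpace ℝ (Fin d) → ℝ)
    (p : ℝ → EuclideanSpace ℝ (Fin d) → EuclideanSpace ℝ (Fin d) → ℝ) : Prop where
  cont : ContinuousOn
      (fun q : ℝ × EuclideanSpace ℝ (Fin d) × EuclideanSpace ℝ (Fin d) => p q.1 q.2.1 q.2.2)
      (Set.Ioi (0:ℝ) ×ˢ (Set.univ : Set (EuclideanSpace ℝ (Fin d) × EuclideanSpace ℝ (Fin d))))
  eqn : ∀ t : ℝ, 0 < t → ∀ x y : EuclideanSpace ℝ (Fin d), x ≠ y →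
      ∃ L : ℝ, Filter.Tendsto (fun ε => Leps d κ J ε (fun x' => p t x' y) x)
          (nhdsWithin 0 (Set.Ioi 0)) (nhds L)
        ∧ HasDerivAt (fun s => p s x y) L t
  upper : ∀ T : ℝ, 1 ≤ T → ∃ c : ℝ, 0 < c ∧ ∀ t : ℝ, 0 < t → t ≤ T →
      ∀ x y, p t x y ≤ c * t * Gfun d φ b β Φinv t (x - y)
  frac : ∀ T : ℝ, 1 ≤ T → ∃ c' : ℝ, 0 < c' ∧ ∀ ε : ℝ, 0 < ε → ε ≤ 1 →
      ∀ t : ℝ, 0 < t → t ≤ T → ∀ x y, x ≠ y →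
      |Leps d κ J ε (fun x' => p t x' y) x| ≤ c' * Gtil d φ Φinv t (x - y)
  approx : ∀ f : EuclideanSpace ℝ (Fin d) → ℝ, (∃ M, ∀ x, |f x| ≤ M) →
      UniformContinuous f → ∀ η : ℝ, 0 < η → ∃ t₀ : ℝ, 0 < t₀ ∧
      ∀ t : ℝ, 0 < t → t < t₀ → ∀ x, |(∫ y, p t x y * f y) - f x| ≤ η

variable {d : ℕ} {φ J : ℝ → ℝ} {a₁ α₁ C₀ a b β : ℝ}
  {κ : EuclideanSpace ℝ (Fin d) → EuclideanSpace ℝ (Fin d) → ℝ} {κ₀ κ₁ κ₂ δ : ℝ}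

/-! ### The scale functions `φ` and `Φ` -/

namespace HKAssumptions

lemma phi_pos (H : HKAssumptions d φ J a₁ α₁ C₀ a b β κ κ₀ κ₁ κ₂ δ) {s : ℝ} (h0 : 0 < s)
    (h1 : s ≤ 1) : 0 < φ s := by
  have := H.φ_mono (show (0:ℝ) ∈ Icc (0:ℝ) 1 by simp) (show s ∈ Icc (0:ℝ) 1 from ⟨h0.le, h1⟩) h0
  rwa [H.φ_zero] at this

lemma phi_le (H : HKAssumptions d φ J a₁ α₁ C₀ a b β κ κ₀ κ₁ κ₂ δ) {s r : ℝ} (h0 : 0 < s)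
    (hsr : s ≤ r) (h1 : r ≤ 1) : φ s ≤ φ r :=
  H.φ_mono.monotoneOn ⟨h0.le, hsr.trans h1⟩ ⟨h0.le.trans hsr, h1⟩ hsr

lemma integrableOn_id_div (H : HKAssumptions d φ J a₁ α₁ C₀ a b β κ κ₀ κ₁ κ₂ δ) {r : ℝ}
    (h1 : r ≤ 1) : IntegrableOn (fun s => s / φ s) (Ioo 0 r) :=
  H.hI.mono_set (Ioo_subset_Ioo_right h1)

lemma integral_id_div_pos (H : HKAssumptions d φ J a₁ α₁ C₀ a b β κ κ₀ κ₁ κ₂ δ) {r : ℝ}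
    (h0 : 0 < r) (h1 : r ≤ 1) : 0 < ∫ s in Ioo (0:ℝ) r, s / φ s := by
  rw [setIntegral_pos_iff_support_of_nonneg_ae]
  · have : Function.support (fun s => s / φ s) ∩ Ioo 0 r = Ioo 0 r := by
      rw [inter_eq_right]
      intro s hs
      have := H.phi_pos hs.1 (hs.2.le.trans h1)
      have := div_pos hs.1 this
      exact this.ne'
    rw [this]
    simpa using h0
  · filter_upwards [ae_restrict_mem measurableSet_Ioo] with s hs
    exact (div_pos hs.1 (H.phi_pos hs.1 (hs.2.le.trans h1))).le
  · exact H.integrableOn_id_div h1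

lemma Phi_of_le {φ : ℝ → ℝ} {r : ℝ} (h : r ≤ 1) :
    Phi φ r = r ^ 2 / (2 * ∫ s in Ioo (0:ℝ) r, s / φ s) := by simp [Phi, h]

lemma Phi_of_one_le {φ : ℝ → ℝ} {r : ℝ} (h : 1 ≤ r) : Phi φ r = Phi φ 1 * r ^ 2 := by
  rcases h.eq_or_lt with rfl | h
  · simp
  · simp [Phi, not_le.mpr h]

lemma Phi_pos (H : HKAssumptions d φ J a₁ α₁ C₀ a b β κ κ₀ κ₁ κ₂ δ) {r : ℝ} (h0 : 0 < r) :
    0 < Phi φ r := by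
  have h1 : ∀ {r : ℝ}, 0 < r → r ≤ 1 → 0 < Phi φ r := fun h0 h => by
    rw [Phi_of_le h]
    have := H.integral_id_div_pos h0 h
    positivity
  rcases le_total r 1 with h | h
  · exact h1 h0 h
  · rw [Phi_of_one_le h]
    have := h1 one_pos le_rfl
    positivity

lemma integral_id_div_comp_mul {φ : ℝ → ℝ} {l r : ℝ} (hl : 0 < l) (hr : 0 < r) :
    ∫ s in Ioo (0:ℝ) (l * r), s / φ s = l ^ 2 * ∫ s in Ioo (0:ℝ) r, s / φ (l * s) := by
  rw [← integral_Ioc_eq_integral_Ioo, ← integral_Ioc_eq_integral_Ioo,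
    ← intervalIntegral.integral_of_le (by positivity), ← intervalIntegral.integral_of_le hr.le]
  have := intervalIntegral.integral_comp_mul_left (a := 0) (b := r) (fun s => s / φ s) hl.ne'
  simp only [mul_zero, smul_eq_mul] at this
  have h2 : ∫ s in (0:ℝ)..r, l * s / φ (l * s) = l * ∫ s in (0:ℝ)..r, s / φ (l * s) := by
    rw [← intervalIntegral.integral_const_mul]
    congr 1; ext s; ring
  rw [h2] at this
  field_simp at this
  linarith

/-- Comparison of the integrals `∫₀^r s/φ(s) ds` under a pointwise scaling bound for `φ`. -/
lemma integral_scale_le (H : HKAssumptions d φ J a₁ α₁ C₀ a b β κ κ₀ κ₁ κ₂ δ) {r R c : ℝ}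
    (h0 : 0 < r) (hrR : r ≤ R) (hR : R ≤ 1) (hc : 0 < c)
    (hs : ∀ s, 0 < s → s ≤ r → c * φ s ≤ φ (R / r * s)) :
    c * ∫ s in Ioo (0:ℝ) R, s / φ s ≤ (R / r) ^ 2 * ∫ s in Ioo (0:ℝ) r, s / φ s := by
  have hl : 0 < R / r := div_pos (h0.trans_le hrR) h0
  have hRr : R = R / r * r := by field_simp
  have key : c * ∫ s in Ioo (0:ℝ) r, s / φ (R / r * s) ≤ ∫ s in Ioo (0:ℝ) r, s / φ s := by
    rw [← integral_const_mul]
    apply integral_mono_of_nonneg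
    · filter_upwards [ae_restrict_mem measurableSet_Ioo] with s hs'
      have : 0 < φ (R / r * s) := lt_of_lt_of_le
        (mul_pos hc (H.phi_pos hs'.1 (hs'.2.le.trans (hrR.trans hR)))) (hs s hs'.1 hs'.2.le)
      have := hs'.1
      simp only [Pi.zero_apply]
      positivity
    · exact H.integrableOn_id_div (hrR.trans hR)
    · filter_upwards [ae_restrict_mem measurableSet_Ioo] with s hs'
      have h1 := H.phi_pos hs'.1 (hs'.2.le.trans (hrR.trans hR))
      have h2 := hs s hs'.1 hs'.2.le
      have h3 : 0 < φ (R / r * s) := (mul_pos hc h1).trans_le h2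
      rw [← mul_div_assoc, div_le_div_iff₀ h3 h1]
      have := hs'.1
      nlinarith
  calc c * ∫ s in Ioo (0:ℝ) R, s / φ s
      = (R / r) ^ 2 * (c * ∫ s in Ioo (0:ℝ) r, s / φ (R / r * s)) := by
        conv_lhs => rw [hRr, integral_id_div_comp_mul hl h0]
        ring
    _ ≤ _ := by gcongr

lemma Phi_scale_of_le_one (H : HKAssumptions d φ J a₁ α₁ C₀ a b β κ κ₀ κ₁ κ₂ δ) {r R c : ℝ}
    (h0 : 0 < r) (hrR : r ≤ R) (hR : R ≤ 1) (hc : 0 < c)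
    (hs : ∀ s, 0 < s → s ≤ r → c * φ s ≤ φ (R / r * s)) :
    c * Phi φ r ≤ Phi φ R := by
  have h := H.integral_scale_le h0 hrR hR hc hs
  have h1 := H.integral_id_div_pos h0 (hrR.trans hR)
  have h2 := H.integral_id_div_pos (h0.trans_le hrR) hR
  rw [Phi_of_le (hrR.trans hR), Phi_of_le hR, ← mul_div_assoc,
    div_le_div_iff₀ (by positivity) (by positivity)]
  rw [div_pow, div_mul_eq_mul_div, le_div_iff₀ (by positivity)] at h
  nlinarith

lemma Phi_lower (H : HKAssumptions d φ J a₁ α₁ C₀ a b β κ κ₀ κ₁ κ₂ δ) {r R : ℝ}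
    (h0 : 0 < r) (hrR : r ≤ R) (hR : R ≤ 1) : a₁ * (R / r) ^ α₁ * Phi φ r ≤ Phi φ R := by
  have hR0 := h0.trans_le hrR
  have := H.a₁_pos
  refine H.Phi_scale_of_le_one h0 hrR hR (by positivity) fun s hs0 hsr => ?_
  have h1 := H.phi_pos hs0 (hsr.trans (hrR.trans hR))
  have h2 : R / r * s ≤ 1 := by
    rw [div_mul_eq_mul_div, div_le_one h0]
    nlinarith
  have h3 : s ≤ R / r * s := le_mul_of_one_le_left hs0.le ((one_le_div h0).2 hrR)
  have := H.hLS s (R / r * s) hs0 h3 h2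
  rw [mul_div_cancel_right₀ _ hs0.ne', le_div_iff₀ h1] at this
  exact this

lemma Phi_mono (H : HKAssumptions d φ J a₁ α₁ C₀ a b β κ κ₀ κ₁ κ₂ δ) {r R : ℝ}
    (h0 : 0 < r) (hrR : r ≤ R) : Phi φ r ≤ Phi φ R := by
  have key : ∀ {r R : ℝ}, 0 < r → r ≤ R → R ≤ 1 → Phi φ r ≤ Phi φ R := by
    intro r R h0 hrR hR
    rw [← one_mul (Phi φ r)]
    refine H.Phi_scale_of_le_one h0 hrR hR one_pos fun s hs0 hsr => ?_
    rw [one_mul]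
    refine H.phi_le hs0 (le_mul_of_one_le_left hs0.le ((one_le_div h0).2 hrR)) ?_
    rw [div_mul_eq_mul_div, div_le_one h0]
    nlinarith
  have h1 := H.Phi_pos one_pos
  rcases le_total R 1 with hR | hR
  · exact key h0 hrR hR
  · rw [Phi_of_one_le hR]
    rcases le_total r 1 with hr | hr
    · have := key h0 hr le_rfl
      nlinarith [one_le_pow₀ (n := 2) hR]
    · rw [Phi_of_one_le hr]
      gcongr

lemma Phi_upper (H : HKAssumptions d φ J a₁ α₁ C₀ a b β κ κ₀ κ₁ κ₂ δ) {r R : ℝ}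
    (h0 : 0 < r) (hrR : r ≤ R) : Phi φ R ≤ (R / r) ^ 2 * Phi φ r := by
  have key : ∀ {r R : ℝ}, 0 < r → r ≤ R → R ≤ 1 → Phi φ R ≤ (R / r) ^ 2 * Phi φ r := by
    intro r R h0 hrR hR
    rw [Phi_of_le hR, Phi_of_le (hrR.trans hR)]
    have h1 := H.integral_id_div_pos h0 (hrR.trans hR)
    have h2 := H.integral_id_div_pos (h0.trans_le hrR) hR
    have h3 : ∫ s in Ioo (0:ℝ) r, s / φ s ≤ ∫ s in Ioo (0:ℝ) R, s / φ s := by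
      refine setIntegral_mono_set (H.integrableOn_id_div hR) ?_
        (Ioo_subset_Ioo_right hrR).eventuallyLE
      filter_upwards [ae_restrict_mem measurableSet_Ioo] with s hs
      exact (div_pos hs.1 (H.phi_pos hs.1 (hs.2.le.trans hR))).le
    rw [div_pow, div_mul_div_comm, mul_comm (R ^ 2), mul_div_mul_left _ _ (by positivity)]
    gcongr
  have h1 := H.Phi_pos one_pos
  rcases le_total R 1 with hR | hR
  · exact key h0 hrR hR
  · rw [Phi_of_one_le hR]
    rcases le_total r 1 with hr | hr
    · have h := key h0 hr le_rfl
      calc Phi φ 1 * R ^ 2 ≤ ((1 / r) ^ 2 * Phi φ r) * R ^ 2 := by gcongr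
        _ = _ := by ring
    · rw [Phi_of_one_le hr]
      apply le_of_eq
      field_simp

lemma Phi_le_phi (H : HKAssumptions d φ J a₁ α₁ C₀ a b β κ κ₀ κ₁ κ₂ δ) {r : ℝ}
    (h0 : 0 < r) (hr : r ≤ 1) : Phi φ r ≤ φ r := by
  have h1 := H.integral_id_div_pos h0 hr
  have hφ := H.phi_pos h0 hr
  rw [Phi_of_le hr, div_le_iff₀ (by positivity)]
  have h2 : ∫ s in Ioo (0:ℝ) r, s / φ r ≤ ∫ s in Ioo (0:ℝ) r, s / φ s := by
    apply integral_mono_of_nonneg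
    · filter_upwards [ae_restrict_mem measurableSet_Ioo] with s hs
      exact (div_pos hs.1 hφ).le
    · exact H.integrableOn_id_div hr
    · filter_upwards [ae_restrict_mem measurableSet_Ioo] with s hs
      exact div_le_div_of_nonneg_left hs.1.le (H.phi_pos hs.1 (hs.2.le.trans hr))
        (H.phi_le hs.1 hs.2.le hr)
  have h3 : ∫ s in Ioo (0:ℝ) r, s / φ r = r ^ 2 / 2 / φ r := by
    rw [integral_div, ← integral_Ioc_eq_integral_Ioo, ← intervalIntegral.integral_of_le h0.le,
      integral_id]
    simp
  rw [h3, div_le_iff₀ hφ] at h2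
  linarith

lemma integral_id_div_eq (H : HKAssumptions d φ J a₁ α₁ C₀ a b β κ κ₀ κ₁ κ₂ δ) {r : ℝ}
    (h0 : 0 < r) (hr : r ≤ 1) : ∫ s in Ioo (0:ℝ) r, s / φ s = r ^ 2 / (2 * Phi φ r) := by
  have h1 := H.integral_id_div_pos h0 hr
  rw [Phi_of_le hr]
  field_simp

/-- Near the origin the integral `∫₀^ε s/φ(s) ds` is negligible. -/
lemma exists_integral_ge (H : HKAssumptions d φ J a₁ α₁ C₀ a b β κ κ₀ κ₁ κ₂ δ) {r : ℝ}
    (h0 : 0 < r) (hr : r ≤ 1) : ∃ ε₀, 0 < ε₀ ∧ ∀ ε, 0 < ε → ε < ε₀ →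
      r ^ 2 / (4 * Phi φ r) ≤ ∫ s in Ioc ε r, s / φ s := by
  have hI : IntervalIntegrable (fun s => s / φ s) volume 0 1 := by
    rw [intervalIntegrable_iff_integrableOn_Ioo_of_le zero_le_one]
    exact H.hI
  have hsub : ∀ u v : ℝ, 0 ≤ u → u ≤ v → v ≤ 1 →
      IntervalIntegrable (fun s => s / φ s) volume u v := fun u v h1 h2 h3 =>
    hI.mono_set (by rw [uIcc_of_le h2, uIcc_of_le zero_le_one]; exact Icc_subset_Icc h1 h3)
  have hc : ContinuousWithinAt (fun ε => ∫ s in (0:ℝ)..ε, s / φ s) (Icc 0 1) 0 := by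
    have := intervalIntegral.continuousOn_primitive_interval (a := 0) (b := 1)
      (f := fun s => s / φ s) (μ := volume) (by
        rw [uIcc_of_le zero_le_one, integrableOn_Icc_iff_integrableOn_Ioo]; exact H.hI)
    rw [uIcc_of_le zero_le_one] at this
    exact this 0 (by simp)
  have hP := H.Phi_pos h0
  have hpos : 0 < r ^ 2 / (4 * Phi φ r) := by positivity
  rw [Metric.continuousWithinAt_iff] at hc
  obtain ⟨ε₁, h1, h2⟩ := hc _ hpos
  refine ⟨min ε₁ r, lt_min h1 h0, fun ε hε hε' => ?_⟩
  have hεr := hε'.trans_le (min_le_right _ _)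
  have h3 := h2 (x := ε) ⟨hε.le, hεr.le.trans hr⟩
    (by rw [Real.dist_eq, sub_zero, abs_of_pos hε]; exact hε'.trans_le (min_le_left _ _))
  rw [Real.dist_eq, intervalIntegral.integral_same, sub_zero] at h3
  have h4 := le_of_abs_le h3.le
  have h5 := intervalIntegral.integral_add_adjacent_intervals
    (hsub 0 ε le_rfl hε.le (hεr.le.trans hr)) (hsub ε r hε.le hεr.le hr)
  rw [← intervalIntegral.integral_of_le hεr.le]
  have h6 := H.integral_id_div_eq h0 hr
  rw [← integral_Ioc_eq_integral_Ioo, ← intervalIntegral.integral_of_le h0.le] at h6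
  have h7 : r ^ 2 / (2 * Phi φ r) = 2 * (r ^ 2 / (4 * Phi φ r)) := by field_simp; ring
  linarith

end HKAssumptions

/-- Tail integral of `s^(γ-1)/h(s)` for a function `h` with lower scaling of order `α > γ`. -/
lemma integral_rpow_div_le {h : ℝ → ℝ} {c α γ ρ : ℝ} (hc : 0 < c) (hγ : γ < α) (hρ : 0 < ρ)
    (hh : 0 < h ρ) (hs : ∀ s, ρ ≤ s → s ≤ 1 → c * (s / ρ) ^ α * h ρ ≤ h s) :
    ∫ s in Ioc ρ 1, s ^ (γ - 1) / h s ≤ 1 / (c * (α - γ)) * (ρ ^ γ / h ρ) := by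
  have hαγ : 0 < α - γ := sub_pos.2 hγ
  have hInt : IntegrableOn (fun s : ℝ => s ^ (γ - 1 - α)) (Ioi ρ) :=
    integrableOn_Ioi_rpow_of_lt (by linarith) hρ
  have h1 : ∫ s in Ioc ρ 1, s ^ (γ - 1) / h s ≤
      ∫ s in Ioc ρ 1, ρ ^ α / (c * h ρ) * s ^ (γ - 1 - α) := by
    apply integral_mono_of_nonneg
    · filter_upwards [ae_restrict_mem measurableSet_Ioc] with s hs'
      have h0 := hρ.trans hs'.1
      have : 0 < h s := lt_of_lt_of_le (by positivity) (hs s hs'.1.le hs'.2)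
      simp only [Pi.zero_apply]
      positivity
    · exact (hInt.mono_set Ioc_subset_Ioi_self).const_mul _
    · filter_upwards [ae_restrict_mem measurableSet_Ioc] with s hs'
      have h0 := hρ.trans hs'.1
      have h2 := hs s hs'.1.le hs'.2
      calc s ^ (γ - 1) / h s ≤ s ^ (γ - 1) / (c * (s / ρ) ^ α * h ρ) := by
            gcongr
        _ = ρ ^ α / (c * h ρ) * s ^ (γ - 1 - α) := by
            rw [Real.div_rpow h0.le hρ.le, Real.rpow_sub h0 (γ - 1) α]
            have := Real.rpow_pos_of_pos h0 α
            have := Real.rpow_pos_of_pos hρ α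
            field_simp
  refine h1.trans ?_
  rw [integral_const_mul]
  have h2 : ∫ s in Ioc ρ 1, s ^ (γ - 1 - α) ≤ ∫ s in Ioi ρ, s ^ (γ - 1 - α) := by
    refine setIntegral_mono_set hInt ?_ Ioc_subset_Ioi_self.eventuallyLE
    filter_upwards [ae_restrict_mem measurableSet_Ioi] with s hs'
    exact Real.rpow_nonneg (hρ.trans hs').le _
  rw [integral_Ioi_rpow_of_lt (by linarith) hρ] at h2
  calc ρ ^ α / (c * h ρ) * ∫ s in Ioc ρ 1, s ^ (γ - 1 - α)
      ≤ ρ ^ α / (c * h ρ) * (-ρ ^ (γ - 1 - α + 1) / (γ - 1 - α + 1)) := by gcongr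
    _ = 1 / (c * (α - γ)) * (ρ ^ γ / h ρ) := by
      have : γ - 1 - α + 1 = γ - α := by ring
      rw [this, Real.rpow_sub hρ]
      have := Real.rpow_pos_of_pos hρ α
      have h3 : γ - α ≠ 0 := by linarith
      have h4 : α - γ ≠ 0 := by linarith
      have h5 : γ - α = -(α - γ) := by ring
      rw [h5]
      field_simp

/-! ### Radial integrals -/

/-- The annulus `{z | ε < ‖z‖ ≤ R}`. -/
def annulus (d : ℕ) (ε R : ℝ) : Set (EuclideanSpace ℝ (Fin d)) := {z | ‖z‖ ∈ Ioc ε R}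

/-- The surface measure of the unit sphere. -/
noncomputable def sphereConst (d : ℕ) : ℝ :=
  d * volume.real (Metric.ball (0 : EuclideanSpace ℝ (Fin d)) 1)

lemma measurableSet_annulus {ε R : ℝ} : MeasurableSet (annulus d ε R) :=
  measurable_norm measurableSet_Ioc

lemma measurableSet_norm_gt {ε : ℝ} :
    MeasurableSet {z : EuclideanSpace ℝ (Fin d) | ε < ‖z‖} :=
  measurable_norm measurableSet_Ioi

lemma annulus_subset {ε R : ℝ} : annulus d ε R ⊆ {z | ε < ‖z‖} := fun _ hz => hz.1

lemma norm_gt_eq_union {ε R : ℝ} (h : ε ≤ R) :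
    {z : EuclideanSpace ℝ (Fin d) | ε < ‖z‖} = annulus d ε R ∪ {z | R < ‖z‖} := by
  ext z
  simp only [annulus, mem_Ioc, mem_ofPred_eq, mem_union]
  constructor
  · intro h1
    rcases le_or_gt ‖z‖ R with h2 | h2
    · exact Or.inl ⟨h1, h2⟩
    · exact Or.inr h2
  · rintro (h1 | h1)
    · exact h1.1
    · exact h.trans_lt h1

lemma disjoint_annulus_norm_gt {ε R : ℝ} :
    Disjoint (annulus d ε R) {z : EuclideanSpace ℝ (Fin d) | R < ‖z‖} :=
  Set.disjoint_left.2 fun _ h1 h2 => not_lt.2 h1.2 h2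

lemma sphereConst_pos (hd : 1 ≤ d) : 0 < sphereConst d := by
  have h1 : (0:ℝ) < d := by exact_mod_cast hd
  have h2 : 0 < volume.real (Metric.ball (0 : EuclideanSpace ℝ (Fin d)) 1) :=
    ENNReal.toReal_pos (Metric.measure_ball_pos _ _ one_pos).ne' measure_ball_lt_top.ne
  exact mul_pos h1 h2

lemma nontrivial_euclideanSpace (hd : 1 ≤ d) : Nontrivial (EuclideanSpace ℝ (Fin d)) := by
  have : Nonempty (Fin d) := ⟨⟨0, hd⟩⟩
  infer_instance

/-- Polar coordinates for radial functions. -/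
lemma setIntegral_radial (hd : 1 ≤ d) {S : Set ℝ} (hS : MeasurableSet S) (hS0 : S ⊆ Ioi 0)
    (f : ℝ → ℝ) : ∫ z in {z : EuclideanSpace ℝ (Fin d) | ‖z‖ ∈ S}, f ‖z‖ =
      sphereConst d * ∫ y in S, y ^ (d - 1) * f y := by
  have := nontrivial_euclideanSpace hd
  have hm : MeasurableSet {z : EuclideanSpace ℝ (Fin d) | ‖z‖ ∈ S} := measurable_norm hS
  rw [← integral_indicator hm]
  have h1 : (fun z : EuclideanSpace ℝ (Fin d) => indicator {z | ‖z‖ ∈ S} (fun z => f ‖z‖) z) =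
      fun z => (indicator S f) ‖z‖ := by
    ext z
    by_cases hz : ‖z‖ ∈ S
    · rw [indicator_of_mem (by exact hz), indicator_of_mem hz]
    · rw [indicator_of_notMem (by exact hz), indicator_of_notMem hz]
  rw [h1, integral_fun_norm_addHaar volume (indicator S f)]
  simp only [finrank_euclideanSpace, Fintype.card_fin, nsmul_eq_mul, smul_eq_mul]
  have h2 : (fun y : ℝ => y ^ (d - 1) * indicator S f y) =
      indicator S (fun y => y ^ (d - 1) * f y) := by
    ext y
    by_cases hy : y ∈ S
    · simp [hy]
    · simp [hy]
  rw [h2, setIntegral_indicator hS, inter_eq_self_of_subset_right hS0, sphereConst]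
  ring

lemma integrable_exp_neg_norm_rpow (hd : 1 ≤ d) {c β : ℝ} (hc : 0 < c) (hβ : 0 < β) :
    Integrable (fun z : EuclideanSpace ℝ (Fin d) => Real.exp (-c * ‖z‖ ^ β)) := by
  have := nontrivial_euclideanSpace hd
  rw [integrable_fun_norm_addHaar volume (f := fun y => Real.exp (-c * y ^ β))]
  simp only [finrank_euclideanSpace, Fintype.card_fin, smul_eq_mul]
  have h := integrableOn_rpow_mul_exp_neg_mul_rpow (p := β) (s := ((d - 1 : ℕ) : ℝ)) (b := c)
    (lt_of_lt_of_le (by norm_num) (Nat.cast_nonneg _)) hβ hc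
  simpa only [Real.rpow_natCast] using h

/-- Radial integrals over annuli are invariant under linear isometries. -/
lemma setIntegral_annulus_comp (R : EuclideanSpace ℝ (Fin d) ≃ₗᵢ[ℝ] EuclideanSpace ℝ (Fin d))
    {ε ρ : ℝ} (f : EuclideanSpace ℝ (Fin d) → ℝ) :
    ∫ z in annulus d ε ρ, f (R z) = ∫ z in annulus d ε ρ, f z := by
  have h := R.measurePreserving.setIntegral_preimage_emb
    R.toHomeomorph.measurableEmbedding f (annulus d ε ρ)
  have h2 : R ⁻¹' (annulus d ε ρ) = annulus d ε ρ := by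
    ext z
    simp [annulus]
  rwa [h2] at h

/-- If the symmetrization of `f` is dominated by `B`, then so is its integral against an even
weight. -/
lemma setIntegral_annulus_symm_le {ε ρ : ℝ} {f B q : EuclideanSpace ℝ (Fin d) → ℝ}
    (hf : IntegrableOn (fun z => f z * q z) (annulus d ε ρ))
    (hB : IntegrableOn (fun z => B z * q z) (annulus d ε ρ))
    (hq : ∀ z, q (-z) = q z) (hq0 : ∀ z ∈ annulus d ε ρ, 0 ≤ q z)
    (h : ∀ z ∈ annulus d ε ρ, f z + f (-z) ≤ 2 * B z) :
    ∫ z in annulus d ε ρ, f z * q z ≤ ∫ z in annulus d ε ρ, B z * q z := by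
  have h1 := setIntegral_annulus_comp (LinearIsometryEquiv.neg ℝ) (ε := ε) (ρ := ρ)
    (fun z => f z * q z)
  simp only [LinearIsometryEquiv.coe_neg, hq] at h1
  have hf' : IntegrableOn (fun z => f (-z) * q z) (annulus d ε ρ) := by
    have h2 := ((LinearIsometryEquiv.neg ℝ
      (E := EuclideanSpace ℝ (Fin d))).measurePreserving.integrableOn_comp_preimage
      (LinearIsometryEquiv.neg ℝ).toHomeomorph.measurableEmbedding
      (f := fun z => f z * q z) (s := annulus d ε ρ)).2 hf
    have h3 : (LinearIsometryEquiv.neg ℝ (E := EuclideanSpace ℝ (Fin d))) ⁻¹' (annulus d ε ρ) =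
        annulus d ε ρ := by
      ext z
      simp [annulus]
    rw [h3] at h2
    refine h2.congr_fun (fun z _ => ?_) measurableSet_annulus
    simp [Function.comp, hq]
  have h4 : ∫ z in annulus d ε ρ, (f z * q z + f (-z) * q z) ≤
      ∫ z in annulus d ε ρ, 2 * (B z * q z) := by
    refine setIntegral_mono_on (hf.add hf') (hB.const_mul 2) measurableSet_annulus fun z hz => ?_
    have := mul_le_mul_of_nonneg_right (h z hz) (hq0 z hz)
    linarith
  rw [integral_add hf hf', h1, integral_const_mul] at h4
  linarith

namespace HKAssumptions

lemma J_nonneg (H : HKAssumptions d φ J a₁ α₁ C₀ a b β κ κ₀ κ₁ κ₂ δ) {ε : ℝ} (hε : 0 ≤ ε)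
    {z : EuclideanSpace ℝ (Fin d)} (hz : z ∈ {z : EuclideanSpace ℝ (Fin d) | ε < ‖z‖}) :
    0 ≤ J ‖z‖ := (H.J_pos _ (hε.trans_lt hz)).le

lemma aestronglyMeasurable_J (H : HKAssumptions d φ J a₁ α₁ C₀ a b β κ κ₀ κ₁ κ₂ δ) {ε : ℝ}
    (hε : 0 ≤ ε) : AEStronglyMeasurable (fun z : EuclideanSpace ℝ (Fin d) => J ‖z‖)
      (volume.restrict {z | ε < ‖z‖}) := by
  refine ContinuousOn.aestronglyMeasurable ?_ measurableSet_norm_gt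
  exact H.J_cont.comp continuous_norm.continuousOn fun z hz => hε.trans_lt hz

lemma J_le_exp (H : HKAssumptions d φ J a₁ α₁ C₀ a b β κ κ₀ κ₁ κ₂ δ) {ε : ℝ} (hε : 0 < ε) :
    ∃ C, 0 < C ∧ ∀ s, ε ≤ s → J s ≤ C * Real.exp (-b * s ^ β) := by
  have ha := H.ha
  have hJ := H.J_pos ε hε
  refine ⟨a + J ε * Real.exp b, by positivity, fun s hs => ?_⟩
  rcases lt_or_ge 1 s with h | h
  · refine (H.hJ1_exp s h).trans ?_
    gcongr
    have : 0 < J ε * Real.exp b := by positivity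
    linarith
  · have h1 : J s ≤ J ε := H.J_anti hε (hε.trans_le hs) hs
    have h2 : s ^ β ≤ 1 := Real.rpow_le_one (hε.le.trans hs) h H.β_pos.le
    have h3 : (1:ℝ) ≤ Real.exp b * Real.exp (-b * s ^ β) := by
      rw [← Real.exp_add, Real.one_le_exp_iff]
      nlinarith [H.hb]
    have h4 : 0 < Real.exp (-b * s ^ β) := Real.exp_pos _
    nlinarith

lemma integrableOn_J (H : HKAssumptions d φ J a₁ α₁ C₀ a b β κ κ₀ κ₁ κ₂ δ) {ε : ℝ}
    (hε : 0 < ε) : IntegrableOn (fun z : EuclideanSpace ℝ (Fin d) => J ‖z‖) {z | ε < ‖z‖} := by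
  obtain ⟨C, hC, h⟩ := H.J_le_exp hε
  refine Integrable.mono' ((integrable_exp_neg_norm_rpow H.hd H.hb H.β_pos).const_mul
    C).integrableOn (H.aestronglyMeasurable_J hε.le) ?_
  filter_upwards [ae_restrict_mem measurableSet_norm_gt] with z hz
  rw [Real.norm_of_nonneg (H.J_nonneg hε.le hz)]
  exact h _ (le_of_lt hz)

/-- Bounded measurable functions are integrable against the jump kernel away from the origin. -/
lemma integrableOn_mul_J (H : HKAssumptions d φ J a₁ α₁ C₀ a b β κ κ₀ κ₁ κ₂ δ) {ε B : ℝ}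
    (hε : 0 < ε) {S : Set (EuclideanSpace ℝ (Fin d))} (hS : S ⊆ {z | ε < ‖z‖})
    (hSm : MeasurableSet S) {f : EuclideanSpace ℝ (Fin d) → ℝ}
    (hf : AEStronglyMeasurable f (volume.restrict S)) (hB : ∀ z ∈ S, |f z| ≤ B) :
    IntegrableOn (fun z => f z * J ‖z‖) S := by
  refine Integrable.bdd_mul (c := B) ((H.integrableOn_J hε).mono_set hS) hf ?_
  filter_upwards [ae_restrict_mem hSm] with z hz
  exact hB z hz

lemma integral_sq_mul_J_le (H : HKAssumptions d φ J a₁ α₁ C₀ a b β κ κ₀ κ₁ κ₂ δ) :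
    ∃ C, 0 < C ∧ ∀ ε R, 0 < ε → 0 < R → R ≤ 1 →
      ∫ z in annulus d ε R, ‖z‖ ^ 2 * J ‖z‖ ≤ C * (R ^ 2 / Phi φ R) := by
  have hσ := sphereConst_pos H.hd
  have ha : 0 < a := one_pos.trans_le H.ha
  refine ⟨sphereConst d * a, by positivity, fun ε R hε hR hR1 => ?_⟩
  have hP := H.Phi_pos hR
  have h0 := setIntegral_radial H.hd (S := Ioc ε R) measurableSet_Ioc
    (fun y hy => hε.trans hy.1) (fun y => y ^ 2 * J y)
  rw [annulus, h0]
  have h1 : ∫ y in Ioc ε R, y ^ (d - 1) * (y ^ 2 * J y) ≤ ∫ y in Ioc ε R, a * (y / φ y) := by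
    apply integral_mono_of_nonneg
    · filter_upwards [ae_restrict_mem measurableSet_Ioc] with y hy
      have := hε.trans hy.1
      have := H.J_pos y this
      simp only [Pi.zero_apply]
      positivity
    · refine Integrable.const_mul ?_ _
      have h := H.integrableOn_id_div hR1
      rw [← integrableOn_Ioc_iff_integrableOn_Ioo] at h
      exact h.mono_set (Ioc_subset_Ioc_left hε.le)
    · filter_upwards [ae_restrict_mem measurableSet_Ioc] with y hy
      have hy0 := hε.trans hy.1
      have hφ := H.phi_pos hy0 (hy.2.trans hR1)
      have h2 := H.hJ1_up y hy0 (hy.2.trans hR1)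
      calc y ^ (d - 1) * (y ^ 2 * J y) ≤ y ^ (d - 1) * (y ^ 2 * (a / (y ^ d * φ y))) := by gcongr
        _ = a * (y / φ y) := by
          obtain ⟨k, rfl⟩ : ∃ k, d = k + 1 := ⟨d - 1, (Nat.sub_add_cancel H.hd).symm⟩
          simp only [Nat.add_sub_cancel]
          field_simp
          ring
  have h2 : ∫ y in Ioc ε R, y / φ y ≤ ∫ y in Ioo 0 R, y / φ y := by
    rw [← integral_Ioc_eq_integral_Ioo]
    have h := H.integrableOn_id_div hR1
    rw [← integrableOn_Ioc_iff_integrableOn_Ioo] at h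
    refine setIntegral_mono_set h ?_ (Ioc_subset_Ioc_left hε.le).eventuallyLE
    filter_upwards [ae_restrict_mem measurableSet_Ioc] with s hs
    exact (div_pos hs.1 (H.phi_pos hs.1 (hs.2.trans hR1))).le
  rw [integral_const_mul] at h1
  rw [H.integral_id_div_eq hR hR1] at h2
  have h3 : R ^ 2 / (2 * Phi φ R) ≤ R ^ 2 / Phi φ R := by
    apply div_le_div_of_nonneg_left (by positivity) hP; linarith
  rw [mul_assoc]
  refine mul_le_mul_of_nonneg_left ?_ hσ.le
  exact h1.trans (mul_le_mul_of_nonneg_left (h2.trans h3) ha.le)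

lemma le_integral_sq_mul_J (H : HKAssumptions d φ J a₁ α₁ C₀ a b β κ κ₀ κ₁ κ₂ δ) :
    ∃ c, 0 < c ∧ ∀ R, 0 < R → R ≤ 1 → ∃ ε₀, 0 < ε₀ ∧ ∀ ε, 0 < ε → ε < ε₀ →
      c * (R ^ 2 / Phi φ R) ≤ ∫ z in annulus d ε R, ‖z‖ ^ 2 * J ‖z‖ := by
  have hσ := sphereConst_pos H.hd
  have ha : 0 < a := one_pos.trans_le H.ha
  refine ⟨sphereConst d * a⁻¹ / 4, by positivity, fun R hR hR1 => ?_⟩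
  obtain ⟨ε₀, hε₀, hε₀'⟩ := H.exists_integral_ge hR hR1
  refine ⟨ε₀, hε₀, fun ε hε hεε => ?_⟩
  have h0 := setIntegral_radial H.hd (S := Ioc ε R) measurableSet_Ioc
    (fun y hy => hε.trans hy.1) (fun y => y ^ 2 * J y)
  rw [annulus, h0]
  have h1 : ∫ y in Ioc ε R, a⁻¹ * (y / φ y) ≤ ∫ y in Ioc ε R, y ^ (d - 1) * (y ^ 2 * J y) := by
    apply integral_mono_of_nonneg
    · filter_upwards [ae_restrict_mem measurableSet_Ioc] with y hy
      have := hε.trans hy.1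
      have := H.phi_pos this (hy.2.trans hR1)
      simp only [Pi.zero_apply]
      positivity
    · refine IntegrableOn.mono_set (t := Icc ε R) ?_ Ioc_subset_Icc_self
      refine ContinuousOn.integrableOn_Icc ?_
      refine (continuous_pow _).continuousOn.mul ((continuous_pow _).continuousOn.mul ?_)
      exact H.J_cont.mono fun y hy => hε.trans_le hy.1
    · filter_upwards [ae_restrict_mem measurableSet_Ioc] with y hy
      have hy0 := hε.trans hy.1
      have hφ := H.phi_pos hy0 (hy.2.trans hR1)
      have h2 := H.hJ1_low y hy0 (hy.2.trans hR1)
      calc a⁻¹ * (y / φ y) = y ^ (d - 1) * (y ^ 2 * (a⁻¹ / (y ^ d * φ y))) := by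
            obtain ⟨k, rfl⟩ : ∃ k, d = k + 1 := ⟨d - 1, (Nat.sub_add_cancel H.hd).symm⟩
            simp only [Nat.add_sub_cancel]
            field_simp
            ring
        _ ≤ _ := by gcongr
  rw [integral_const_mul] at h1
  have h2 := hε₀' ε hε hεε
  calc sphereConst d * a⁻¹ / 4 * (R ^ 2 / Phi φ R)
      = sphereConst d * (a⁻¹ * (R ^ 2 / (4 * Phi φ R))) := by
        rw [show R ^ 2 / (4 * Phi φ R) = R ^ 2 / Phi φ R / 4 by ring]; ring
    _ ≤ sphereConst d * (a⁻¹ * ∫ s in Ioc ε R, s / φ s) := by gcongr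
    _ ≤ _ := by gcongr

lemma integral_rpow_mul_J_le (H : HKAssumptions d φ J a₁ α₁ C₀ a b β κ κ₀ κ₁ κ₂ δ) {γ : ℝ}
    (hγ : γ < α₁) : ∃ C, 0 < C ∧ ∀ ρ, 0 < ρ → ρ ≤ 1 →
      ∫ z in annulus d ρ 1, ‖z‖ ^ γ * J ‖z‖ ≤ C * (ρ ^ γ / Phi φ ρ) := by
  have hσ := sphereConst_pos H.hd
  have ha : 0 < a := one_pos.trans_le H.ha
  have ha1 := H.a₁_pos
  have hγ' : 0 < α₁ - γ := sub_pos.2 hγ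
  refine ⟨sphereConst d * (a * (1 / (a₁ * (α₁ - γ)))), by positivity, fun ρ hρ hρ1 => ?_⟩
  have hP := H.Phi_pos hρ
  have hφρ := H.phi_pos hρ hρ1
  have h0 := setIntegral_radial H.hd (S := Ioc ρ 1) measurableSet_Ioc
    (fun y hy => hρ.trans hy.1) (fun y => y ^ γ * J y)
  rw [annulus, h0]
  have h1 : ∫ y in Ioc ρ 1, y ^ (d - 1) * (y ^ γ * J y) ≤
      ∫ y in Ioc ρ 1, a * (y ^ (γ - 1) / φ y) := by
    apply integral_mono_of_nonneg
    · filter_upwards [ae_restrict_mem measurableSet_Ioc] with y hy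
      have := hρ.trans hy.1
      have := H.J_pos y this
      simp only [Pi.zero_apply]
      positivity
    · refine Integrable.const_mul ?_ _
      refine IntegrableOn.mono_set (t := Icc ρ 1) ?_ Ioc_subset_Icc_self
      refine ContinuousOn.integrableOn_Icc ?_
      refine ContinuousOn.div ?_ (H.φ_cont.mono (Icc_subset_Icc_left hρ.le)) fun y hy =>
        (H.phi_pos (hρ.trans_le hy.1) hy.2).ne'
      exact continuousOn_id.rpow_const fun y hy => Or.inl (hρ.trans_le hy.1).ne'
    · filter_upwards [ae_restrict_mem measurableSet_Ioc] with y hy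
      have hy0 := hρ.trans hy.1
      have hφ := H.phi_pos hy0 hy.2
      have h2 := H.hJ1_up y hy0 hy.2
      calc y ^ (d - 1) * (y ^ γ * J y) ≤ y ^ (d - 1) * (y ^ γ * (a / (y ^ d * φ y))) := by gcongr
        _ = a * (y ^ (γ - 1) / φ y) := by
          obtain ⟨k, rfl⟩ : ∃ k, d = k + 1 := ⟨d - 1, (Nat.sub_add_cancel H.hd).symm⟩
          rw [Real.rpow_sub hy0, Real.rpow_one]
          simp only [Nat.add_sub_cancel]
          field_simp
          ring
  rw [integral_const_mul] at h1
  have h2 := integral_rpow_div_le (h := φ) ha1 hγ hρ hφρ fun s h1 h2 => by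
    have := H.hLS ρ s hρ h1 h2
    rwa [le_div_iff₀ hφρ] at this
  have h3 : ρ ^ γ / φ ρ ≤ ρ ^ γ / Phi φ ρ :=
    div_le_div_of_nonneg_left (by positivity) hP (H.Phi_le_phi hρ hρ1)
  rw [mul_assoc]
  refine mul_le_mul_of_nonneg_left (h1.trans ?_) hσ.le
  rw [mul_assoc]
  refine mul_le_mul_of_nonneg_left (h2.trans ?_) ha.le
  exact mul_le_mul_of_nonneg_left h3 (by positivity)

lemma integral_J_le (H : HKAssumptions d φ J a₁ α₁ C₀ a b β κ κ₀ κ₁ κ₂ δ) :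
    ∃ C, 0 < C ∧ ∀ ρ, 0 < ρ → ρ ≤ 1 →
      ∫ z in {z : EuclideanSpace ℝ (Fin d) | ρ < ‖z‖}, J ‖z‖ ≤ C / Phi φ ρ := by
  obtain ⟨C, hC, h⟩ := H.integral_rpow_mul_J_le H.α₁_pos
  have hP1 := H.Phi_pos one_pos
  set I := ∫ z in {z : EuclideanSpace ℝ (Fin d) | 1 < ‖z‖}, J ‖z‖ with hI
  have hI0 : 0 ≤ I := setIntegral_nonneg measurableSet_norm_gt fun z hz =>
    H.J_nonneg zero_le_one hz
  refine ⟨C + I * Phi φ 1, by positivity, fun ρ hρ hρ1 => ?_⟩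
  have hP := H.Phi_pos hρ
  have hInt := H.integrableOn_J hρ
  rw [norm_gt_eq_union hρ1] at hInt ⊢
  rw [setIntegral_union disjoint_annulus_norm_gt measurableSet_norm_gt
    (hInt.mono_set subset_union_left) (hInt.mono_set subset_union_right), ← hI, add_div]
  have h1 := h ρ hρ hρ1
  simp only [Real.rpow_zero, one_mul] at h1
  refine add_le_add (h1.trans_eq (by ring)) ?_
  rw [le_div_iff₀ hP]
  exact mul_le_mul_of_nonneg_left (H.Phi_mono hρ hρ1) hI0

end HKAssumptions

/-- By rotational symmetry the second moments of a radial kernel in all directions coincide. -/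
lemma setIntegral_annulus_inner_sq (hd : 1 ≤ d) {ε ρ : ℝ} (J : ℝ → ℝ)
    (e : EuclideanSpace ℝ (Fin d)) (he : ‖e‖ = 1)
    (hInt : ∀ v : EuclideanSpace ℝ (Fin d),
      IntegrableOn (fun z => inner ℝ v z ^ 2 * J ‖z‖) (annulus d ε ρ)) :
    ∫ z in annulus d ε ρ, inner ℝ e z ^ 2 * J ‖z‖ =
      1 / d * ∫ z in annulus d ε ρ, ‖z‖ ^ 2 * J ‖z‖ := by
  have hd0 : (d : ℝ) ≠ 0 := by positivity
  let B := EuclideanSpace.basisFun (Fin d) ℝ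
  have h1 : ∀ i, ∫ z in annulus d ε ρ, inner ℝ (B i) z ^ 2 * J ‖z‖ =
      ∫ z in annulus d ε ρ, inner ℝ e z ^ 2 * J ‖z‖ := by
    intro i
    have hn : ‖B i‖ = ‖e‖ := by rw [he]; exact B.norm_eq_one i
    let R := (Submodule.span ℝ {B i - e})ᗮ.reflection
    have hR : R (B i) = e := Submodule.reflection_sub hn
    rw [← setIntegral_annulus_comp R (fun z => inner ℝ e z ^ 2 * J ‖z‖)]
    congr 1
    ext z
    rw [LinearIsometryEquiv.norm_map, ← hR, LinearIsometryEquiv.inner_map_map]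
  have h2 : ∫ z in annulus d ε ρ, ‖z‖ ^ 2 * J ‖z‖ =
      ∑ i, ∫ z in annulus d ε ρ, inner ℝ (B i) z ^ 2 * J ‖z‖ := by
    rw [← integral_finsetSum _ fun i _ => hInt (B i)]
    congr 1
    ext z
    rw [← Finset.sum_mul, ← B.sum_sq_inner_right z]
  rw [h2, Finset.sum_congr rfl fun i _ => h1 i]
  simp
  field_simp

/-! ### Concave moduli of continuity -/

/-- A concave modulus comparable with `s^γ` and quantitatively concave with respect to
`s^(γ+η)`. -/
structure ConcaveModulus (γ η c : ℝ) (ω : ℝ → ℝ) : Prop where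
  zero : ω 0 = 0
  cont : Continuous ω
  concave : ConcaveOn ℝ (Icc 0 1) ω
  mono : MonotoneOn ω (Icc 0 1)
  le_rpow : ∀ s ∈ Icc (0:ℝ) 1, ω s ≤ s ^ γ
  rpow_le : ∀ s ∈ Icc (0:ℝ) 1, s ^ γ / 2 ≤ ω s
  second_diff : ∀ s σ : ℝ, 0 < s → s ≤ 1 → |σ| ≤ s / 2 →
    ω (s + σ) + ω (s - σ) - 2 * ω s ≤ -c * s ^ (γ + η) * (σ / s) ^ 2

lemma rpow_second_diff_le {s p k τ : ℝ} (hp0 : 0 < p) (hp2 : p ≤ 2) (hk : 0 ≤ k)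
    (h : s * (p * (p - 1)) ≤ -(8 * k)) (hτ : |τ| ≤ 1 / 2) :
    s * ((1 + τ) ^ p + (1 - τ) ^ p - 2) ≤ -(2 * k) * τ ^ 2 := by
  have hconc : ConcaveOn ℝ (Icc (1/2) (3/2)) (fun x : ℝ => s * x ^ p + k * x ^ 2) := by
    have hd1 : ∀ x : ℝ, x ∈ Ioo (1/2:ℝ) (3/2) →
        HasDerivAt (fun x : ℝ => s * x ^ p + k * x ^ 2) (s * (p * x ^ (p - 1)) + k * (2 * x)) x := by
      intro x hx
      have hx0 : x ≠ 0 := by have := hx.1; positivity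
      have h1 := (Real.hasDerivAt_rpow_const (p := p) (Or.inl hx0)).const_mul s
      have h2 := ((hasDerivAt_pow 2 x)).const_mul k
      exact (h1.add h2).congr_deriv (by norm_num)
    have hd2 : ∀ x : ℝ, x ∈ Ioo (1/2:ℝ) (3/2) →
        HasDerivAt (fun x : ℝ => s * (p * x ^ (p - 1)) + k * (2 * x))
          (s * (p * ((p - 1) * x ^ (p - 1 - 1))) + k * (2 * 1)) x := by
      intro x hx
      have hx0 : x ≠ 0 := by have := hx.1; positivity
      have h1 := ((Real.hasDerivAt_rpow_const (p := p - 1) (Or.inl hx0)).const_mul p).const_mul s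
      have h2 := ((hasDerivAt_id x).const_mul 2).const_mul k
      exact h1.add h2
    refine concaveOn_of_hasDerivWithinAt2_nonpos (convex_Icc _ _) ?_
      (f' := fun x => s * (p * x ^ (p - 1)) + k * (2 * x))
      (f'' := fun x => s * (p * ((p - 1) * x ^ (p - 1 - 1))) + k * (2 * 1)) ?_ ?_ ?_
    · refine Continuous.continuousOn ?_
      have := Real.continuous_rpow_const (q := p) hp0.le
      fun_prop
    · rw [interior_Icc]
      exact fun x hx => (hd1 x hx).hasDerivWithinAt
    · rw [interior_Icc]
      exact fun x hx => (hd2 x hx).hasDerivWithinAt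
    · rw [interior_Icc]
      intro x hx
      have hx0 : 0 < x := by have := hx.1; linarith
      have h4 : (1/4 : ℝ) ≤ x ^ (p - 1 - 1) := by
        rcases le_total x 1 with hx1 | hx1
        · have := Real.one_le_rpow_of_pos_of_le_one_of_nonpos hx0 hx1
            (show p - 1 - 1 ≤ 0 by linarith)
          linarith
        · calc (1/4:ℝ) ≤ (x ^ 2)⁻¹ := by
                rw [one_div]
                have := hx.2
                apply inv_anti₀ (by positivity)
                nlinarith
            _ = x ^ (-2 : ℝ) := by rw [Real.rpow_neg hx0.le]; norm_num
            _ ≤ x ^ (p - 1 - 1) := Real.rpow_le_rpow_of_exponent_le hx1 (by linarith)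
      calc s * (p * ((p - 1) * x ^ (p - 1 - 1))) + k * (2 * 1)
          = s * (p * (p - 1)) * x ^ (p - 1 - 1) + 2 * k := by ring
        _ ≤ -(8 * k) * x ^ (p - 1 - 1) + 2 * k := by gcongr
        _ ≤ 0 := by nlinarith
  have hτ' := abs_le.1 hτ
  have h1 := hconc.2 (show 1 + τ ∈ Icc (1/2) (3/2) from ⟨by linarith, by linarith⟩)
    (show 1 - τ ∈ Icc (1/2) (3/2) from ⟨by linarith, by linarith⟩)
    (show (0:ℝ) ≤ 1/2 by norm_num) (show (0:ℝ) ≤ 1/2 by norm_num) (by norm_num)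
  simp only [smul_eq_mul] at h1
  rw [show (1/2 * (1 + τ) + 1/2 * (1 - τ) : ℝ) = 1 by ring, Real.one_rpow] at h1
  nlinarith

lemma rpow_second_diff_scale {s p k x σ : ℝ} (hp0 : 0 < p) (hp2 : p ≤ 2) (hk : 0 ≤ k)
    (h : s * (p * (p - 1)) ≤ -(8 * k)) (hx : 0 < x) (hσ : |σ| ≤ x / 2) :
    s * ((x + σ) ^ p + (x - σ) ^ p - 2 * x ^ p) ≤ -(2 * k) * x ^ p * (σ / x) ^ 2 := by
  have hτ : |σ / x| ≤ 1 / 2 := by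
    rw [abs_div, abs_of_pos hx, div_le_iff₀ hx]; linarith
  have h1 := rpow_second_diff_le hp0 hp2 hk h hτ
  have h2 := abs_le.1 hτ
  have e1 : (x + σ) ^ p = x ^ p * (1 + σ / x) ^ p := by
    rw [← Real.mul_rpow hx.le (by linarith)]; congr 1; field_simp
  have e2 : (x - σ) ^ p = x ^ p * (1 - σ / x) ^ p := by
    rw [← Real.mul_rpow hx.le (by linarith)]; congr 1; field_simp
  rw [e1, e2]
  have h3 : 0 < x ^ p := Real.rpow_pos_of_pos hx p
  calc s * (x ^ p * (1 + σ / x) ^ p + x ^ p * (1 - σ / x) ^ p - 2 * x ^ p)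
      = x ^ p * (s * ((1 + σ / x) ^ p + (1 - σ / x) ^ p - 2)) := by ring
    _ ≤ x ^ p * (-(2 * k) * (σ / x) ^ 2) := by gcongr
    _ = _ := by ring

lemma exists_concaveModulus {γ η : ℝ} (hγ0 : 0 < γ) (hγ1 : γ ≤ 1) (hη0 : 0 < η) (hη1 : η ≤ 1) :
    ∃ c ω, 0 < c ∧ ConcaveModulus γ η c ω := by
  rcases hγ1.lt_or_eq with hγ | rfl
  · refine ⟨γ * (1 - γ) / 4, fun s => s ^ γ, by have := sub_pos.2 hγ; positivity, ?_⟩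
    refine ⟨Real.zero_rpow hγ0.ne', Real.continuous_rpow_const hγ0.le,
      (Real.concaveOn_rpow hγ0.le hγ1).subset Icc_subset_Ici_self (convex_Icc _ _),
      fun x hx y _ hxy => Real.rpow_le_rpow hx.1 hxy hγ0.le, fun s _ => le_rfl,
      fun s hs => by have := Real.rpow_nonneg hs.1 γ; linarith, fun s σ hs hs1 hσ => ?_⟩
    have h1 := rpow_second_diff_scale (s := 1) (p := γ) (k := γ * (1 - γ) / 8) hγ0 (by linarith)
      (by have := sub_pos.2 hγ; positivity) (by linarith) hs hσ
    have h2 : s ^ (γ + η) ≤ s ^ γ := Real.rpow_le_rpow_of_exponent_ge hs hs1 (by linarith)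
    have h3 : 0 ≤ γ * (1 - γ) / 4 * (σ / s) ^ 2 := by have := sub_pos.2 hγ; positivity
    nlinarith
  · have hcont : Continuous fun s : ℝ => s - s ^ (1 + η) / 2 := by
      have := Real.continuous_rpow_const (q := 1 + η) (by linarith)
      fun_prop
    have hle : ∀ s ∈ Icc (0:ℝ) 1, s ^ (1 + η) ≤ s := fun s hs => by
      rcases hs.1.eq_or_lt with rfl | h0
      · rw [Real.zero_rpow (by linarith)]
      · exact (Real.rpow_le_rpow_of_exponent_ge h0 hs.2 (by linarith)).trans_eq (Real.rpow_one s)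
    refine ⟨(1 + η) * η / 8, fun s => s - s ^ (1 + η) / 2, by positivity, ?_⟩
    refine ⟨by simp [Real.zero_rpow (show (1 + η) ≠ 0 by linarith)], hcont, ?_, ?_, ?_, ?_, ?_⟩
    · have h1 : ConvexOn ℝ (Icc (0:ℝ) 1) fun s : ℝ => s ^ (1 + η) :=
        (convexOn_rpow (by linarith)).subset Icc_subset_Ici_self (convex_Icc _ _)
      have h2 := h1.smul (show (0:ℝ) ≤ 1/2 by norm_num)
      have h3 := (concaveOn_id (𝕜 := ℝ) (convex_Icc (0:ℝ) 1)).sub h2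
      refine h3.congr fun s _ => ?_
      simp only [Pi.sub_apply, id, smul_eq_mul]
      ring
    · refine monotoneOn_of_deriv_nonneg (convex_Icc _ _) hcont.continuousOn ?_ ?_
      · rw [interior_Icc]
        intro x hx
        refine DifferentiableAt.differentiableWithinAt ?_
        exact (differentiableAt_id.sub
          ((Real.differentiableAt_rpow_const_of_ne _ hx.1.ne').div_const 2))
      · rw [interior_Icc]
        intro x hx
        have h1 := (hasDerivAt_id x).sub
          ((Real.hasDerivAt_rpow_const (p := 1 + η) (Or.inl hx.1.ne')).div_const 2)
        have h2 : deriv (fun s : ℝ => s - s ^ (1 + η) / 2) x = 1 - (1 + η) * x ^ (1 + η - 1) / 2 :=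
          h1.deriv
        rw [h2]
        have h3 : x ^ (1 + η - 1) ≤ 1 := Real.rpow_le_one hx.1.le hx.2.le (by linarith)
        nlinarith
    · intro s hs
      rw [Real.rpow_one]
      have := Real.rpow_nonneg hs.1 (1 + η)
      linarith
    · intro s hs
      rw [Real.rpow_one]
      have := hle s hs
      linarith
    · intro s σ hs hs1 hσ
      have h1 := rpow_second_diff_scale (s := -1) (p := 1 + η) (k := (1 + η) * η / 8) (by linarith)
        (by linarith) (by positivity) (by linarith) hs hσ
      linarith

namespace ConcaveModulus

variable {γ η c : ℝ} {ω : ℝ → ℝ}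

lemma nonneg (hω : ConcaveModulus γ η c ω) {s : ℝ} (hs : s ∈ Icc (0:ℝ) 1) : 0 ≤ ω s := by
  have := hω.mono (show (0:ℝ) ∈ Icc (0:ℝ) 1 by simp) hs hs.1
  rwa [hω.zero] at this

/-- `ω(l s) ≤ l ω(s)` for `l ≥ 1`. -/
lemma scale_le (hω : ConcaveModulus γ η c ω) {l s : ℝ} (hl : 1 ≤ l) (hs : 0 ≤ s)
    (hls : l * s ≤ 1) : ω (l * s) ≤ l * ω s := by
  have hl0 : 0 < l := by linarith
  have h := hω.concave.2 (show l * s ∈ Icc (0:ℝ) 1 from ⟨by positivity, hls⟩)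
    (show (0:ℝ) ∈ Icc (0:ℝ) 1 by simp) (show 0 ≤ 1 / l by positivity)
    (show 0 ≤ 1 - 1 / l by rw [sub_nonneg, div_le_one hl0]; exact hl) (by ring)
  simp only [smul_eq_mul, hω.zero, mul_zero, add_zero] at h
  rw [show 1 / l * (l * s) = s by field_simp, one_div, inv_mul_le_iff₀ hl0] at h
  exact h

lemma subadd (hω : ConcaveModulus γ η c ω) {s t : ℝ} (hs : 0 ≤ s) (ht : 0 ≤ t)
    (hst : s + t ≤ 1) : ω (s + t) ≤ ω s + ω t := by
  rcases hs.eq_or_lt with rfl | hs0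
  · simp [hω.zero]
  rcases ht.eq_or_lt with rfl | ht0
  · simp [hω.zero]
  have e1 : (s + t) / s * s = s + t := by field_simp
  have e2 : (s + t) / t * t = s + t := by field_simp
  have h1 := hω.scale_le (l := (s + t) / s) (s := s) (by rw [one_le_div hs0]; linarith) hs
    (by rwa [e1])
  have h2 := hω.scale_le (l := (s + t) / t) (s := t) (by rw [one_le_div ht0]; linarith) ht
    (by rwa [e2])
  rw [e1, div_mul_eq_mul_div, le_div_iff₀ hs0] at h1
  rw [e2, div_mul_eq_mul_div, le_div_iff₀ ht0] at h2
  have hst0 : 0 < s + t := by linarith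
  by_contra hcon
  push Not at hcon
  nlinarith

lemma norm_add_le (hω : ConcaveModulus γ η c ω) {E : Type*} [NormedAddCommGroup E] {r : ℝ}
    (hr : 0 < r) {h z : E} (hz : ‖h‖ + ‖z‖ ≤ r) :
    ω (‖h + z‖ / r) - ω (‖h‖ / r) ≤ ω (‖z‖ / r) := by
  have h1 : ‖h‖ / r + ‖z‖ / r ≤ 1 := by rw [← add_div, div_le_one hr]; exact hz
  have h0 : ‖h + z‖ / r ≤ ‖h‖ / r + ‖z‖ / r := by
    rw [← add_div]; gcongr; exact _root_.norm_add_le h z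
  have h2 := hω.mono (a := ‖h + z‖ / r) (b := ‖h‖ / r + ‖z‖ / r)
    ⟨by positivity, h0.trans h1⟩ ⟨by positivity, h1⟩ h0
  have h3 := hω.subadd (s := ‖h‖ / r) (t := ‖z‖ / r) (by positivity) (by positivity) h1
  linarith

/-- Second differences of the radial function `ω(‖·‖/r)`. -/
lemma norm_second_diff_le (hω : ConcaveModulus γ η c ω) {E : Type*} [NormedAddCommGroup E]
    [InnerProductSpace ℝ E] {r : ℝ} (hr : 0 < r) {h z : E} (hh : h ≠ 0) (hz : ‖z‖ ≤ ‖h‖)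
    (hr2 : 2 * ‖h‖ ≤ r) :
    ω (‖h + z‖ / r) + ω (‖h - z‖ / r) - 2 * ω (‖h‖ / r) ≤
      ω (‖h‖ / r) * (‖z‖ ^ 2 / ‖h‖ ^ 2) := by
  have hh0 : 0 < ‖h‖ := norm_pos_iff.2 hh
  set A := (‖h + z‖ + ‖h - z‖) / 2 with hA
  set l := 1 + ‖z‖ ^ 2 / (2 * ‖h‖ ^ 2) with hl
  have hzh : ‖z‖ ^ 2 / (2 * ‖h‖ ^ 2) ≤ 1 / 2 := by
    rw [div_le_iff₀ (by positivity)]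
    nlinarith [norm_nonneg z]
  have hl0 : 0 ≤ ‖z‖ ^ 2 / (2 * ‖h‖ ^ 2) := by positivity
  have hAl : A ≤ l * ‖h‖ := by
    have hp := parallelogram_law_with_norm ℝ h z
    have h1 : A ^ 2 ≤ ‖h‖ ^ 2 + ‖z‖ ^ 2 := by
      rw [hA]; nlinarith [sq_nonneg (‖h + z‖ - ‖h - z‖)]
    have h2 : ‖h‖ ^ 2 + ‖z‖ ^ 2 ≤ (l * ‖h‖) ^ 2 := by
      have : l * ‖h‖ = ‖h‖ + ‖z‖ ^ 2 / (2 * ‖h‖) := by rw [hl]; field_simp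
      rw [this]
      have e : ‖h‖ * (‖z‖ ^ 2 / (2 * ‖h‖)) = ‖z‖ ^ 2 / 2 := by field_simp
      nlinarith [sq_nonneg (‖z‖ ^ 2 / (2 * ‖h‖))]
    have hl1 : 0 ≤ l * ‖h‖ := by positivity
    exact abs_le_of_sq_le_sq' (h1.trans h2) hl1 |>.2
  have hA0 : 0 ≤ A := by positivity
  have hlh : l * ‖h‖ ≤ r := by nlinarith
  have b1 : ‖h + z‖ ≤ r := (_root_.norm_add_le h z).trans (by linarith)
  have b2 : ‖h - z‖ ≤ r := (norm_sub_le h z).trans (by linarith)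
  have h1 := hω.concave.2
    (show ‖h + z‖ / r ∈ Icc (0:ℝ) 1 from ⟨by positivity, by rwa [div_le_one hr]⟩)
    (show ‖h - z‖ / r ∈ Icc (0:ℝ) 1 from ⟨by positivity, by rwa [div_le_one hr]⟩)
    (show (0:ℝ) ≤ 1/2 by norm_num) (show (0:ℝ) ≤ 1/2 by norm_num) (by norm_num)
  simp only [smul_eq_mul] at h1
  rw [show 1/2 * (‖h + z‖ / r) + 1/2 * (‖h - z‖ / r) = A / r by rw [hA]; ring] at h1
  have e1 : l * (‖h‖ / r) = l * ‖h‖ / r := by ring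
  have h2 : ω (A / r) ≤ ω (l * (‖h‖ / r)) := by
    rw [e1]
    refine hω.mono ⟨by positivity, ?_⟩ ⟨by positivity, ?_⟩ (by gcongr)
    · rw [div_le_one hr]; linarith
    · rw [div_le_one hr]; linarith
  have h3 := hω.scale_le (l := l) (s := ‖h‖ / r) (by rw [hl]; linarith) (by positivity)
    (by rw [e1, div_le_one hr]; exact hlh)
  have e2 : l * ω (‖h‖ / r) = ω (‖h‖ / r) + ω (‖h‖ / r) * (‖z‖ ^ 2 / ‖h‖ ^ 2) / 2 := by
    rw [hl]; field_simp
  linarith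

end ConcaveModulus

/-! ### The action of the jump kernel on a concave modulus -/

lemma annulus_union {ε ρ R : ℝ} (h1 : ε ≤ ρ) (h2 : ρ ≤ R) :
    annulus d ε R = annulus d ε ρ ∪ annulus d ρ R := by
  ext z
  simp only [annulus, mem_ofPred_eq, mem_union, ← Ioc_union_Ioc_eq_Ioc h1 h2]

lemma disjoint_annulus {ε ρ R : ℝ} : Disjoint (annulus d ε ρ) (annulus d ρ R) :=
  Set.disjoint_left.2 fun _ h1 h2 => not_lt.2 h1.2 h2.1

lemma ConcaveModulus.le_one {γ η c : ℝ} {ω : ℝ → ℝ} (hω : ConcaveModulus γ η c ω) (hγ : 0 < γ)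
    {s : ℝ} (hs : s ∈ Icc (0:ℝ) 1) : ω s ≤ 1 :=
  (hω.le_rpow s hs).trans (Real.rpow_le_one hs.1 hs.2 hγ.le)

lemma ConcaveModulus.abs_sub_le_one {γ η c : ℝ} {ω : ℝ → ℝ} (hω : ConcaveModulus γ η c ω)
    (hγ : 0 < γ) {s t : ℝ} (hs : s ∈ Icc (0:ℝ) 1) (ht : t ∈ Icc (0:ℝ) 1) : |ω s - ω t| ≤ 1 := by
  have h1 := hω.nonneg hs
  have h2 := hω.nonneg ht
  have h3 := hω.le_one hγ hs
  have h4 := hω.le_one hγ ht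
  exact abs_le.2 ⟨by linarith, by linarith⟩

namespace HKAssumptions

lemma integrableOn_mul_mul_J (H : HKAssumptions d φ J a₁ α₁ C₀ a b β κ κ₀ κ₁ κ₂ δ) {ε B Λ : ℝ}
    (hε : 0 < ε) {S : Set (EuclideanSpace ℝ (Fin d))} (hS : S ⊆ {z | ε < ‖z‖})
    (hSm : MeasurableSet S) {f q : EuclideanSpace ℝ (Fin d) → ℝ}
    (hf : AEStronglyMeasurable f (volume.restrict S)) (hB : ∀ z ∈ S, |f z| ≤ B)
    (hq : Measurable q) (hq0 : ∀ z, 0 ≤ q z) (hqΛ : ∀ z, q z ≤ Λ) :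
    IntegrableOn (fun z => f z * (q z * J ‖z‖)) S := by
  have := H.integrableOn_mul_J (B := B * Λ) hε hS hSm (f := fun z => f z * q z)
    (hf.mul hq.aestronglyMeasurable) fun z hz => by
      rw [abs_mul, abs_of_nonneg (hq0 z)]
      exact mul_le_mul (hB z hz) (hqΛ z) (hq0 z) ((abs_nonneg _).trans (hB z hz))
  simpa only [mul_assoc] using this

lemma integral_modulus_le (H : HKAssumptions d φ J a₁ α₁ C₀ a b β κ κ₀ κ₁ κ₂ δ)
    {γ η c : ℝ} {ω : ℝ → ℝ} (hω : ConcaveModulus γ η c ω) (hγ0 : 0 < γ) (hγ : γ < α₁) :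
    ∃ C, 0 < C ∧ ∀ (R ρ₂ ε Λ : ℝ) (h : EuclideanSpace ℝ (Fin d))
      (q : EuclideanSpace ℝ (Fin d) → ℝ), 0 < ε → ε < ‖h‖ / 4 → 4 * ‖h‖ ≤ R → ‖h‖ / 4 ≤ ρ₂ →
      ρ₂ ≤ 1 → ‖h‖ + ρ₂ ≤ R → Measurable q → (∀ z, q (-z) = q z) → (∀ z, 0 ≤ q z) →
      (∀ z, q z ≤ Λ) →
      ∫ z in annulus d ε ρ₂, (ω (‖h + z‖ / R) - ω (‖h‖ / R)) * (q z * J ‖z‖) ≤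
        C * Λ * ((‖h‖ / R) ^ γ / Phi φ ‖h‖) := by
  obtain ⟨C1, hC1, hsq⟩ := H.integral_sq_mul_J_le
  obtain ⟨C2, hC2, hpow⟩ := H.integral_rpow_mul_J_le hγ
  refine ⟨C1 + 16 * C2, by positivity, ?_⟩
  intro R ρ₂ ε Λ h q hε hεh hhR hρ hρ1 hR hqm hqs hq0 hqΛ
  have hh : 0 < ‖h‖ := by linarith
  have hh0 : h ≠ 0 := norm_pos_iff.1 hh
  have hR0 : 0 < R := by linarith
  set ρ := ‖h‖ / 4 with hρdef
  have hρ0 : 0 < ρ := by positivity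
  have hP := H.Phi_pos hh
  have hPρ := H.Phi_pos hρ0
  have hPle : Phi φ ‖h‖ ≤ 16 * Phi φ ρ := by
    have := H.Phi_upper hρ0 (show ρ ≤ ‖h‖ by linarith)
    rwa [show ‖h‖ / ρ = 4 by rw [hρdef]; field_simp, show (4:ℝ)^2 = 16 by norm_num] at this
  have hΛ : 0 ≤ Λ := (hq0 0).trans (hqΛ 0)
  have hτ0 : 0 ≤ (‖h‖ / R) ^ γ := by positivity
  have hτm : ‖h‖ / R ∈ Icc (0:ℝ) 1 := ⟨by positivity, by rw [div_le_one hR0]; linarith⟩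
  have hmem : ∀ z : EuclideanSpace ℝ (Fin d), ‖z‖ ≤ ρ₂ → ‖h + z‖ / R ∈ Icc (0:ℝ) 1 := fun z hz =>
    ⟨by positivity, by rw [div_le_one hR0]; exact (norm_add_le h z).trans (by linarith)⟩
  have hcont : Continuous fun z : EuclideanSpace ℝ (Fin d) =>
      ω (‖h + z‖ / R) - ω (‖h‖ / R) := by
    have := hω.cont
    fun_prop
  have hInt : IntegrableOn (fun z => (ω (‖h + z‖ / R) - ω (‖h‖ / R)) * (q z * J ‖z‖))
      (annulus d ε ρ₂) :=
    H.integrableOn_mul_mul_J (B := 1) hε annulus_subset measurableSet_annulus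
      hcont.aestronglyMeasurable (fun z hz => hω.abs_sub_le_one hγ0 (hmem z hz.2) hτm)
      hqm hq0 hqΛ
  have hsub1 : annulus d ε ρ ⊆ annulus d ε ρ₂ := by
    rw [annulus_union hεh.le hρ]; exact subset_union_left
  have hsub2 : annulus d ρ ρ₂ ⊆ annulus d ε ρ₂ := by
    rw [annulus_union hεh.le hρ]; exact subset_union_right
  have hnear : ∫ z in annulus d ε ρ, (ω (‖h + z‖ / R) - ω (‖h‖ / R)) * (q z * J ‖z‖) ≤
      C1 * Λ * ((‖h‖ / R) ^ γ / Phi φ ‖h‖) := by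
    have hB0 : ∀ z : EuclideanSpace ℝ (Fin d), z ∈ annulus d ε ρ →
        |(‖h‖ / R) ^ γ * (‖z‖ ^ 2 / ‖h‖ ^ 2)| ≤ (‖h‖ / R) ^ γ * (ρ ^ 2 / ‖h‖ ^ 2) := fun z hz => by
      rw [abs_of_nonneg (by positivity)]
      have := hz.2
      gcongr
    have hBint : IntegrableOn (fun z => (‖h‖ / R) ^ γ * (‖z‖ ^ 2 / ‖h‖ ^ 2) * (q z * J ‖z‖))
        (annulus d ε ρ) :=
      H.integrableOn_mul_mul_J hε annulus_subset measurableSet_annulus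
        (Continuous.aestronglyMeasurable (by fun_prop)) hB0 hqm hq0 hqΛ
    refine (setIntegral_annulus_symm_le (B := fun z => (‖h‖ / R) ^ γ * (‖z‖ ^ 2 / ‖h‖ ^ 2))
      (hInt.mono_set hsub1) hBint (by simp [hqs]) ?_ ?_).trans ?_
    · exact fun z hz => mul_nonneg (hq0 z) (H.J_nonneg hε.le hz.1)
    · intro z hz
      have hz2 : ‖z‖ ≤ ‖h‖ := hz.2.trans (by linarith)
      have h1 := hω.norm_second_diff_le hR0 hh0 hz2 (by linarith)
      rw [← sub_eq_add_neg h z]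
      have h2 : ω (‖h‖ / R) * (‖z‖ ^ 2 / ‖h‖ ^ 2) ≤ (‖h‖ / R) ^ γ * (‖z‖ ^ 2 / ‖h‖ ^ 2) := by
        gcongr; exact hω.le_rpow _ hτm
      have h3 : 0 ≤ (‖h‖ / R) ^ γ * (‖z‖ ^ 2 / ‖h‖ ^ 2) := by positivity
      linarith
    · have hsqint : IntegrableOn (fun z : EuclideanSpace ℝ (Fin d) => ‖z‖ ^ 2 * J ‖z‖)
          (annulus d ε ρ) :=
        H.integrableOn_mul_J (B := ρ ^ 2) hε annulus_subset measurableSet_annulus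
          (Continuous.aestronglyMeasurable (by fun_prop)) fun z hz => by
            rw [abs_of_nonneg (by positivity)]
            have := hz.2
            gcongr
      calc ∫ z in annulus d ε ρ, (‖h‖ / R) ^ γ * (‖z‖ ^ 2 / ‖h‖ ^ 2) * (q z * J ‖z‖)
          ≤ ∫ z in annulus d ε ρ, (Λ * (‖h‖ / R) ^ γ / ‖h‖ ^ 2) * (‖z‖ ^ 2 * J ‖z‖) := by
            refine setIntegral_mono_on hBint (hsqint.const_mul _) measurableSet_annulus fun z hz => ?_
            have hJ := H.J_nonneg hε.le hz.1
            calc (‖h‖ / R) ^ γ * (‖z‖ ^ 2 / ‖h‖ ^ 2) * (q z * J ‖z‖)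
                ≤ (‖h‖ / R) ^ γ * (‖z‖ ^ 2 / ‖h‖ ^ 2) * (Λ * J ‖z‖) := by
                  gcongr; exact hqΛ z
              _ = _ := by ring
        _ = (Λ * (‖h‖ / R) ^ γ / ‖h‖ ^ 2) * ∫ z in annulus d ε ρ, ‖z‖ ^ 2 * J ‖z‖ :=
            integral_const_mul _ _
        _ ≤ (Λ * (‖h‖ / R) ^ γ / ‖h‖ ^ 2) * (C1 * (ρ ^ 2 / Phi φ ρ)) := by
            gcongr
            exact hsq ε ρ hε hρ0 (by linarith)
        _ = C1 * Λ * ((‖h‖ / R) ^ γ / (16 * Phi φ ρ)) := by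
            rw [hρdef]; field_simp; norm_num
        _ ≤ _ := by gcongr
  have hfar : ∫ z in annulus d ρ ρ₂, (ω (‖h + z‖ / R) - ω (‖h‖ / R)) * (q z * J ‖z‖) ≤
      16 * C2 * Λ * ((‖h‖ / R) ^ γ / Phi φ ‖h‖) := by
    have hpint : ∀ S : ℝ, IntegrableOn (fun z : EuclideanSpace ℝ (Fin d) => ‖z‖ ^ γ * J ‖z‖)
        (annulus d ρ S) := fun S =>
      H.integrableOn_mul_J (B := S ^ γ) hρ0 annulus_subset measurableSet_annulus
        (measurable_norm.pow_const γ).aestronglyMeasurable fun z hz => by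
          rw [abs_of_nonneg (by positivity)]
          have := hz.2
          gcongr
    calc ∫ z in annulus d ρ ρ₂, (ω (‖h + z‖ / R) - ω (‖h‖ / R)) * (q z * J ‖z‖)
        ≤ ∫ z in annulus d ρ ρ₂, (Λ / R ^ γ) * (‖z‖ ^ γ * J ‖z‖) := by
          refine setIntegral_mono_on (hInt.mono_set hsub2) ((hpint _).const_mul _)
            measurableSet_annulus fun z hz => ?_
          have hJ := H.J_nonneg hρ0.le hz.1
          have hzR : ‖h‖ + ‖z‖ ≤ R := by have := hz.2; linarith
          have h1 := hω.norm_add_le hR0 hzR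
          have h2 := hω.le_rpow (‖z‖ / R) ⟨by positivity, by
            rw [div_le_one hR0]; linarith [norm_nonneg h]⟩
          rw [Real.div_rpow (norm_nonneg _) hR0.le] at h2
          calc (ω (‖h + z‖ / R) - ω (‖h‖ / R)) * (q z * J ‖z‖)
              ≤ (‖z‖ ^ γ / R ^ γ) * (q z * J ‖z‖) := by
                have := hq0 z
                gcongr
                exact h1.trans h2
            _ ≤ (‖z‖ ^ γ / R ^ γ) * (Λ * J ‖z‖) := by gcongr; exact hqΛ z
            _ = _ := by ring
      _ = (Λ / R ^ γ) * ∫ z in annulus d ρ ρ₂, ‖z‖ ^ γ * J ‖z‖ := integral_const_mul _ _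
      _ ≤ (Λ / R ^ γ) * ∫ z in annulus d ρ 1, ‖z‖ ^ γ * J ‖z‖ := by
          refine mul_le_mul_of_nonneg_left (setIntegral_mono_set (hpint 1) ?_ ?_) (by positivity)
          · filter_upwards [ae_restrict_mem measurableSet_annulus] with z hz
            exact mul_nonneg (by positivity) (H.J_nonneg hρ0.le hz.1)
          · exact Eventually.of_forall fun z hz => ⟨hz.1, hz.2.trans hρ1⟩
      _ ≤ (Λ / R ^ γ) * (C2 * (ρ ^ γ / Phi φ ρ)) := by
          gcongr
          exact hpow ρ hρ0 (hρ.trans hρ1)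
      _ = C2 * Λ * ((ρ / R) ^ γ / Phi φ ρ) := by
          rw [Real.div_rpow hρ0.le hR0.le]; ring
      _ ≤ C2 * Λ * ((‖h‖ / R) ^ γ / (Phi φ ‖h‖ / 16)) := by
          gcongr
          · linarith
          · linarith
      _ = _ := by field_simp
  rw [annulus_union hεh.le hρ, setIntegral_union disjoint_annulus measurableSet_annulus
    (hInt.mono_set hsub1) (hInt.mono_set hsub2)]
  linarith

lemma integral_modulus_reflection_le (H : HKAssumptions d φ J a₁ α₁ C₀ a b β κ κ₀ κ₁ κ₂ δ)
    {γ η c : ℝ} {ω : ℝ → ℝ} (hω : ConcaveModulus γ η c ω) (hc : 0 < c) (hγ0 : 0 < γ) :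
    ∃ c', 0 < c' ∧ ∀ (R : ℝ) (h : EuclideanSpace ℝ (Fin d)), h ≠ 0 → 4 * ‖h‖ ≤ R → ‖h‖ ≤ 1 →
      ∃ ε₀, 0 < ε₀ ∧ ∀ ε, 0 < ε → ε < ε₀ →
      ∫ z in annulus d ε (‖h‖ / 4),
        (ω ((‖h‖ + 2 * inner ℝ (‖h‖⁻¹ • h) z) / R) - ω (‖h‖ / R)) * J ‖z‖ ≤
        -(c' * ((‖h‖ / R) ^ (γ + η) / Phi φ ‖h‖)) := by
  obtain ⟨c1, hc1, hlow⟩ := H.le_integral_sq_mul_J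
  have hd0 : (0:ℝ) < d := by exact_mod_cast H.hd
  refine ⟨c * c1 / (8 * d), by positivity, fun R h hh0 hhR hh1 => ?_⟩
  have hh : 0 < ‖h‖ := norm_pos_iff.2 hh0
  have hR0 : 0 < R := by linarith
  set ρ := ‖h‖ / 4 with hρdef
  have hρ0 : 0 < ρ := by positivity
  have hP := H.Phi_pos hh
  have hPρ := H.Phi_pos hρ0
  have hPle := H.Phi_mono hρ0 (show ρ ≤ ‖h‖ by linarith)
  set e := ‖h‖⁻¹ • h with he
  have he1 : ‖e‖ = 1 := by rw [he, norm_smul, norm_inv, norm_norm, inv_mul_cancel₀ hh.ne']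
  obtain ⟨ε₀, hε₀, hε₀'⟩ := hlow ρ hρ0 (by linarith)
  refine ⟨ε₀, hε₀, fun ε hε hεε => ?_⟩
  have hlow' := hε₀' ε hε hεε
  have hez : ∀ z ∈ annulus d ε ρ, |inner ℝ e z| ≤ ρ := fun z hz => by
    refine (abs_real_inner_le_norm e z).trans ?_
    rw [he1, one_mul]; exact hz.2
  have hmem : ∀ z ∈ annulus d ε ρ, (‖h‖ + 2 * inner ℝ e z) / R ∈ Icc (0:ℝ) 1 := fun z hz => by
    have h1 := abs_le.1 (hez z hz)
    refine ⟨div_nonneg (by linarith) hR0.le, ?_⟩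
    rw [div_le_one hR0]; linarith
  have hτm : ‖h‖ / R ∈ Icc (0:ℝ) 1 := ⟨by positivity, by rw [div_le_one hR0]; linarith⟩
  have hiint : ∀ v : EuclideanSpace ℝ (Fin d),
      IntegrableOn (fun z => inner ℝ v z ^ 2 * J ‖z‖) (annulus d ε ρ) := fun v => by
    refine H.integrableOn_mul_J (B := (‖v‖ * ρ) ^ 2) hε annulus_subset measurableSet_annulus
        (Continuous.aestronglyMeasurable (by fun_prop)) fun z hz => ?_
    rw [abs_of_nonneg (by positivity), ← sq_abs]
    have h1 := abs_real_inner_le_norm v z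
    have h2 := hz.2
    gcongr
    exact h1.trans (by gcongr)
  have hInt : IntegrableOn (fun z => (ω ((‖h‖ + 2 * inner ℝ e z) / R) - ω (‖h‖ / R)) * J ‖z‖)
      (annulus d ε ρ) := by
    refine H.integrableOn_mul_J (B := 1) hε annulus_subset measurableSet_annulus
      (Continuous.aestronglyMeasurable ?_)
      (fun z hz => hω.abs_sub_le_one hγ0 (hmem z hz) hτm)
    have := hω.cont
    fun_prop
  set K := 2 * c * (‖h‖ / R) ^ (γ + η) / ‖h‖ ^ 2 with hK
  have hK0 : 0 ≤ K := by positivity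
  have hBint : IntegrableOn (fun z => -K * inner ℝ e z ^ 2 * J ‖z‖) (annulus d ε ρ) := by
    have h1 : IntegrableOn (fun z => -K * (inner ℝ e z ^ 2 * J ‖z‖)) (annulus d ε ρ) :=
      (hiint e).const_mul (-K)
    simpa only [mul_assoc] using h1
  refine (setIntegral_annulus_symm_le (B := fun z => -K * inner ℝ e z ^ 2)
      hInt hBint (by simp) (fun z hz => H.J_nonneg hε.le hz.1) ?_).trans ?_
  · intro z hz
    have h1 := abs_le.1 (hez z hz)
    have h2 := hω.second_diff (‖h‖ / R) (2 * inner ℝ e z / R) (by positivity) hτm.2 (by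
      rw [abs_div, abs_of_pos hR0, div_div, mul_comm R 2, ← div_div]
      gcongr
      rw [abs_mul, abs_two]
      linarith [hez z hz])
    rw [inner_neg_right]
    rw [show (‖h‖ + 2 * inner ℝ e z) / R = ‖h‖ / R + 2 * inner ℝ e z / R by ring,
      show (‖h‖ + 2 * -inner ℝ e z) / R = ‖h‖ / R - 2 * inner ℝ e z / R by ring]
    have h3 : -c * (‖h‖ / R) ^ (γ + η) * (2 * inner ℝ e z / R / (‖h‖ / R)) ^ 2 =
        2 * (-K * inner ℝ e z ^ 2) := by
      rw [hK]; field_simp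
    linarith
  · have e1 : ∫ z in annulus d ε ρ, -K * inner ℝ e z ^ 2 * J ‖z‖ =
        -K * (1 / d * ∫ z in annulus d ε ρ, ‖z‖ ^ 2 * J ‖z‖) := by
      rw [← setIntegral_annulus_inner_sq H.hd J e he1 hiint, ← integral_const_mul]
      simp only [mul_assoc]
    rw [e1]
    have h1 : K * (1 / d * (c1 * (ρ ^ 2 / Phi φ ‖h‖))) ≤
        K * (1 / d * ∫ z in annulus d ε ρ, ‖z‖ ^ 2 * J ‖z‖) := by
      gcongr
      refine le_trans ?_ hlow'
      gcongr
    have h2 : K * (1 / d * (c1 * (ρ ^ 2 / Phi φ ‖h‖))) =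
        c * c1 / (8 * d) * ((‖h‖ / R) ^ (γ + η) / Phi φ ‖h‖) := by
      rw [hK, hρdef]; field_simp; norm_num
    linarith

end HKAssumptions

/-! ### The doubling inequality for the nonlocal operator -/

namespace HKAssumptions

lemma measurable_kappa (H : HKAssumptions d φ J a₁ α₁ C₀ a b β κ κ₀ κ₁ κ₂ δ)
    (x : EuclideanSpace ℝ (Fin d)) : Measurable (κ x) :=
  H.κ_meas.comp measurable_prodMk_left

lemma integrableOn_annulus (H : HKAssumptions d φ J a₁ α₁ C₀ a b β κ κ₀ κ₁ κ₂ δ) {ε ρ Λ : ℝ}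
    (hε : 0 < ε) {f q : EuclideanSpace ℝ (Fin d) → ℝ} (hf : Continuous f)
    (hq : Measurable q) (hqΛ : ∀ z, |q z| ≤ Λ) :
    IntegrableOn (fun z => f z * (q z * J ‖z‖)) (annulus d ε ρ) := by
  obtain ⟨B, hB⟩ := (isCompact_closedBall (0 : EuclideanSpace ℝ (Fin d)) ρ).exists_bound_of_continuousOn
    hf.continuousOn
  have hΛ : 0 ≤ Λ := (abs_nonneg _).trans (hqΛ 0)
  have := H.integrableOn_mul_J (B := B * Λ) hε annulus_subset measurableSet_annulus (ε := ε)
    (S := annulus d ε ρ) (f := fun z => f z * q z)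
    (hf.aestronglyMeasurable.mul hq.aestronglyMeasurable) fun z hz => by
      rw [abs_mul]
      have h1 : |f z| ≤ B := hB z (by simpa using hz.2)
      exact mul_le_mul h1 (hqΛ z) (abs_nonneg _) ((abs_nonneg _).trans h1)
  simpa only [mul_assoc] using this

/-- Mirror coupling: the integral of the increments over a small annulus. -/
lemma integral_reflection_le (H : HKAssumptions d φ J a₁ α₁ C₀ a b β κ κ₀ κ₁ κ₂ δ)
    {Q w : EuclideanSpace ℝ (Fin d) → ℝ} {θ : ℝ → ℝ} (hθ : Continuous θ)
    (hw : Continuous w) (hQ : Continuous Q)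
    {x x' : EuclideanSpace ℝ (Fin d)} {ε R P K : ℝ} (hε : 0 < ε) (hne : x ≠ x')
    (hmax : ∀ z z' : EuclideanSpace ℝ (Fin d), ‖z‖ ≤ ‖x - x'‖ / 4 → ‖z'‖ ≤ ‖x - x'‖ / 4 →
      w (x + z) - w x - (w (x' + z') - w x') ≤
        P * (θ (‖x + z - (x' + z')‖ / R) - θ (‖x - x'‖ / R)) + K * Q z) :
    ∫ z in annulus d ε (‖x - x'‖ / 4), (w (x + z) - w x - (w (x' + z) - w x')) * J ‖z‖ ≤
      P * (∫ z in annulus d ε (‖x - x'‖ / 4),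
        (θ ((‖x - x'‖ + 2 * inner ℝ (‖x - x'‖⁻¹ • (x - x')) z) / R) - θ (‖x - x'‖ / R)) * J ‖z‖) +
      K * ∫ z in annulus d ε (‖x - x'‖ / 4), Q z * J ‖z‖ := by
  set h := x - x' with hh
  have hh0 : h ≠ 0 := sub_ne_zero.2 hne
  have hn : 0 < ‖h‖ := norm_pos_iff.2 hh0
  set e := ‖h‖⁻¹ • h with he
  have he1 : ‖e‖ = 1 := by rw [he, norm_smul, norm_inv, norm_norm, inv_mul_cancel₀ hn.ne']
  have hhe : h = ‖h‖ • e := by rw [he, smul_smul, mul_inv_cancel₀ hn.ne', one_smul]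
  set Rf : EuclideanSpace ℝ (Fin d) ≃ₗᵢ[ℝ] EuclideanSpace ℝ (Fin d) :=
    (ℝ ∙ e)ᗮ.reflection with hRf
  have hRz : ∀ z, Rf z = z - (2 * inner ℝ e z) • e := by
    intro z
    rw [hRf, Submodule.reflection_orthogonal_apply, Submodule.reflection_singleton_apply, he1]
    simp only [RCLike.ofReal_real_eq_id, id, one_pow, div_one]
    rw [neg_sub, two_smul, ← add_smul, two_mul]
  have hcI : ∀ f : EuclideanSpace ℝ (Fin d) → ℝ, Continuous f →
      IntegrableOn (fun z => f z * J ‖z‖) (annulus d ε (‖h‖ / 4)) := fun f hf => by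
    simpa using H.integrableOn_annulus (ρ := ‖h‖ / 4) (Λ := 1) hε hf
      (measurable_const (a := (1:ℝ))) (by simp)
  have hcw : Continuous fun z => w (x + z) - w x := by fun_prop
  have hcw' : Continuous fun z => w (x' + z) - w x' := by fun_prop
  have hcwR : Continuous fun z => w (x' + Rf z) - w x' := by fun_prop
  have e1 : ∫ z in annulus d ε (‖h‖ / 4), (w (x + z) - w x - (w (x' + z) - w x')) * J ‖z‖ =
      ∫ z in annulus d ε (‖h‖ / 4), (w (x + z) - w x - (w (x' + Rf z) - w x')) * J ‖z‖ := by
    simp only [sub_mul (_ - _ : ℝ)]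
    rw [integral_sub (hcI _ hcw) (hcI _ hcw'), integral_sub (hcI _ hcw) (hcI _ hcwR)]
    congr 1
    have := setIntegral_annulus_comp Rf (ε := ε) (ρ := ‖h‖ / 4)
      (fun z => (w (x' + z) - w x') * J ‖z‖)
    simpa using this.symm
  have hcθ : Continuous fun z : EuclideanSpace ℝ (Fin d) =>
      θ ((‖h‖ + 2 * inner ℝ e z) / R) - θ (‖h‖ / R) := by fun_prop
  rw [e1, ← integral_const_mul, ← integral_const_mul, ← integral_add ((hcI _ hcθ).const_mul P)
    ((hcI _ hQ).const_mul K)]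
  refine setIntegral_mono_on (hcI _ (hcw.sub hcwR))
    (((hcI _ hcθ).const_mul P).add ((hcI _ hQ).const_mul K)) measurableSet_annulus fun z hz => ?_
  have hJ := H.J_nonneg hε.le hz.1
  have hin : |inner ℝ e z| ≤ ‖h‖ / 4 := by
    refine (abs_real_inner_le_norm e z).trans ?_
    rw [he1, one_mul]; exact hz.2
  have h1 := hmax z (Rf z) hz.2 (by rw [LinearIsometryEquiv.norm_map]; exact hz.2)
  have h2 : ‖x + z - (x' + Rf z)‖ = ‖h‖ + 2 * inner ℝ e z := by
    have : x + z - (x' + Rf z) = (‖h‖ + 2 * inner ℝ e z) • e := by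
      rw [hRz, add_smul, ← hhe, hh]; abel
    rw [this, norm_smul, he1, mul_one, Real.norm_of_nonneg]
    have := (abs_le.1 hin).1
    linarith
  rw [h2] at h1
  calc _ ≤ (P * (θ ((‖h‖ + 2 * inner ℝ e z) / R) - θ (‖h‖ / R)) + K * Q z) * J ‖z‖ := by
        gcongr
    _ = _ := by ring

lemma doubling_local (H : HKAssumptions d φ J a₁ α₁ C₀ a b β κ κ₀ κ₁ κ₂ δ)
    {γ η c : ℝ} {ω : ℝ → ℝ} (hω : ConcaveModulus γ η c ω) (hc : 0 < c) (hγ0 : 0 < γ)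
    (hγ : γ < α₁) :
    ∃ C c', 0 < C ∧ 0 < c' ∧ ∀ (r P K : ℝ) (x x' v : EuclideanSpace ℝ (Fin d))
      (w : EuclideanSpace ℝ (Fin d) → ℝ), 0 < r → r ≤ 1 → 0 ≤ P → 0 ≤ K → x ≠ x' →
      4 * ‖x - x'‖ ≤ r → Continuous w →
      (∀ z z' : EuclideanSpace ℝ (Fin d), ‖z‖ ≤ r / 2 → ‖z'‖ ≤ r / 2 →
        w (x + z) - w x - (w (x' + z') - w x') ≤
          P * (ω (‖x + z - (x' + z')‖ / (2 * r)) - ω (‖x - x'‖ / (2 * r))) +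
            K * (inner ℝ v z + ‖z‖ ^ 2)) →
      ∃ ε₀, 0 < ε₀ ∧ ε₀ ≤ r / 2 ∧ ∀ ε, 0 < ε → ε < ε₀ →
      ∫ z in annulus d ε (r / 2), ((w (x + z) - w x) * (κ x z * J ‖z‖) -
          (w (x' + z) - w x') * (κ x' z * J ‖z‖)) ≤
        K * (C * (r ^ 2 / Phi φ r)) +
        P * (C * ‖x - x'‖ ^ δ * ((‖x - x'‖ / (2 * r)) ^ γ / Phi φ ‖x - x'‖) -
          c' * ((‖x - x'‖ / (2 * r)) ^ (γ + η) / Phi φ ‖x - x'‖)) := by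
  obtain ⟨C1, hC1, hmod⟩ := H.integral_modulus_le hω hγ0 hγ
  obtain ⟨c1, hc1, hrefl⟩ := H.integral_modulus_reflection_le hω hc hγ0
  obtain ⟨C2, hC2, hsq⟩ := H.integral_sq_mul_J_le
  have hk0 := H.κ₀_pos
  have hk1 := H.κ₁_pos
  have hk2 := H.κ₂_pos
  refine ⟨2 * C1 * κ₂ + κ₁ * C2, κ₀ * c1, by positivity, by positivity, ?_⟩
  intro r P K x x' v w hr hr1 hP hK hne hhr hw hmax
  set h := x - x' with hh
  have hh0 : h ≠ 0 := sub_ne_zero.2 hne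
  have hn : 0 < ‖h‖ := norm_pos_iff.2 hh0
  obtain ⟨ε₁, hε₁, hrefl'⟩ := hrefl (2 * r) h hh0 (by linarith) (by linarith)
  refine ⟨min ε₁ (‖h‖ / 4), by positivity, (min_le_right _ _).trans (by linarith),
    fun ε hε hεε => ?_⟩
  have hεh : ε < ‖h‖ / 4 := hεε.trans_le (min_le_right _ _)
  have hρr : ‖h‖ / 4 ≤ r / 2 := by linarith
  have hrefl'' := hrefl' ε hε (hεε.trans_le (min_le_left _ _))
  set D : EuclideanSpace ℝ (Fin d) → ℝ := fun z => ω (‖h + z‖ / (2 * r)) - ω (‖h‖ / (2 * r)) with hD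
  set D' : EuclideanSpace ℝ (Fin d) → ℝ :=
    fun z => ω (‖-h + z‖ / (2 * r)) - ω (‖-h‖ / (2 * r)) with hD'
  set Q : EuclideanSpace ℝ (Fin d) → ℝ := fun z => inner ℝ v z + ‖z‖ ^ 2 with hQ
  set k : EuclideanSpace ℝ (Fin d) → ℝ := fun z => κ x z with hkdef
  set k' : EuclideanSpace ℝ (Fin d) → ℝ := fun z => κ x' z with hkdef'
  set m : EuclideanSpace ℝ (Fin d) → ℝ := fun z => min (k z) (k' z) with hm
  set N := annulus d ε (‖h‖ / 4) with hN
  set S := annulus d ε (r / 2) with hS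
  set F := annulus d (‖h‖ / 4) (r / 2) with hF
  have hSu : S = N ∪ F := annulus_union hεh.le hρr
  have hNS : N ⊆ S := by rw [hSu]; exact subset_union_left
  have hFS : F ⊆ S := by rw [hSu]; exact subset_union_right
  have hωc := hω.cont
  have hDc : Continuous D := by fun_prop
  have hDc' : Continuous D' := by fun_prop
  have hQc : Continuous Q := by fun_prop
  have hac : Continuous fun z => w (x + z) - w x := by fun_prop
  have hbc : Continuous fun z => w (x' + z) - w x' := by fun_prop
  have hkm : Measurable k := H.measurable_kappa x
  have hkm' : Measurable k' := H.measurable_kappa x'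
  have hmm : Measurable m := hkm.min hkm'
  have hkl : ∀ z, κ₀ ≤ k z := H.κ_low x
  have hkl' : ∀ z, κ₀ ≤ k' z := H.κ_low x'
  have hku : ∀ z, k z ≤ κ₁ := H.κ_up x
  have hku' : ∀ z, k' z ≤ κ₁ := H.κ_up x'
  have hml : ∀ z, κ₀ ≤ m z := fun z => le_min (hkl z) (hkl' z)
  have hmk : ∀ z, m z ≤ k z := fun z => min_le_left _ _
  have hmk' : ∀ z, m z ≤ k' z := fun z => min_le_right _ _
  have hdiff : ∀ z, |k z - k' z| ≤ κ₂ * ‖h‖ ^ δ := fun z => H.κ_holder x x' z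
  have hd1 : ∀ z, k z - m z ≤ κ₂ * ‖h‖ ^ δ := fun z => by
    have h1 := abs_le.1 (hdiff z)
    have : 0 ≤ κ₂ * ‖h‖ ^ δ := by positivity
    rcases min_cases (k z) (k' z) with ⟨h2, _⟩ | ⟨h2, _⟩ <;> simp only [hm, h2] <;> linarith
  have hd2 : ∀ z, k' z - m z ≤ κ₂ * ‖h‖ ^ δ := fun z => by
    have h1 := abs_le.1 (hdiff z)
    have : 0 ≤ κ₂ * ‖h‖ ^ δ := by positivity
    rcases min_cases (k z) (k' z) with ⟨h2, _⟩ | ⟨h2, _⟩ <;> simp only [hm, h2] <;> linarith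
  have hms : ∀ z, m (-z) = m z := fun z => by
    simp only [hm, hkdef, hkdef', ← H.κ_sym]
  -- integrability of all the pieces
  have iA : IntegrableOn (fun z => (w (x + z) - w x) * (k z * J ‖z‖)) S :=
    H.integrableOn_annulus (Λ := κ₁) hε hac hkm fun z => by
      rw [abs_of_nonneg (hk0.le.trans (hkl z))]; exact hku z
  have iB : IntegrableOn (fun z => (w (x' + z) - w x') * (k' z * J ‖z‖)) S :=
    H.integrableOn_annulus (Λ := κ₁) hε hbc hkm' fun z => by
      rw [abs_of_nonneg (hk0.le.trans (hkl' z))]; exact hku' z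
  have iD : IntegrableOn (fun z => D z * ((k z - m z) * J ‖z‖)) S :=
    H.integrableOn_annulus (q := fun z => k z - m z) (Λ := κ₂ * ‖h‖ ^ δ) hε hDc (hkm.sub hmm) fun z => by
      rw [abs_of_nonneg (sub_nonneg.2 (hmk z))]; exact hd1 z
  have iD' : IntegrableOn (fun z => D' z * ((k' z - m z) * J ‖z‖)) S :=
    H.integrableOn_annulus (q := fun z => k' z - m z) (Λ := κ₂ * ‖h‖ ^ δ) hε hDc' (hkm'.sub hmm) fun z => by
      rw [abs_of_nonneg (sub_nonneg.2 (hmk' z))]; exact hd2 z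
  have iQ : IntegrableOn (fun z => Q z * (k z * J ‖z‖)) S :=
    H.integrableOn_annulus (Λ := κ₁) hε hQc hkm fun z => by
      rw [abs_of_nonneg (hk0.le.trans (hkl z))]; exact hku z
  have iab : IntegrableOn (fun z => (w (x + z) - w x - (w (x' + z) - w x')) * J ‖z‖) N := by
    simpa using H.integrableOn_annulus (ρ := ‖h‖ / 4) (Λ := 1) hε (hac.sub hbc)
      (measurable_const (a := (1:ℝ))) (by simp)
  have iQN : IntegrableOn (fun z => Q z * J ‖z‖) N := by
    simpa using H.integrableOn_annulus (ρ := ‖h‖ / 4) (Λ := 1) hε hQc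
      (measurable_const (a := (1:ℝ))) (by simp)
  set G : EuclideanSpace ℝ (Fin d) → ℝ := fun z => P * (D z * ((k z - m z) * J ‖z‖)) +
    P * (D' z * ((k' z - m z) * J ‖z‖)) + K * (Q z * (k z * J ‖z‖)) with hG
  have iG : IntegrableOn G S :=
    ((iD.const_mul P).add (iD'.const_mul P)).add (iQ.const_mul K)
  -- pointwise inequalities
  have pa : ∀ z ∈ S, w (x + z) - w x ≤ P * D z + K * Q z := fun z hz => by
    have h1 := hmax z 0 hz.2 (by simpa using (half_pos hr).le)
    rw [add_zero, show x + z - x' = h + z by rw [hh]; abel] at h1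
    simp only [hD, hQ]; linarith
  have pb : ∀ z ∈ S, -(w (x' + z) - w x') ≤ P * D' z := fun z hz => by
    have h1 := hmax 0 z (by simpa using (half_pos hr).le) hz.2
    rw [add_zero, show x - (x' + z) = -(-h + z) by rw [hh]; abel, norm_neg] at h1
    simp only [hD', norm_neg h]
    simp only [inner_zero_right, norm_zero] at h1
    linarith
  have pab : ∀ z ∈ S, w (x + z) - w x - (w (x' + z) - w x') ≤ K * Q z := fun z hz => by
    have h1 := hmax z z hz.2 hz.2
    rw [show x + z - (x' + z) = h by rw [hh]; abel] at h1
    simp only [hQ]; linarith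
  have pI : ∀ z ∈ S, ∀ l, l ≤ m z → (w (x + z) - w x) * (k z * J ‖z‖) -
      (w (x' + z) - w x') * (k' z * J ‖z‖) - l * ((w (x + z) - w x - (w (x' + z) - w x')) * J ‖z‖) ≤
      G z - l * K * (Q z * J ‖z‖) := fun z hz l hl => by
    have hJ := H.J_nonneg hε.le hz.1
    have h1 := mul_le_mul_of_nonneg_left (pa z hz) (mul_nonneg (sub_nonneg.2 (hmk z)) hJ)
    have h2 := mul_le_mul_of_nonneg_left (pb z hz) (mul_nonneg (sub_nonneg.2 (hmk' z)) hJ)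
    have h3 := mul_le_mul_of_nonneg_left (pab z hz) (mul_nonneg (sub_nonneg.2 hl) hJ)
    simp only [hG]
    linarith
  have stepF : ∫ z in F, ((w (x + z) - w x) * (k z * J ‖z‖) -
      (w (x' + z) - w x') * (k' z * J ‖z‖)) ≤ ∫ z in F, G z := by
    refine setIntegral_mono_on ((iA.sub iB).mono_set hFS) (iG.mono_set hFS)
      measurableSet_annulus fun z hz => ?_
    have := pI z (hFS hz) 0 (hk0.le.trans (hml z))
    simpa using this
  have stepN : (∫ z in N, ((w (x + z) - w x) * (k z * J ‖z‖) -
      (w (x' + z) - w x') * (k' z * J ‖z‖))) -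
      κ₀ * ∫ z in N, (w (x + z) - w x - (w (x' + z) - w x')) * J ‖z‖ ≤
      (∫ z in N, G z) - κ₀ * K * ∫ z in N, Q z * J ‖z‖ := by
    have j1 : IntegrableOn (fun z => (w (x + z) - w x) * (k z * J ‖z‖) -
      (w (x' + z) - w x') * (k' z * J ‖z‖)) N := (iA.sub iB).mono_set hNS
    rw [← integral_const_mul, ← integral_const_mul, ← integral_sub j1 (iab.const_mul κ₀),
      ← integral_sub (iG.mono_set hNS) (iQN.const_mul _)]
    refine setIntegral_mono_on (j1.sub (iab.const_mul κ₀))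
      ((iG.mono_set hNS).sub (iQN.const_mul _)) measurableSet_annulus fun z hz => ?_
    exact pI z (hNS hz) κ₀ (hml z)
  have stepR := H.integral_reflection_le hωc hw hQc (ε := ε) (R := 2 * r) (P := P) (K := K)
    hε hne fun z z' hz hz' => hmax z z' (hz.trans hρr) (hz'.trans hρr)
  have stepR' := mul_le_mul_of_nonneg_left stepR hk0.le
  have iDD : IntegrableOn (fun z => P * (D z * ((k z - m z) * J ‖z‖)) +
      P * (D' z * ((k' z - m z) * J ‖z‖))) S := (iD.const_mul P).add (iD'.const_mul P)
  have hGint : ∫ z in S, G z = P * (∫ z in S, D z * ((k z - m z) * J ‖z‖)) +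
      P * (∫ z in S, D' z * ((k' z - m z) * J ‖z‖)) + K * ∫ z in S, Q z * (k z * J ‖z‖) := by
    rw [← integral_const_mul, ← integral_const_mul, ← integral_const_mul,
      ← integral_add (iD.const_mul P) (iD'.const_mul P),
      ← integral_add iDD (iQ.const_mul K)]
  have bD := hmod (2 * r) (r / 2) ε (κ₂ * ‖h‖ ^ δ) h (fun z => k z - m z) hε hεh (by linarith) hρr
    (by linarith) (by linarith) (hkm.sub hmm) (fun z => by
      rw [hms]; simp only [hkdef, ← H.κ_sym]) (fun z => sub_nonneg.2 (hmk z)) hd1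
  have bD' := hmod (2 * r) (r / 2) ε (κ₂ * ‖h‖ ^ δ) (-h) (fun z => k' z - m z) hε (by rwa [norm_neg])
    (by rw [norm_neg]; linarith) (by rwa [norm_neg])
    (by linarith) (by rw [norm_neg]; linarith) (hkm'.sub hmm) (fun z => by
      rw [hms]; simp only [hkdef', ← H.κ_sym]) (fun z => sub_nonneg.2 (hmk' z)) hd2
  rw [norm_neg] at bD'
  have bQ : ∫ z in S, Q z * (k z * J ‖z‖) ≤ κ₁ * C2 * (r ^ 2 / Phi φ r) := by
    have hnc : Continuous fun z : EuclideanSpace ℝ (Fin d) => ‖z‖ ^ 2 := by fun_prop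
    have i1 : IntegrableOn (fun z => ‖z‖ ^ 2 * (k z * J ‖z‖)) S :=
      H.integrableOn_annulus (Λ := κ₁) hε hnc hkm fun z => by
        rw [abs_of_nonneg (hk0.le.trans (hkl z))]; exact hku z
    have i2 : IntegrableOn (fun z : EuclideanSpace ℝ (Fin d) => ‖z‖ ^ 2 * J ‖z‖) S := by
      simpa using H.integrableOn_annulus (ρ := r / 2) (Λ := 1) hε hnc
        (measurable_const (a := (1:ℝ))) (by simp)
    have hPr := H.Phi_pos hr
    have hPr2 := H.Phi_pos (half_pos hr)
    have hPle : Phi φ r ≤ 4 * Phi φ (r / 2) := by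
      have := H.Phi_upper (half_pos hr) (show r / 2 ≤ r by linarith)
      rwa [show r / (r / 2) = 2 by field_simp, show (2:ℝ)^2 = 4 by norm_num] at this
    refine (setIntegral_annulus_symm_le (B := fun z => ‖z‖ ^ 2) iQ i1
      (fun z => by simp only [hkdef, ← H.κ_sym, norm_neg])
      (fun z hz => mul_nonneg (hk0.le.trans (hkl z)) (H.J_nonneg hε.le hz.1))
      (fun z _ => by simp only [hQ, inner_neg_right, norm_neg]; linarith)).trans ?_
    calc ∫ z in S, ‖z‖ ^ 2 * (k z * J ‖z‖) ≤ ∫ z in S, κ₁ * (‖z‖ ^ 2 * J ‖z‖) := by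
          refine setIntegral_mono_on i1 (i2.const_mul _) measurableSet_annulus fun z hz => ?_
          have hJ := H.J_nonneg hε.le hz.1
          calc ‖z‖ ^ 2 * (k z * J ‖z‖) ≤ ‖z‖ ^ 2 * (κ₁ * J ‖z‖) := by gcongr; exact hku z
            _ = _ := by ring
      _ = κ₁ * ∫ z in S, ‖z‖ ^ 2 * J ‖z‖ := integral_const_mul _ _
      _ ≤ κ₁ * (C2 * ((r / 2) ^ 2 / Phi φ (r / 2))) := by
          gcongr
          exact hsq ε (r / 2) hε (half_pos hr) (by linarith)
      _ = κ₁ * C2 * (r ^ 2 / (4 * Phi φ (r / 2))) := by field_simp; norm_num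
      _ ≤ _ := by gcongr
  have iAB : IntegrableOn (fun z => (w (x + z) - w x) * (k z * J ‖z‖) -
      (w (x' + z) - w x') * (k' z * J ‖z‖)) S := iA.sub iB
  have hABu : ∫ z in S, ((w (x + z) - w x) * (k z * J ‖z‖) -
      (w (x' + z) - w x') * (k' z * J ‖z‖)) = (∫ z in N, ((w (x + z) - w x) * (k z * J ‖z‖) -
      (w (x' + z) - w x') * (k' z * J ‖z‖))) + ∫ z in F, ((w (x + z) - w x) * (k z * J ‖z‖) -
      (w (x' + z) - w x') * (k' z * J ‖z‖)) := by
    rw [hSu]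
    exact setIntegral_union disjoint_annulus measurableSet_annulus (iAB.mono_set hNS)
      (iAB.mono_set hFS)
  rw [hABu]
  have hGu : ∫ z in S, G z = (∫ z in N, G z) + ∫ z in F, G z := by
    rw [hSu]
    exact setIntegral_union disjoint_annulus measurableSet_annulus (iG.mono_set hNS)
      (iG.mono_set hFS)
  have q1 := mul_le_mul_of_nonneg_left bD hP
  have q2 := mul_le_mul_of_nonneg_left bD' hP
  have q3 := mul_le_mul_of_nonneg_left bQ hK
  have q4 := mul_le_mul_of_nonneg_left hrefl'' (mul_nonneg hk0.le hP)
  have hPr := H.Phi_pos hr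
  have hPh := H.Phi_pos hn
  have q5 : 0 ≤ K * (2 * C1 * κ₂) * (r ^ 2 / Phi φ r) := by positivity
  have q6 : 0 ≤ P * (κ₁ * C2 * ‖h‖ ^ δ * ((‖h‖ / (2 * r)) ^ γ / Phi φ ‖h‖)) := by positivity
  simp only [hD, hD', norm_neg h] at hGint q1 q2
  linarith

lemma integrableOn_Leps (H : HKAssumptions d φ J a₁ α₁ C₀ a b β κ κ₀ κ₁ κ₂ δ) {ε : ℝ}
    (hε : 0 < ε) {w : EuclideanSpace ℝ (Fin d) → ℝ} (hw : Continuous w)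
    (hB : ∃ B, ∀ x, |w x| ≤ B) (x : EuclideanSpace ℝ (Fin d)) :
    IntegrableOn (fun z => (w (x + z) - w x) * (κ x z * J ‖z‖)) {z | ε < ‖z‖} := by
  obtain ⟨B, hB⟩ := hB
  refine H.integrableOn_mul_mul_J (B := B + B) (Λ := κ₁) hε le_rfl measurableSet_norm_gt
    (Continuous.aestronglyMeasurable (by fun_prop)) (fun z _ => ?_) (H.measurable_kappa x)
    (fun z => H.κ₀_pos.le.trans (H.κ_low x z)) (H.κ_up x)
  exact (abs_sub _ _).trans (add_le_add (hB _) (hB _))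

lemma integrableOn_abs_mul_J (H : HKAssumptions d φ J a₁ α₁ C₀ a b β κ κ₀ κ₁ κ₂ δ) {ε : ℝ}
    (hε : 0 < ε) {w : EuclideanSpace ℝ (Fin d) → ℝ} (hw : Continuous w)
    (hB : ∃ B, ∀ x, |w x| ≤ B) (x : EuclideanSpace ℝ (Fin d)) :
    IntegrableOn (fun z => |w (x + z)| * J ‖z‖) {z | ε < ‖z‖} := by
  obtain ⟨B, hB⟩ := hB
  exact H.integrableOn_mul_J (B := B) hε le_rfl measurableSet_norm_gt
    (Continuous.aestronglyMeasurable (by fun_prop)) fun z _ => by rw [abs_abs]; exact hB _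

lemma abs_tail_le (H : HKAssumptions d φ J a₁ α₁ C₀ a b β κ κ₀ κ₁ κ₂ δ) {ε : ℝ}
    (hε : 0 < ε) {w : EuclideanSpace ℝ (Fin d) → ℝ} (hw : Continuous w)
    (hB : ∃ B, ∀ x, |w x| ≤ B) (x : EuclideanSpace ℝ (Fin d)) :
    |∫ z in {z : EuclideanSpace ℝ (Fin d) | ε < ‖z‖}, (w (x + z) - w x) * (κ x z * J ‖z‖)| ≤
      κ₁ * ((∫ z in {z : EuclideanSpace ℝ (Fin d) | ε < ‖z‖}, |w (x + z)| * J ‖z‖) +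
        |w x| * ∫ z in {z : EuclideanSpace ℝ (Fin d) | ε < ‖z‖}, J ‖z‖) := by
  have i1 := H.integrableOn_abs_mul_J hε hw hB x
  have i2 := (H.integrableOn_J hε).const_mul (|w x|)
  rw [← integral_const_mul |w x|, ← integral_add i1 i2, ← integral_const_mul]
  refine (abs_integral_le_integral_abs).trans ?_
  refine setIntegral_mono_on (H.integrableOn_Leps hε hw hB x).abs ((i1.add i2).const_mul κ₁)
    measurableSet_norm_gt fun z hz => ?_
  have hJ := H.J_nonneg hε.le hz
  have hk := H.κ₀_pos.le.trans (H.κ_low x z)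
  rw [abs_mul, abs_of_nonneg (mul_nonneg hk hJ)]
  calc |w (x + z) - w x| * (κ x z * J ‖z‖) ≤ (|w (x + z)| + |w x|) * (κ₁ * J ‖z‖) := by
        gcongr
        · exact abs_sub _ _
        · exact H.κ_up x z
    _ = _ := by ring

lemma Phi_half (H : HKAssumptions d φ J a₁ α₁ C₀ a b β κ κ₀ κ₁ κ₂ δ) {r : ℝ} (hr : 0 < r) :
    Phi φ r ≤ 4 * Phi φ (r / 2) := by
  have := H.Phi_upper (half_pos hr) (show r / 2 ≤ r by linarith)
  rwa [show r / (r / 2) = 2 by field_simp, show (2:ℝ)^2 = 4 by norm_num] at this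

set_option maxHeartbeats 1000000 in
/-- At a positive maximum of the doubled functional, the operator strictly contracts. -/
lemma doubling_static (H : HKAssumptions d φ J a₁ α₁ C₀ a b β κ κ₀ κ₁ κ₂ δ)
    {γ : ℝ} (hγ0 : 0 < γ) (hγ1 : γ ≤ 1) (hγ : γ < α₁) :
    ∃ ω : ℝ → ℝ, Continuous ω ∧ ω 0 = 0 ∧ (∀ s ∈ Icc (0:ℝ) 1, 0 ≤ ω s) ∧
    (∀ s ∈ Icc (0:ℝ) 1, ω s ≤ s ^ γ) ∧
    ∀ N, 0 < N → ∃ M, 0 < M ∧ ∀ (A r : ℝ) (x₀ x x' : EuclideanSpace ℝ (Fin d))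
      (w : EuclideanSpace ℝ (Fin d) → ℝ), 0 < A → 0 < r → r ≤ 1 → Continuous w →
      (∃ B, ∀ u, |w u| ≤ B) → (∀ u, ‖u - x₀‖ ≤ r → |w u| ≤ A) →
      (∀ u, ‖u - x₀‖ ≤ r / 2 →
        ∫ z in {z : EuclideanSpace ℝ (Fin d) | r / 2 < ‖z‖}, |w (u + z)| * J ‖z‖ ≤ A / Phi φ r) →
      ‖x - x₀‖ ≤ r → ‖x' - x₀‖ ≤ r →
      (∀ u u', ‖u - x₀‖ ≤ r → ‖u' - x₀‖ ≤ r →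
        w u - w u' - A * M * ω (‖u - u'‖ / (2 * r)) - 32 * A / r ^ 2 * ‖u - x₀‖ ^ 2 ≤
        w x - w x' - A * M * ω (‖x - x'‖ / (2 * r)) - 32 * A / r ^ 2 * ‖x - x₀‖ ^ 2) →
      0 < w x - w x' - A * M * ω (‖x - x'‖ / (2 * r)) - 32 * A / r ^ 2 * ‖x - x₀‖ ^ 2 →
      ∃ ε₀, 0 < ε₀ ∧ ∀ ε, 0 < ε → ε < ε₀ →
        Leps d κ J ε w x - Leps d κ J ε w x' ≤ -(N * (A / Phi φ r)) := by
  have hδ := H.δ_pos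
  have hδ1 := H.δ_lt
  have ha₁ := H.a₁_pos
  have hk1 := H.κ₁_pos
  set η := min δ (α₁ - γ) / 2 with hη
  have hγ' : 0 < α₁ - γ := sub_pos.2 hγ
  have hmin : 0 < min δ (α₁ - γ) := lt_min hδ hγ'
  have hη0 : 0 < η := by positivity
  have hηδ : η < δ := by have := min_le_left δ (α₁ - γ); linarith
  have hηα : γ + η ≤ α₁ := by have := min_le_right δ (α₁ - γ); linarith
  obtain ⟨c, ω, hc, hω⟩ := exists_concaveModulus hγ0 hγ1 hη0 (by linarith)
  obtain ⟨C, c', hC, hc', hloc⟩ := H.doubling_local hω hc hγ0 hγ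
  obtain ⟨CJ, hCJ, hJle⟩ := H.integral_J_le
  refine ⟨ω, hω.cont, hω.zero, fun s hs => hω.nonneg hs, hω.le_rpow, fun N hN => ?_⟩
  set τ₀ := min (1 / 8) ((c' / (4 * C)) ^ (1 / (δ - η))) with hτ₀
  have hδη : 0 < δ - η := by linarith
  have hτ₀0 : 0 < τ₀ := by positivity
  have hτ₀8 : τ₀ ≤ 1 / 8 := min_le_left _ _
  have hτ₀C : 2 * C * τ₀ ^ (δ - η) ≤ c' / 2 := by
    have h1 : τ₀ ^ (δ - η) ≤ c' / (4 * C) := by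
      calc τ₀ ^ (δ - η) ≤ ((c' / (4 * C)) ^ (1 / (δ - η))) ^ (δ - η) := by
            gcongr; exact min_le_right _ _
        _ = c' / (4 * C) := by
            rw [← Real.rpow_mul (by positivity), one_div, inv_mul_cancel₀ hδη.ne', Real.rpow_one]
    calc 2 * C * τ₀ ^ (δ - η) ≤ 2 * C * (c' / (4 * C)) := by gcongr
      _ = c' / 2 := by field_simp; norm_num
  set Ct := 32 * C + 2 * (κ₁ * (1 + 4 * CJ)) with hCt
  set M := max (4 / τ₀ ^ γ) (8 * (N + Ct) / (c' * a₁)) with hM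
  have hM0 : 0 < M := lt_max_of_lt_left (by positivity)
  have hM1 : 4 ≤ M * τ₀ ^ γ := by
    have := le_max_left (4 / τ₀ ^ γ) (8 * (N + Ct) / (c' * a₁))
    rwa [div_le_iff₀ (by positivity)] at this
  have hM2 : 8 * (N + Ct) ≤ M * (c' * a₁) := by
    have := le_max_right (4 / τ₀ ^ γ) (8 * (N + Ct) / (c' * a₁))
    rwa [div_le_iff₀ (by positivity)] at this
  refine ⟨M, hM0, ?_⟩
  intro A r x₀ x x' w hA hr hr1 hw hB hwA htail hx hx' hmax hpos
  have hPr := H.Phi_pos hr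
  set τ := ‖x - x'‖ / (2 * r) with hτ
  have hxx : ‖x - x'‖ ≤ 2 * r := by
    rw [show x - x' = (x - x₀) - (x' - x₀) by abel]
    exact (norm_sub_le _ _).trans (by linarith)
  have hτm : τ ∈ Icc (0:ℝ) 1 := ⟨by positivity, by rw [hτ, div_le_one (by positivity)]; exact hxx⟩
  have h2A : w x - w x' ≤ 2 * A := by
    have h1 := (abs_le.1 (hwA x hx)).2
    have h2 := (abs_le.1 (hwA x' hx')).1
    linarith
  have hω0 := hω.nonneg hτm
  have hq0 : 0 ≤ 32 * A / r ^ 2 * ‖x - x₀‖ ^ 2 := by positivity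
  have hAM : 0 < A * M := by positivity
  have hAMω : 0 ≤ A * M * ω τ := by positivity
  have hne : x ≠ x' := by
    rintro rfl
    linarith
  have hh : 0 < ‖x - x'‖ := norm_pos_iff.2 (sub_ne_zero.2 hne)
  have hτ0 : 0 < τ := by positivity
  have hττ : τ < τ₀ := by
    by_contra hcon
    push Not at hcon
    have h1 : τ₀ ^ γ ≤ τ ^ γ := Real.rpow_le_rpow hτ₀0.le hcon hγ0.le
    have h2 := hω.rpow_le τ hτm
    have h3 : A * (M * τ₀ ^ γ) / 2 ≤ A * M * ω τ := by
      calc A * (M * τ₀ ^ γ) / 2 = A * M * (τ₀ ^ γ / 2) := by ring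
        _ ≤ A * M * ω τ := by gcongr; linarith
    have h4 := mul_le_mul_of_nonneg_left hM1 hA.le
    linarith
  have hh4 : 4 * ‖x - x'‖ ≤ r := by
    have : ‖x - x'‖ = τ * (2 * r) := by rw [hτ]; field_simp
    rw [this]
    have := mul_le_mul_of_nonneg_right (hττ.le.trans hτ₀8) hr.le
    linarith
  have hxr : ‖x - x₀‖ ≤ r / 4 := by
    have h1 : 32 * A / r ^ 2 * ‖x - x₀‖ ^ 2 ≤ 2 * A := by linarith
    rw [div_mul_eq_mul_div, div_le_iff₀ (by positivity)] at h1
    have h2 : ‖x - x₀‖ ^ 2 ≤ (r / 4) ^ 2 :=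
      le_of_mul_le_mul_left (show A * ‖x - x₀‖ ^ 2 ≤ A * (r / 4) ^ 2 by linarith) hA
    exact (abs_le_of_sq_le_sq' h2 (by positivity)).2
  have hx'r : ‖x' - x₀‖ ≤ r / 2 := by
    rw [show x' - x₀ = (x - x₀) - (x - x') by abel]
    exact (norm_sub_le _ _).trans (by linarith)
  obtain ⟨ε₀, hε₀, hε₀r, hmain⟩ := hloc r (A * M) (32 * A / r ^ 2) x x' ((2:ℝ) • (x - x₀)) w hr hr1
    hAM.le (by positivity) hne hh4 hw (by
      intro z z' hz hz'
      have h1 := hmax (x + z) (x' + z') (by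
        rw [show x + z - x₀ = (x - x₀) + z by abel]
        exact (norm_add_le _ _).trans (by linarith)) (by
        rw [show x' + z' - x₀ = (x' - x₀) + z' by abel]
        exact (norm_add_le _ _).trans (by linarith))
      rw [show x + z - x₀ = (x - x₀) + z by abel, norm_add_sq_real] at h1
      rw [inner_smul_left]
      simp only [conj_trivial]
      linarith)
  refine ⟨ε₀, hε₀, fun ε hε hεε => ?_⟩
  have hm := hmain ε hε hεε
  have hεr : ε ≤ r / 2 := hεε.le.trans hε₀r
  have i1 := H.integrableOn_Leps hε hw hB x
  have i2 := H.integrableOn_Leps hε hw hB x'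
  have hr2 : 0 < r / 2 := half_pos hr
  have hsplit : ∀ u, Leps d κ J ε w u =
      (∫ z in annulus d ε (r / 2), (w (u + z) - w u) * (κ u z * J ‖z‖)) +
      ∫ z in {z : EuclideanSpace ℝ (Fin d) | r / 2 < ‖z‖}, (w (u + z) - w u) * (κ u z * J ‖z‖) :=
    fun u => by
      rw [Leps, norm_gt_eq_union hεr]
      exact setIntegral_union disjoint_annulus_norm_gt measurableSet_norm_gt
        ((H.integrableOn_Leps hε hw hB u).mono_set annulus_subset)
        (H.integrableOn_Leps hr2 hw hB u)
  have htl : ∀ u, ‖u - x₀‖ ≤ r / 2 →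
      |∫ z in {z : EuclideanSpace ℝ (Fin d) | r / 2 < ‖z‖}, (w (u + z) - w u) * (κ u z * J ‖z‖)| ≤
      κ₁ * (1 + 4 * CJ) * (A / Phi φ r) := fun u hu => by
    refine (H.abs_tail_le hr2 hw hB u).trans ?_
    have h1 := hJle (r / 2) hr2 (by linarith)
    have h2 := H.Phi_half hr
    have h3 := H.Phi_pos hr2
    have h4 : CJ / Phi φ (r / 2) ≤ 4 * CJ / Phi φ r := by
      rw [div_le_div_iff₀ h3 hPr]
      have := mul_le_mul_of_nonneg_left h2 hCJ.le
      linarith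
    have h5 : 0 ≤ ∫ z in {z : EuclideanSpace ℝ (Fin d) | r / 2 < ‖z‖}, J ‖z‖ :=
      setIntegral_nonneg measurableSet_norm_gt fun z hz => H.J_nonneg hr2.le hz
    calc _ ≤ κ₁ * (A / Phi φ r + A * (4 * CJ / Phi φ r)) := by
          gcongr
          · exact htail u hu
          · exact hwA u (by linarith)
          · exact h1.trans h4
      _ = _ := by ring
  have t1 := abs_le.1 (htl x (by linarith))
  have t2 := abs_le.1 (htl x' hx'r)
  rw [integral_sub (i1.mono_set annulus_subset) (i2.mono_set annulus_subset)] at hm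
  rw [hsplit x, hsplit x']
  -- the contraction term
  have hPh := H.Phi_pos hh
  have hhτ : ‖x - x'‖ ^ δ ≤ 2 * τ ^ δ := by
    have e1 : ‖x - x'‖ ≤ 2 * τ := by
      rw [hτ, show 2 * (‖x - x'‖ / (2 * r)) = ‖x - x'‖ / r by field_simp, le_div_iff₀ hr]
      exact mul_le_of_le_one_right hh.le hr1
    calc ‖x - x'‖ ^ δ ≤ (2 * τ) ^ δ := by gcongr
      _ = 2 ^ δ * τ ^ δ := Real.mul_rpow (by norm_num) hτ0.le
      _ ≤ 2 ^ (1:ℝ) * τ ^ δ := by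
          gcongr
          norm_num
      _ = 2 * τ ^ δ := by rw [Real.rpow_one]
  have hkey : C * ‖x - x'‖ ^ δ * (τ ^ γ / Phi φ ‖x - x'‖) -
      c' * (τ ^ (γ + η) / Phi φ ‖x - x'‖) ≤ -(c' * a₁ / 8 / Phi φ r) := by
    have e1 : C * ‖x - x'‖ ^ δ * τ ^ γ ≤ c' / 2 * τ ^ (γ + η) := by
      calc C * ‖x - x'‖ ^ δ * τ ^ γ ≤ C * (2 * τ ^ δ) * τ ^ γ := by gcongr
        _ = 2 * C * τ ^ (δ - η) * τ ^ (γ + η) := by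
            have : τ ^ δ * τ ^ γ = τ ^ (δ - η) * τ ^ (γ + η) := by
              rw [← Real.rpow_add hτ0, ← Real.rpow_add hτ0]; congr 1; ring
            linear_combination 2 * C * this
        _ ≤ 2 * C * τ₀ ^ (δ - η) * τ ^ (γ + η) := by gcongr
        _ ≤ _ := by gcongr
    have e2 := H.Phi_lower hh (show ‖x - x'‖ ≤ r by linarith) hr1
    have e3 : a₁ / 4 / Phi φ r ≤ τ ^ (γ + η) / Phi φ ‖x - x'‖ := by
      rw [div_le_div_iff₀ hPr hPh]
      have e4 : τ ^ α₁ ≤ τ ^ (γ + η) := Real.rpow_le_rpow_of_exponent_ge hτ0 hτm.2 hηα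
      have e5 : 1 / 4 ≤ τ ^ α₁ * (r / ‖x - x'‖) ^ α₁ := by
        rw [← Real.mul_rpow hτ0.le (by positivity), show τ * (r / ‖x - x'‖) = 1 / 2 by
          rw [hτ]; field_simp]
        calc (1/4:ℝ) = (1/2:ℝ) ^ (2:ℝ) := by norm_num
          _ ≤ (1/2:ℝ) ^ α₁ :=
            Real.rpow_le_rpow_of_exponent_ge (by norm_num) (by norm_num) H.α₁_le
      calc a₁ / 4 * Phi φ ‖x - x'‖ = a₁ * (1 / 4) * Phi φ ‖x - x'‖ := by ring
        _ ≤ a₁ * (τ ^ α₁ * (r / ‖x - x'‖) ^ α₁) * Phi φ ‖x - x'‖ := by gcongr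
        _ = τ ^ α₁ * (a₁ * (r / ‖x - x'‖) ^ α₁ * Phi φ ‖x - x'‖) := by ring
        _ ≤ τ ^ (γ + η) * Phi φ r := by gcongr
    calc C * ‖x - x'‖ ^ δ * (τ ^ γ / Phi φ ‖x - x'‖) - c' * (τ ^ (γ + η) / Phi φ ‖x - x'‖)
        = (C * ‖x - x'‖ ^ δ * τ ^ γ) / Phi φ ‖x - x'‖ - c' * (τ ^ (γ + η) / Phi φ ‖x - x'‖) := by
          ring
      _ ≤ (c' / 2 * τ ^ (γ + η)) / Phi φ ‖x - x'‖ - c' * (τ ^ (γ + η) / Phi φ ‖x - x'‖) := by gcongr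
      _ = -(c' / 2 * (τ ^ (γ + η) / Phi φ ‖x - x'‖)) := by ring
      _ ≤ -(c' / 2 * (a₁ / 4 / Phi φ r)) := by gcongr
      _ = _ := by ring
  have hkey' := mul_le_mul_of_nonneg_left hkey hAM.le
  have hfin : (N + Ct) * (A / Phi φ r) ≤ A * M * (c' * a₁ / 8 / Phi φ r) := by
    calc (N + Ct) * (A / Phi φ r) = 8 * (N + Ct) * (A / (8 * Phi φ r)) := by field_simp
      _ ≤ M * (c' * a₁) * (A / (8 * Phi φ r)) := by gcongr
      _ = _ := by field_simp
  have hKr : 32 * A / r ^ 2 * (C * (r ^ 2 / Phi φ r)) = 32 * C * (A / Phi φ r) := by field_simp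
  rw [hCt] at hfin
  linarith

end HKAssumptions

/-- The derivative at a left-sided maximum is nonnegative. -/
lemma HasDerivAt.nonneg_of_left_max {h : ℝ → ℝ} {D s₀ s : ℝ} (hD : HasDerivAt h D s)
    (hs : s₀ < s) (hmax : ∀ u ∈ Icc s₀ s, h u ≤ h s) : 0 ≤ D := by
  have h1 := (hasDerivWithinAt_iff_tendsto_slope' (s := Iio s) (by simp)).1 hD.hasDerivWithinAt
  refine ge_of_tendsto h1 ?_
  filter_upwards [Ioo_mem_nhdsLT hs] with u hu
  rw [slope_def_field]
  exact div_nonneg_of_nonpos (by linarith [hmax u ⟨hu.1.le, hu.2.le⟩]) (by linarith [hu.2])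

lemma Leps_neg (ε : ℝ) (w : EuclideanSpace ℝ (Fin d) → ℝ) (x : EuclideanSpace ℝ (Fin d)) :
    Leps d κ J ε (fun u => -w u) x = -Leps d κ J ε w x := by
  rw [Leps, Leps, ← integral_neg]
  congr 1
  ext z
  ring

namespace HKAssumptions

/-- Interior Hölder estimate for functions with bounded truncated operators. -/
lemma holder_elliptic (H : HKAssumptions d φ J a₁ α₁ C₀ a b β κ κ₀ κ₁ κ₂ δ)
    {γ : ℝ} (hγ0 : 0 < γ) (hγ1 : γ ≤ 1) (hγ : γ < α₁) :
    ∃ M, 0 < M ∧ ∀ (A r : ℝ) (x₀ : EuclideanSpace ℝ (Fin d))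
      (w : EuclideanSpace ℝ (Fin d) → ℝ), 0 < A → 0 < r → r ≤ 1 → Continuous w →
      (∃ B, ∀ u, |w u| ≤ B) → (∀ u, ‖u - x₀‖ ≤ r → |w u| ≤ A) →
      (∀ u, ‖u - x₀‖ ≤ r / 2 →
        ∫ z in {z : EuclideanSpace ℝ (Fin d) | r / 2 < ‖z‖}, |w (u + z)| * J ‖z‖ ≤ A / Phi φ r) →
      (∀ ε, 0 < ε → ε ≤ 1 → ∀ u, ‖u - x₀‖ ≤ r → |Leps d κ J ε w u| ≤ A / Phi φ r) →
      ∀ x', ‖x' - x₀‖ ≤ r → |w x₀ - w x'| ≤ A * M * (‖x₀ - x'‖ / r) ^ γ := by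
  obtain ⟨ω, hωc, hω0, hωn, hωγ, hmain⟩ := H.doubling_static hγ0 hγ1 hγ
  obtain ⟨M, hM, hmain⟩ := hmain 3 (by norm_num)
  refine ⟨M, hM, fun A r x₀ w hA hr hr1 hw hB hwA htail hL x' hx' => ?_⟩
  suffices key : ∀ w : EuclideanSpace ℝ (Fin d) → ℝ, Continuous w →
      (∃ B, ∀ u, |w u| ≤ B) → (∀ u, ‖u - x₀‖ ≤ r → |w u| ≤ A) →
      (∀ u, ‖u - x₀‖ ≤ r / 2 →
        ∫ z in {z : EuclideanSpace ℝ (Fin d) | r / 2 < ‖z‖}, |w (u + z)| * J ‖z‖ ≤ A / Phi φ r) →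
      (∀ ε, 0 < ε → ε ≤ 1 → ∀ u, ‖u - x₀‖ ≤ r → |Leps d κ J ε w u| ≤ A / Phi φ r) →
      w x₀ - w x' ≤ A * M * (‖x₀ - x'‖ / r) ^ γ by
    refine abs_le.2 ⟨?_, key w hw hB hwA htail hL⟩
    have := key (fun u => -w u) hw.neg (by simpa only [abs_neg] using hB)
      (by simpa only [abs_neg] using hwA) (by simpa only [abs_neg] using htail)
      (by simpa only [Leps_neg, abs_neg] using hL)
    linarith
  clear! w
  intro w hw hB hwA htail hL
  set Ψ : EuclideanSpace ℝ (Fin d) × EuclideanSpace ℝ (Fin d) → ℝ := fun q =>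
    w q.1 - w q.2 - A * M * ω (‖q.1 - q.2‖ / (2 * r)) - 32 * A / r ^ 2 * ‖q.1 - x₀‖ ^ 2 with hΨ
  have hΨc : Continuous Ψ := by fun_prop
  have hmem : (x₀, x') ∈ Metric.closedBall x₀ r ×ˢ Metric.closedBall x₀ r :=
    ⟨by simp [hr.le], by simpa [dist_eq_norm] using hx'⟩
  obtain ⟨⟨x, y⟩, hxy, hmax⟩ := ((isCompact_closedBall x₀ r).prod
    (isCompact_closedBall x₀ r)).exists_isMaxOn ⟨_, hmem⟩ hΨc.continuousOn
  have hx : ‖x - x₀‖ ≤ r := by simpa [dist_eq_norm] using hxy.1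
  have hy : ‖y - x₀‖ ≤ r := by simpa [dist_eq_norm] using hxy.2
  have hle : Ψ (x₀, x') ≤ 0 := by
    by_contra hcon
    push Not at hcon
    obtain ⟨ε₀, hε₀, hε⟩ := hmain A r x₀ x y w hA hr hr1 hw hB hwA htail hx hy
      (fun u u' hu hu' => hmax (show (u, u') ∈ _ from
        ⟨by simpa [dist_eq_norm] using hu, by simpa [dist_eq_norm] using hu'⟩))
      (hcon.trans_le (hmax hmem))
    set e := min (ε₀ / 2) 1
    have he0 : 0 < e := by positivity
    have h1 := hε e he0 ((min_le_left _ _).trans_lt (by linarith))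
    have h2 := (abs_le.1 (hL e he0 (min_le_right _ _) x hx)).1
    have h3 := (abs_le.1 (hL e he0 (min_le_right _ _) y hy)).2
    have h4 : 0 < A / Phi φ r := div_pos hA (H.Phi_pos hr)
    linarith
  have hn : ‖x₀ - x'‖ ≤ r := by rwa [norm_sub_rev]
  have h1 : ω (‖x₀ - x'‖ / (2 * r)) ≤ (‖x₀ - x'‖ / r) ^ γ := by
    refine (hωγ _ ⟨by positivity, ?_⟩).trans ?_
    · rw [div_le_one (by positivity)]; linarith
    · gcongr; linarith
  have h2 := mul_le_mul_of_nonneg_left h1 (show 0 ≤ A * M by positivity)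
  simp only [hΨ, sub_self, norm_zero] at hle
  linarith

/-- Interior Hölder estimate for solutions of the evolution equation. -/
lemma holder_parabolic (H : HKAssumptions d φ J a₁ α₁ C₀ a b β κ κ₀ κ₁ κ₂ δ)
    {γ : ℝ} (hγ0 : 0 < γ) (hγ1 : γ ≤ 1) (hγ : γ < α₁) :
    ∃ M, 0 < M ∧ ∀ (A r t : ℝ) (x₀ : EuclideanSpace ℝ (Fin d))
      (w : ℝ → EuclideanSpace ℝ (Fin d) → ℝ), 0 < A → 0 < r → r ≤ 1 → 0 < t → Phi φ r ≤ t →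
      ContinuousOn (fun q : ℝ × EuclideanSpace ℝ (Fin d) => w q.1 q.2) (Icc (t / 2) t ×ˢ univ) →
      (∀ s ∈ Icc (t / 2) t, ∃ B, ∀ u, |w s u| ≤ B) →
      (∀ s ∈ Icc (t / 2) t, ∀ u, ‖u - x₀‖ ≤ r → |w s u| ≤ A) →
      (∀ s ∈ Icc (t / 2) t, ∀ u, ‖u - x₀‖ ≤ r / 2 →
        ∫ z in {z : EuclideanSpace ℝ (Fin d) | r / 2 < ‖z‖}, |w s (u + z)| * J ‖z‖ ≤
          A / Phi φ r) →
      (∀ s ∈ Icc (t / 2) t, ∀ u, ‖u - x₀‖ ≤ r → ∃ L, Tendsto (fun ε => Leps d κ J ε (w s) u)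
        (nhdsWithin 0 (Ioi 0)) (nhds L) ∧ HasDerivAt (fun s => w s u) L s) →
      ∀ x', ‖x' - x₀‖ ≤ r → |w t x₀ - w t x'| ≤ A * M * (‖x₀ - x'‖ / r) ^ γ := by
  obtain ⟨ω, hωc, hω0, hωn, hωγ, hmain⟩ := H.doubling_static hγ0 hγ1 hγ
  obtain ⟨M, hM, hmain⟩ := hmain 9 (by norm_num)
  refine ⟨M, hM, fun A r t x₀ w hA hr hr1 ht hrt hw hB hwA htail hL x' hx' => ?_⟩
  suffices key : ∀ w : ℝ → EuclideanSpace ℝ (Fin d) → ℝ,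
      ContinuousOn (fun q : ℝ × EuclideanSpace ℝ (Fin d) => w q.1 q.2) (Icc (t / 2) t ×ˢ univ) →
      (∀ s ∈ Icc (t / 2) t, ∃ B, ∀ u, |w s u| ≤ B) →
      (∀ s ∈ Icc (t / 2) t, ∀ u, ‖u - x₀‖ ≤ r → |w s u| ≤ A) →
      (∀ s ∈ Icc (t / 2) t, ∀ u, ‖u - x₀‖ ≤ r / 2 →
        ∫ z in {z : EuclideanSpace ℝ (Fin d) | r / 2 < ‖z‖}, |w s (u + z)| * J ‖z‖ ≤
          A / Phi φ r) →
      (∀ s ∈ Icc (t / 2) t, ∀ u, ‖u - x₀‖ ≤ r → ∃ L, Tendsto (fun ε => Leps d κ J ε (w s) u)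
        (nhdsWithin 0 (Ioi 0)) (nhds L) ∧ HasDerivAt (fun s => w s u) L s) →
      w t x₀ - w t x' ≤ A * M * (‖x₀ - x'‖ / r) ^ γ by
    refine abs_le.2 ⟨?_, key w hw hB hwA htail hL⟩
    have := key (fun s u => -w s u) hw.neg (by simpa only [abs_neg] using hB)
      (by simpa only [abs_neg] using hwA) (by simpa only [abs_neg] using htail)
      (fun s hs u hu => by
        obtain ⟨L, h1, h2⟩ := hL s hs u hu
        refine ⟨-L, ?_, h2.neg⟩
        simp only [Leps_neg]
        exact h1.neg)
    linarith
  clear! w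
  intro w hw hB hwA htail hL
  set Ψ : ℝ × EuclideanSpace ℝ (Fin d) × EuclideanSpace ℝ (Fin d) → ℝ := fun q =>
    w q.1 q.2.1 - w q.1 q.2.2 - A * M * ω (‖q.2.1 - q.2.2‖ / (2 * r)) -
      32 * A / r ^ 2 * ‖q.2.1 - x₀‖ ^ 2 - 8 * A / t * (t - q.1) with hΨ
  set K := Icc (t / 2) t ×ˢ Metric.closedBall x₀ r ×ˢ Metric.closedBall x₀ r with hK
  have hΨc : ContinuousOn Ψ K := by
    have h1 : ContinuousOn (fun q : ℝ × EuclideanSpace ℝ (Fin d) × EuclideanSpace ℝ (Fin d) =>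
        w q.1 q.2.1) K :=
      hw.comp (f := fun q : ℝ × EuclideanSpace ℝ (Fin d) × EuclideanSpace ℝ (Fin d) =>
        (q.1, q.2.1)) (by fun_prop) (fun q hq => ⟨hq.1, mem_univ _⟩)
    have h2 : ContinuousOn (fun q : ℝ × EuclideanSpace ℝ (Fin d) × EuclideanSpace ℝ (Fin d) =>
        w q.1 q.2.2) K :=
      hw.comp (f := fun q : ℝ × EuclideanSpace ℝ (Fin d) × EuclideanSpace ℝ (Fin d) =>
        (q.1, q.2.2)) (by fun_prop) (fun q hq => ⟨hq.1, mem_univ _⟩)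
    have h3 : Continuous (fun q : ℝ × EuclideanSpace ℝ (Fin d) × EuclideanSpace ℝ (Fin d) =>
        A * M * ω (‖q.2.1 - q.2.2‖ / (2 * r))) := by fun_prop
    have h4 : Continuous (fun q : ℝ × EuclideanSpace ℝ (Fin d) × EuclideanSpace ℝ (Fin d) =>
        32 * A / r ^ 2 * ‖q.2.1 - x₀‖ ^ 2) := by fun_prop
    have h5 : Continuous (fun q : ℝ × EuclideanSpace ℝ (Fin d) × EuclideanSpace ℝ (Fin d) =>
        8 * A / t * (t - q.1)) := by fun_prop
    exact (((h1.sub h2).sub h3.continuousOn).sub h4.continuousOn).sub h5.continuousOn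
  have htm : t ∈ Icc (t / 2) t := ⟨by linarith, le_rfl⟩
  have hmem : (t, x₀, x') ∈ K :=
    ⟨htm, by simp [hr.le], by simpa [dist_eq_norm] using hx'⟩
  obtain ⟨⟨s, x, y⟩, hxy, hmax⟩ := (isCompact_Icc.prod ((isCompact_closedBall x₀ r).prod
    (isCompact_closedBall x₀ r))).exists_isMaxOn ⟨_, hmem⟩ hΨc
  have hs : s ∈ Icc (t / 2) t := hxy.1
  have hx : ‖x - x₀‖ ≤ r := by simpa [dist_eq_norm] using hxy.2.1
  have hy : ‖y - x₀‖ ≤ r := by simpa [dist_eq_norm] using hxy.2.2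
  have hle : Ψ (t, x₀, x') ≤ 0 := by
    by_contra hcon
    push Not at hcon
    have hpos := hcon.trans_le (hmax hmem)
    have hmax' : ∀ s' u u', s' ∈ Icc (t / 2) t → ‖u - x₀‖ ≤ r → ‖u' - x₀‖ ≤ r →
        Ψ (s', u, u') ≤ Ψ (s, x, y) := fun s' u u' hs' hu hu' =>
      hmax (show (s', u, u') ∈ K from
        ⟨hs', by simpa [dist_eq_norm] using hu, by simpa [dist_eq_norm] using hu'⟩)
    simp only [hΨ] at hpos hmax'
    have hP := H.Phi_pos hr
    have hpen : 0 ≤ 8 * A / t * (t - s) := mul_nonneg (by positivity) (by linarith [hs.2])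
    have hpos' : 0 < w s x - w s y - A * M * ω (‖x - y‖ / (2 * r)) -
        32 * A / r ^ 2 * ‖x - x₀‖ ^ 2 := by linarith
    obtain ⟨ε₀, hε₀, hε⟩ := hmain A r x₀ x y (w s) hA hr hr1
      (by
        rw [← continuousOn_univ]
        exact hw.comp (f := fun u => (s, u)) (by fun_prop) (fun q hq => ⟨hs, mem_univ _⟩))
      (hB s hs) (hwA s hs) (htail s hs) hx hy
      (fun u u' hu hu' => by have := hmax' s u u' hs hu hu'; linarith) hpos'
    obtain ⟨L₁, h1, h1'⟩ := hL s hs x hx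
    obtain ⟨L₂, h2, h2'⟩ := hL s hs y hy
    have hLL : L₁ - L₂ ≤ -(9 * (A / Phi φ r)) := by
      refine le_of_tendsto (h1.sub h2) ?_
      filter_upwards [Ioo_mem_nhdsGT hε₀] with ε he using hε ε he.1 he.2
    have hωnn : 0 ≤ A * M * ω (‖x - y‖ / (2 * r)) := by
      refine mul_nonneg (by positivity) (hωn _ ⟨by positivity, ?_⟩)
      rw [div_le_one (by positivity), show x - y = (x - x₀) - (y - x₀) by abel]
      exact (norm_sub_le _ _).trans (by linarith)
    have hst : t / 2 < s := by
      refine lt_of_le_of_ne hs.1 fun he => ?_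
      have e1 := (abs_le.1 (hwA s hs x hx)).2
      have e2 := (abs_le.1 (hwA s hs y hy)).1
      have hq : 0 ≤ 32 * A / r ^ 2 * ‖x - x₀‖ ^ 2 := by positivity
      have e3 : 8 * A / t * (t - s) = 4 * A := by rw [← he]; field_simp; ring
      linarith
    have hD : HasDerivAt (fun s => w s x - w s y + 8 * A / t * s) (L₁ - L₂ + 8 * A / t) s := by
      have := (h1'.sub h2').add ((hasDerivAt_id s).const_mul (8 * A / t))
      rwa [mul_one] at this
    have h0 := hD.nonneg_of_left_max hst (fun u hu => by
      have := hmax' u x y ⟨hu.1, hu.2.trans hs.2⟩ hx hy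
      linarith)
    have h3 : A / t ≤ A / Phi φ r := by gcongr
    have h4 : 0 < A / t := by positivity
    have h5 : 8 * A / t = 8 * (A / t) := by ring
    linarith
  have hn : ‖x₀ - x'‖ ≤ r := by rwa [norm_sub_rev]
  have h1 : ω (‖x₀ - x'‖ / (2 * r)) ≤ (‖x₀ - x'‖ / r) ^ γ := by
    refine (hωγ _ ⟨by positivity, ?_⟩).trans ?_
    · rw [div_le_one (by positivity)]; linarith
    · gcongr; linarith
  have h2 := mul_le_mul_of_nonneg_left h1 (show 0 ≤ A * M by positivity)
  simp only [hΨ, sub_self, norm_zero] at hle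
  linarith

end HKAssumptions

/-- The polynomial off-diagonal profile. -/
noncomputable def profile (d : ℕ) (φ : ℝ → ℝ) (r : ℝ) : ℝ := 1 / (r ^ d * Phi φ r)

/-- The spatial scale attached to time `t`, capped at one. -/
noncomputable def scale (Φinv : ℝ → ℝ) (t : ℝ) : ℝ := min 1 (Φinv t)

variable {Φinv : ℝ → ℝ}

namespace HKAssumptions

lemma profile_pos (H : HKAssumptions d φ J a₁ α₁ C₀ a b β κ κ₀ κ₁ κ₂ δ) {r : ℝ} (hr : 0 < r) :
    0 < profile d φ r := by
  have := H.Phi_pos hr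
  unfold profile
  positivity

lemma profile_anti (H : HKAssumptions d φ J a₁ α₁ C₀ a b β κ κ₀ κ₁ κ₂ δ) {r R : ℝ} (hr : 0 < r)
    (hrR : r ≤ R) : profile d φ R ≤ profile d φ r := by
  have h1 := H.Phi_pos hr
  have h2 := H.Phi_mono hr hrR
  have hR := hr.trans_le hrR
  unfold profile
  gcongr

lemma profile_upper (H : HKAssumptions d φ J a₁ α₁ C₀ a b β κ κ₀ κ₁ κ₂ δ) {r R : ℝ} (hr : 0 < r)
    (hrR : r ≤ R) : profile d φ r ≤ (R / r) ^ (d + 2) * profile d φ R := by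
  have h1 := H.Phi_pos hr
  have hR := hr.trans_le hrR
  have h3 := H.Phi_pos hR
  have h2 := H.Phi_upper hr hrR
  unfold profile
  rw [mul_one_div, div_le_div_iff₀ (by positivity) (by positivity), one_mul]
  calc R ^ d * Phi φ R ≤ R ^ d * ((R / r) ^ 2 * Phi φ r) := by gcongr
    _ = (R / r) ^ (d + 2) * (r ^ d * Phi φ r) := by
      rw [pow_add, div_pow R r d]; field_simp

lemma scale_pos (S : PhiInvSpec φ Φinv) {t : ℝ} (ht : 0 < t) : 0 < scale Φinv t :=
  lt_min one_pos (S.pos t ht)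

lemma Phiinv_mono (H : HKAssumptions d φ J a₁ α₁ C₀ a b β κ κ₀ κ₁ κ₂ δ) (S : PhiInvSpec φ Φinv)
    {s t : ℝ} (hs : 0 < s) (hst : s ≤ t) : Φinv s ≤ Φinv t := by
  by_contra hcon
  push Not at hcon
  have ht := hs.trans_le hst
  have h1 := H.Phi_mono (S.pos t ht) hcon.le
  rw [S.right_inv t ht, S.right_inv s hs] at h1
  rw [le_antisymm hst h1] at hcon
  exact lt_irrefl _ hcon

lemma Phi_scale_le (H : HKAssumptions d φ J a₁ α₁ C₀ a b β κ κ₀ κ₁ κ₂ δ) (S : PhiInvSpec φ Φinv)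
    {t : ℝ} (ht : 0 < t) : Phi φ (scale Φinv t) ≤ t :=
  (H.Phi_mono (scale_pos S ht) (min_le_right _ _)).trans_eq (S.right_inv t ht)

lemma exists_scale (H : HKAssumptions d φ J a₁ α₁ C₀ a b β κ κ₀ κ₁ κ₂ δ) (S : PhiInvSpec φ Φinv)
    (T : ℝ) : ∃ K, 1 ≤ K ∧ ∀ t, 0 < t → t ≤ T →
      Φinv t ≤ K * scale Φinv t ∧ t ≤ K * Phi φ (scale Φinv t) := by
  set R := max 1 (Φinv T) with hR
  have hR1 : 1 ≤ R := le_max_left _ _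
  refine ⟨R ^ 2, one_le_pow₀ hR1, fun t ht htT => ?_⟩
  have hs := scale_pos S ht
  have h1 : Φinv t ≤ R * scale Φinv t := by
    rw [scale, mul_min_of_nonneg _ _ (by positivity)]
    refine le_min ?_ ?_
    · rw [mul_one]; exact (H.Phiinv_mono S ht htT).trans (le_max_right _ _)
    · exact le_mul_of_one_le_left (S.pos t ht).le hR1
  constructor
  · refine h1.trans ?_
    gcongr
    nlinarith
  · have h2 := H.Phi_upper hs (min_le_right 1 (Φinv t))
    rw [S.right_inv t ht] at h2
    refine h2.trans ?_
    have := H.Phi_pos hs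
    have h3 : Φinv t / scale Φinv t ≤ R := by rwa [div_le_iff₀ hs]
    have h4 : 0 ≤ Φinv t / scale Φinv t := div_nonneg (S.pos t ht).le hs.le
    gcongr

lemma Gtil_le (S : PhiInvSpec φ Φinv)
    {t : ℝ} (ht : 0 < t) (x : EuclideanSpace ℝ (Fin d)) :
    Gtil d φ Φinv t x ≤ 1 / (t * scale Φinv t ^ d) := by
  have hs := scale_pos S ht
  have h1 : 1 / (t * Φinv t ^ d) ≤ 1 / (t * scale Φinv t ^ d) := by
    have : scale Φinv t ≤ Φinv t := min_le_right _ _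
    gcongr
  unfold Gtil
  split_ifs
  · exact h1
  · exact (min_le_left _ _).trans h1

lemma Gtil_le_profile {t : ℝ} {x : EuclideanSpace ℝ (Fin d)} (hx : x ≠ 0) :
    Gtil d φ Φinv t x ≤ profile d φ ‖x‖ := by
  rw [Gtil, if_neg hx]
  exact min_le_right _ _

end HKAssumptions

namespace GoodHeatKernel

variable {p : ℝ → EuclideanSpace ℝ (Fin d) → EuclideanSpace ℝ (Fin d) → ℝ}

lemma cont_fst (G : GoodHeatKernel d φ J b β Φinv κ p) {t : ℝ} (ht : 0 < t)
    (y : EuclideanSpace ℝ (Fin d)) : Continuous fun x => p t x y := by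
  rw [← continuousOn_univ]
  exact G.cont.comp (f := fun x => (t, x, y)) (by fun_prop) fun x _ => ⟨ht, mem_univ _⟩

lemma cont_snd (G : GoodHeatKernel d φ J b β Φinv κ p) {t : ℝ} (ht : 0 < t)
    (x : EuclideanSpace ℝ (Fin d)) : Continuous fun y => p t x y := by
  rw [← continuousOn_univ]
  exact G.cont.comp (f := fun y => (t, x, y)) (by fun_prop) fun x _ => ⟨ht, mem_univ _⟩

lemma cont_prod (G : GoodHeatKernel d φ J b β Φinv κ p) (y : EuclideanSpace ℝ (Fin d)) :
    ContinuousOn (fun q : ℝ × EuclideanSpace ℝ (Fin d) => p q.1 q.2 y) (Ioi 0 ×ˢ univ) :=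
  G.cont.comp (f := fun q : ℝ × EuclideanSpace ℝ (Fin d) => (q.1, q.2, y)) (by fun_prop)
    fun q hq => ⟨hq.1, mem_univ _⟩

/-- Lipschitz continuity in time off the diagonal. -/
lemma time_lipschitz (G : GoodHeatKernel d φ J b β Φinv κ p) {T : ℝ} (hT : 1 ≤ T) :
    ∃ c, 0 < c ∧ ∀ s t, 0 < s → s ≤ t → t ≤ T → ∀ x y, x ≠ y →
      |p t x y - p s x y| ≤ c * profile d φ ‖x - y‖ * (t - s) := by
  obtain ⟨c, hc, hfrac⟩ := G.frac T hT
  refine ⟨c, hc, fun s t hs hst htT x y hxy => ?_⟩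
  choose! L hL1 hL2 using fun u (hu : 0 < u) => G.eqn u hu x y hxy
  have hbound : ∀ u ∈ Icc s t, ‖L u‖ ≤ c * profile d φ ‖x - y‖ := fun u hu => by
    have hu0 := hs.trans_le hu.1
    refine le_of_tendsto (hL1 u hu0).norm ?_
    filter_upwards [Ioc_mem_nhdsGT one_pos] with ε hε
    refine (hfrac ε hε.1 hε.2 u hu0 (hu.2.trans htT) x y hxy).trans ?_
    exact mul_le_mul_of_nonneg_left (HKAssumptions.Gtil_le_profile (sub_ne_zero.2 hxy)) hc.le
  have := (convex_Icc s t).norm_image_sub_le_of_norm_hasDerivWithin_le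
    (f := fun s => p s x y) (f' := L)
    (fun u hu => (hL2 u (hs.trans_le hu.1)).hasDerivWithinAt) hbound
    (left_mem_Icc.2 hst) (right_mem_Icc.2 hst)
  rwa [Real.norm_eq_abs, Real.norm_eq_abs, abs_of_nonneg (by linarith : 0 ≤ t - s)] at this

/-- The kernel vanishes at time zero off the diagonal. -/
lemma exists_abs_le (H : HKAssumptions d φ J a₁ α₁ C₀ a b β κ κ₀ κ₁ κ₂ δ)
    (G : GoodHeatKernel d φ J b β Φinv κ p) {x y : EuclideanSpace ℝ (Fin d)} (hxy : x ≠ y)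
    {η : ℝ} (hη : 0 < η) : ∃ s₀, 0 < s₀ ∧ ∀ s, 0 < s → s < s₀ → |p s x y| ≤ η := by
  obtain ⟨c, hc, hlip⟩ := G.time_lipschitz le_rfl
  set ρ := ‖x - y‖ / 2 with hρ
  have hρ0 : 0 < ρ := half_pos (norm_pos_iff.2 (sub_ne_zero.2 hxy))
  have hF := H.profile_pos hρ0
  refine ⟨min 1 (η / (4 * (c * profile d φ ρ))), by positivity, fun s hs hss => ?_⟩
  have hs1 : s ≤ 1 := hss.le.trans (min_le_left _ _)
  have hsF : c * profile d φ ρ * s ≤ η / 4 := by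
    have := hss.le.trans (min_le_right _ _)
    rw [le_div_iff₀ (by positivity)] at this
    linarith
  by_contra hcon
  push Not at hcon
  obtain ⟨σ, hσ, hσp⟩ : ∃ σ : ℝ, |σ| = 1 ∧ η < σ * p s x y := by
    rcases le_total 0 (p s x y) with h | h
    · exact ⟨1, by simp, by rwa [one_mul, ← abs_of_nonneg h]⟩
    · exact ⟨-1, by simp, by rwa [neg_one_mul, ← abs_of_nonpos h]⟩
  obtain ⟨ρ', hρ', hcl⟩ := Metric.continuousAt_iff.1
    ((G.cont_snd hs x).continuousAt (x := y)) (η / 4) (by positivity)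
  set τ := min ρ ρ' with hτ
  have hτ0 : 0 < τ := lt_min hρ0 hρ'
  have hlow : ∀ u, 0 < u → u ≤ s → ∀ y', ‖y' - y‖ < τ → η / 2 ≤ σ * p u x y' := by
    intro u hu hus y' hy'
    have hd : ρ ≤ ‖x - y'‖ := by
      have h1 : ‖y' - y‖ < ρ := hy'.trans_le (min_le_left _ _)
      have h2 := norm_sub_le_norm_sub_add_norm_sub x y' y
      linarith
    have h1 := hlip u s hu hus hs1 x y' (fun h => by
      rw [h, sub_self, norm_zero] at hd; linarith)
    have h2 := H.profile_anti hρ0 hd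
    have h3 : |p s x y' - p u x y'| ≤ η / 4 := by
      refine h1.trans (le_trans ?_ hsF)
      gcongr
      linarith
    have h4 : |p s x y' - p s x y| < η / 4 := hcl (by
      rw [dist_eq_norm]; exact hy'.trans_le (min_le_right _ _))
    have h5 : |σ * (p s x y - p u x y')| ≤ η / 2 := by
      rw [abs_mul, hσ, one_mul, show p s x y - p u x y' =
        (p s x y' - p u x y') - (p s x y' - p s x y) by ring]
      exact (abs_sub _ _).trans (by linarith)
    have h6 := (abs_le.1 h5).2
    rw [mul_sub] at h6
    linarith
  set f : EuclideanSpace ℝ (Fin d) → ℝ := fun y' => max 0 (τ - ‖y' - y‖) with hf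
  have hfc : Continuous f := by fun_prop
  have hf0 : ∀ y', τ ≤ ‖y' - y‖ → f y' = 0 := fun y' h => max_eq_left (by linarith)
  have hfnn : ∀ y', 0 ≤ f y' := fun y' => le_max_left _ _
  have hcs : HasCompactSupport f := by
    refine HasCompactSupport.intro (isCompact_closedBall y τ) fun y' hy' => hf0 y' ?_
    rw [Metric.mem_closedBall, dist_eq_norm] at hy'
    linarith
  have hfpos : 0 < ∫ y', f y' := by
    refine hfc.integral_pos_of_hasCompactSupport_nonneg_nonzero hcs hfnn (x := y) ?_
    simp only [hf, sub_self, norm_zero, sub_zero]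
    exact (hτ0.trans_le (le_max_right _ _)).ne'
  have hfx : f x = 0 := hf0 x (by
    have := min_le_left ρ ρ'
    linarith [norm_nonneg (x - y)])
  obtain ⟨t₀, ht₀, happ⟩ := G.approx f ⟨τ, fun y' => by
      rw [abs_of_nonneg (hfnn y')]
      exact max_le hτ0.le (by linarith [norm_nonneg (y' - y)])⟩
    (hcs.uniformContinuous_of_continuous hfc) ((η / 4) * ∫ y', f y')
    (mul_pos (by positivity) hfpos)
  set u := min s (t₀ / 2) with hu
  have hu0 : 0 < u := by positivity
  have h1 := happ u hu0 ((min_le_right _ _).trans_lt (by linarith)) x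
  rw [hfx, sub_zero] at h1
  have h2 : (η / 2) * ∫ y', f y' ≤ σ * ∫ y', p u x y' * f y' := by
    rw [← integral_const_mul, ← integral_const_mul]
    refine integral_mono ((hfc.integrable_of_hasCompactSupport hcs).const_mul _)
      ((Continuous.integrable_of_hasCompactSupport ((G.cont_snd hu0 x).mul hfc)
        hcs.mul_left).const_mul σ) fun y' => ?_
    rcases lt_or_ge ‖y' - y‖ τ with h | h
    · have := hlow u hu0 (min_le_left _ _) y' h
      have := mul_le_mul_of_nonneg_right this (hfnn y')
      simpa only [mul_assoc] using this
    · simp [hf0 y' h]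
  have h3 : σ * ∫ y', p u x y' * f y' ≤ (η / 4) * ∫ y', f y' := by
    refine (le_abs_self _).trans ?_
    rwa [abs_mul, hσ, one_mul]
  have h4 := mul_pos hη hfpos
  linarith

/-- Off-diagonal two-sided bound. -/
lemma abs_le_profile (H : HKAssumptions d φ J a₁ α₁ C₀ a b β κ κ₀ κ₁ κ₂ δ)
    (G : GoodHeatKernel d φ J b β Φinv κ p) {T : ℝ} (hT : 1 ≤ T) :
    ∃ c, 0 < c ∧ ∀ t, 0 < t → t ≤ T → ∀ x y, x ≠ y →
      |p t x y| ≤ c * t * profile d φ ‖x - y‖ := by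
  obtain ⟨c, hc, hlip⟩ := G.time_lipschitz hT
  refine ⟨c, hc, fun t ht htT x y hxy => le_of_forall_pos_le_add fun η hη => ?_⟩
  obtain ⟨s₀, hs₀, hs⟩ := G.exists_abs_le H hxy hη
  set s := min (s₀ / 2) t
  have hs0 : 0 < s := by positivity
  have h1 := hlip s t hs0 (min_le_right _ _) htT x y hxy
  have h2 := hs s hs0 ((min_le_left _ _).trans_lt (by linarith))
  have hF := H.profile_pos (norm_pos_iff.2 (sub_ne_zero.2 hxy))
  have h3 : c * profile d φ ‖x - y‖ * (t - s) ≤ c * t * profile d φ ‖x - y‖ := by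
    have : 0 ≤ c * profile d φ ‖x - y‖ * s := by positivity
    linarith
  have h4 := abs_sub_abs_le_abs_sub (p t x y) (p s x y)
  linarith

end GoodHeatKernel

namespace HKAssumptions

lemma continuous_kappa (H : HKAssumptions d φ J a₁ α₁ C₀ a b β κ κ₀ κ₁ κ₂ δ)
    (z : EuclideanSpace ℝ (Fin d)) : Continuous fun x => κ x z := by
  refine continuous_iff_continuousAt.2 fun y => ?_
  rw [ContinuousAt, tendsto_iff_dist_tendsto_zero]
  have h0 : Tendsto (fun x => κ₂ * ‖x - y‖ ^ δ) (nhds y) (nhds 0) := by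
    have h : Continuous fun x : EuclideanSpace ℝ (Fin d) => κ₂ * ‖x - y‖ ^ δ :=
      continuous_const.mul ((continuous_norm.comp (continuous_id.sub continuous_const)).rpow_const
        fun _ => Or.inr H.δ_pos.le)
    have := h.tendsto y
    simpa [Real.zero_rpow H.δ_pos.ne'] using this
  exact squeeze_zero (fun _ => dist_nonneg) (fun x => by
    rw [Real.dist_eq]; exact H.κ_holder x y z) h0

lemma continuous_Leps (H : HKAssumptions d φ J a₁ α₁ C₀ a b β κ κ₀ κ₁ κ₂ δ) {ε : ℝ}
    (hε : 0 < ε) {w : EuclideanSpace ℝ (Fin d) → ℝ} (hw : Continuous w)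
    (hB : ∃ B, ∀ x, |w x| ≤ B) : Continuous fun x => Leps d κ J ε w x := by
  obtain ⟨B, hB⟩ := hB
  refine continuous_of_dominated (bound := fun z => (B + B) * (κ₁ * J ‖z‖))
    (fun x => (H.integrableOn_Leps hε hw ⟨B, hB⟩ x).aestronglyMeasurable) (fun x => ?_)
    (((H.integrableOn_J hε).const_mul κ₁).const_mul _) (Eventually.of_forall fun z => ?_)
  · filter_upwards [ae_restrict_mem measurableSet_norm_gt] with z hz
    have hJ := H.J_nonneg hε.le hz
    have hk := H.κ₀_pos.le.trans (H.κ_low x z)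
    have hB0 : 0 ≤ B := (abs_nonneg _).trans (hB x)
    rw [Real.norm_eq_abs, abs_mul, abs_of_nonneg (mul_nonneg hk hJ)]
    gcongr
    · exact (abs_sub _ _).trans (add_le_add (hB _) (hB _))
    · exact H.κ_up x z
  · have := H.continuous_kappa z
    fun_prop

lemma Leps_split (H : HKAssumptions d φ J a₁ α₁ C₀ a b β κ κ₀ κ₁ κ₂ δ) {ε R : ℝ}
    (hε : 0 < ε) (hR : ε ≤ R) {w : EuclideanSpace ℝ (Fin d) → ℝ} (hw : Continuous w)
    (hB : ∃ B, ∀ x, |w x| ≤ B) (x : EuclideanSpace ℝ (Fin d)) :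
    Leps d κ J ε w x =
      (∫ z in annulus d ε R, (w (x + z) - w x) * (κ x z * J ‖z‖)) +
      ∫ z in {z : EuclideanSpace ℝ (Fin d) | R < ‖z‖}, (w (x + z) - w x) * (κ x z * J ‖z‖) := by
  rw [Leps, norm_gt_eq_union hR]
  exact setIntegral_union disjoint_annulus_norm_gt measurableSet_norm_gt
    ((H.integrableOn_Leps hε hw hB x).mono_set annulus_subset)
    (H.integrableOn_Leps (hε.trans_le hR) hw hB x)

/-- The truncated paraboloid is a strict subsolution near its vertex. -/
lemma le_Leps_barrier (H : HKAssumptions d φ J a₁ α₁ C₀ a b β κ κ₀ κ₁ κ₂ δ) :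
    ∃ c, 0 < c ∧ ∀ r, 0 < r → r ≤ 1 → ∃ ε₀, 0 < ε₀ ∧ ∀ ε, 0 < ε → ε < ε₀ →
      ∀ x x₀ : EuclideanSpace ℝ (Fin d), ‖x - x₀‖ ≤ r →
      c / Phi φ r ≤ Leps d κ J ε (fun u => min (‖u - x₀‖ ^ 2 / r ^ 2) 16) x := by
  obtain ⟨c, hc, hlow⟩ := H.le_integral_sq_mul_J
  have hk0 := H.κ₀_pos
  refine ⟨κ₀ * c, by positivity, fun r hr hr1 => ?_⟩
  obtain ⟨ε₀, hε₀, hlow⟩ := hlow r hr hr1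
  refine ⟨min ε₀ r, by positivity, fun ε hε hεε x x₀ hx => ?_⟩
  have hεr : ε < r := hεε.trans_le (min_le_right _ _)
  have h1 := hlow ε hε (hεε.trans_le (min_le_left _ _))
  set w : EuclideanSpace ℝ (Fin d) → ℝ := fun u => min (‖u - x₀‖ ^ 2 / r ^ 2) 16 with hw
  have hwc : Continuous w := by fun_prop
  have hwB : ∃ B, ∀ u, |w u| ≤ B := ⟨16, fun u => by
    rw [abs_of_nonneg (le_min (by positivity) (by norm_num))]; exact min_le_right _ _⟩
  have hquad : ∀ u, ‖u - x₀‖ ≤ 4 * r → w u = ‖u - x₀‖ ^ 2 / r ^ 2 := fun u hu => by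
    refine min_eq_left ?_
    rw [div_le_iff₀ (by positivity)]
    calc ‖u - x₀‖ ^ 2 ≤ (4 * r) ^ 2 := by gcongr
      _ = 16 * r ^ 2 := by ring
  have hwx : w x ≤ 1 := by
    refine (min_le_left _ _).trans ?_
    rw [div_le_one (by positivity)]
    gcongr
  rw [H.Leps_split hε (show ε ≤ 3 * r by linarith) hwc hwB x]
  have htail : 0 ≤ ∫ z in {z : EuclideanSpace ℝ (Fin d) | 3 * r < ‖z‖},
      (w (x + z) - w x) * (κ x z * J ‖z‖) := by
    refine setIntegral_nonneg measurableSet_norm_gt fun z hz => ?_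
    refine mul_nonneg ?_ (mul_nonneg (hk0.le.trans (H.κ_low x z))
      (H.J_nonneg (by positivity) hz))
    have hz' : 3 * r < ‖z‖ := hz
    have h2 : 2 * r ≤ ‖x + z - x₀‖ := by
      have := norm_sub_le_norm_add z (x - x₀)
      rw [show x + z - x₀ = z + (x - x₀) by abel]
      linarith
    have h3 : 1 ≤ w (x + z) := by
      refine le_min ?_ (by norm_num)
      rw [le_div_iff₀ (by positivity), one_mul]
      gcongr
      linarith
    linarith
  have hk : Measurable (κ x) := H.measurable_kappa x
  have hkΛ : ∀ z, |κ x z| ≤ κ₁ := fun z => by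
    rw [abs_of_nonneg (hk0.le.trans (H.κ_low x z))]; exact H.κ_up x z
  have hmain := setIntegral_annulus_symm_le (ε := ε) (ρ := 3 * r)
    (f := fun z => w x - w (x + z)) (B := fun z => -(‖z‖ ^ 2 / r ^ 2))
    (q := fun z => κ x z * J ‖z‖)
    (H.integrableOn_annulus hε (by fun_prop) hk hkΛ)
    (H.integrableOn_annulus hε (by fun_prop) hk hkΛ)
    (fun z => by rw [norm_neg, ← H.κ_sym]) (fun z hz => mul_nonneg (hk0.le.trans (H.κ_low x z))
      (H.J_nonneg hε.le hz.1)) (fun z hz => by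
      have hz' : ‖z‖ ≤ 3 * r := hz.2
      have e1 : x + z - x₀ = (x - x₀) + z := by abel
      have e2 : x + -z - x₀ = (x - x₀) - z := by abel
      rw [hquad x (by linarith), hquad (x + z) (by
        rw [e1]; exact (norm_add_le _ _).trans (by linarith)), hquad (x + -z) (by
        rw [e2]; exact (norm_sub_le _ _).trans (by linarith)), e1, e2, norm_add_sq_real,
        norm_sub_sq_real (x - x₀) z]
      apply le_of_eq
      ring)
  have e3 : ∀ z, (w x - w (x + z)) * (κ x z * J ‖z‖) =
      -((w (x + z) - w x) * (κ x z * J ‖z‖)) := fun z => by ring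
  have e4 : ∀ z : EuclideanSpace ℝ (Fin d), -(‖z‖ ^ 2 / r ^ 2) * (κ x z * J ‖z‖) =
      -(‖z‖ ^ 2 / r ^ 2 * (κ x z * J ‖z‖)) := fun z => by ring
  simp only [e3, e4, integral_neg] at hmain
  have i1 : IntegrableOn (fun z : EuclideanSpace ℝ (Fin d) =>
      ‖z‖ ^ 2 / r ^ 2 * (κ x z * J ‖z‖)) (annulus d ε (3 * r)) :=
    H.integrableOn_annulus hε (by fun_prop) hk hkΛ
  have i2 : IntegrableOn (fun z : EuclideanSpace ℝ (Fin d) => ‖z‖ ^ 2 * J ‖z‖)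
      (annulus d ε r) := by
    simpa using H.integrableOn_annulus (f := fun z => ‖z‖ ^ 2) (q := fun _ => 1) (Λ := 1)
      hε (by fun_prop) measurable_const (by simp)
  have hsub : annulus d ε r ⊆ annulus d ε (3 * r) := fun z hz => ⟨hz.1, hz.2.trans (by linarith)⟩
  have h2 : ∫ z in annulus d ε r, ‖z‖ ^ 2 / r ^ 2 * (κ x z * J ‖z‖) ≤
      ∫ z in annulus d ε (3 * r), ‖z‖ ^ 2 / r ^ 2 * (κ x z * J ‖z‖) := by
    refine setIntegral_mono_set i1 ?_ hsub.eventuallyLE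
    filter_upwards [ae_restrict_mem measurableSet_annulus] with z hz
    exact mul_nonneg (by positivity) (mul_nonneg (hk0.le.trans (H.κ_low x z))
      (H.J_nonneg hε.le hz.1))
  have h3 : κ₀ / r ^ 2 * ∫ z in annulus d ε r, ‖z‖ ^ 2 * J ‖z‖ ≤
      ∫ z in annulus d ε r, ‖z‖ ^ 2 / r ^ 2 * (κ x z * J ‖z‖) := by
    rw [← integral_const_mul]
    refine setIntegral_mono_on (i2.const_mul _) (i1.mono_set hsub) measurableSet_annulus
      fun z hz => ?_
    have hJ := H.J_nonneg hε.le hz.1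
    calc κ₀ / r ^ 2 * (‖z‖ ^ 2 * J ‖z‖) = ‖z‖ ^ 2 / r ^ 2 * (κ₀ * J ‖z‖) := by ring
      _ ≤ _ := by gcongr; exact H.κ_low x z
  have h4 := mul_le_mul_of_nonneg_left h1 (show 0 ≤ κ₀ / r ^ 2 by positivity)
  have h5 : κ₀ / r ^ 2 * (c * (r ^ 2 / Phi φ r)) = κ₀ * c / Phi φ r := by field_simp
  linarith

lemma Leps_add_mul (H : HKAssumptions d φ J a₁ α₁ C₀ a b β κ κ₀ κ₁ κ₂ δ) {ε l : ℝ}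
    (hε : 0 < ε) {w v : EuclideanSpace ℝ (Fin d) → ℝ} (hw : Continuous w)
    (hB : ∃ B, ∀ x, |w x| ≤ B) (hv : Continuous v) (hB' : ∃ B, ∀ x, |v x| ≤ B)
    (x : EuclideanSpace ℝ (Fin d)) :
    Leps d κ J ε (fun u => w u + l * v u) x = Leps d κ J ε w x + l * Leps d κ J ε v x := by
  have i1 := H.integrableOn_Leps hε hw hB x
  have i2 := (H.integrableOn_Leps hε hv hB' x).const_mul l
  rw [Leps, Leps, Leps, ← integral_const_mul, ← integral_add i1 i2]
  congr 1
  ext z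
  ring

lemma Leps_nonpos_of_max (H : HKAssumptions d φ J a₁ α₁ C₀ a b β κ κ₀ κ₁ κ₂ δ) {ε : ℝ}
    (hε : 0 < ε) {w : EuclideanSpace ℝ (Fin d) → ℝ} {x : EuclideanSpace ℝ (Fin d)}
    (hmax : ∀ u, w u ≤ w x) : Leps d κ J ε w x ≤ 0 :=
  setIntegral_nonpos measurableSet_norm_gt fun z hz =>
    mul_nonpos_of_nonpos_of_nonneg (by linarith [hmax (x + z)])
      (mul_nonneg (H.κ₀_pos.le.trans (H.κ_low x z)) (H.J_nonneg hε.le hz))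

/-- A maximum principle on small balls; the equation may fail at the centre. -/
lemma abs_le_of_Leps (H : HKAssumptions d φ J a₁ α₁ C₀ a b β κ κ₀ κ₁ κ₂ δ) :
    ∃ C, 1 ≤ C ∧ ∀ (A r : ℝ) (x₀ : EuclideanSpace ℝ (Fin d)) (w : EuclideanSpace ℝ (Fin d) → ℝ),
      0 < A → 0 < r → r ≤ 1 → Continuous w → (∃ B, ∀ u, |w u| ≤ B) →
      (∀ u, r ≤ ‖u - x₀‖ → |w u| ≤ A) →
      (∀ ε, 0 < ε → ε ≤ 1 → ∀ u, u ≠ x₀ → |Leps d κ J ε w u| ≤ A / Phi φ r) →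
      ∀ u, |w u| ≤ C * A := by
  obtain ⟨c, hc, hbar⟩ := H.le_Leps_barrier
  refine ⟨1 + 16 * (2 / c), by
    have : 0 < 16 * (2 / c) := by positivity
    linarith, fun A r x₀ w hA hr hr1 hw hB hwA hL => ?_⟩
  suffices key : ∀ w : EuclideanSpace ℝ (Fin d) → ℝ, Continuous w → (∃ B, ∀ u, |w u| ≤ B) →
      (∀ u, r ≤ ‖u - x₀‖ → |w u| ≤ A) →
      (∀ ε, 0 < ε → ε ≤ 1 → ∀ u, u ≠ x₀ → |Leps d κ J ε w u| ≤ A / Phi φ r) →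
      ∀ u, w u ≤ (1 + 16 * (2 / c)) * A by
    intro u
    refine abs_le.2 ⟨?_, key w hw hB hwA hL u⟩
    have := key (fun u => -w u) hw.neg (by simpa only [abs_neg] using hB)
      (by simpa only [abs_neg] using hwA) (by simpa only [Leps_neg, abs_neg] using hL) u
    linarith
  clear! w
  intro w hw hB hwA hL u
  have hP := H.Phi_pos hr
  have hL' : ∀ ε, 0 < ε → ε ≤ 1 → ∀ u, |Leps d κ J ε w u| ≤ A / Phi φ r := fun ε hε hε1 u => by
    have := nontrivial_euclideanSpace H.hd
    have hcl : IsClosed {u | |Leps d κ J ε w u| ≤ A / Phi φ r} :=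
      isClosed_le (H.continuous_Leps hε hw hB).abs continuous_const
    have hd : Dense ({x₀}ᶜ : Set (EuclideanSpace ℝ (Fin d))) := dense_compl_singleton x₀
    exact hcl.closure_subset_iff.2 (fun u hu => hL ε hε hε1 u hu) (hd u)
  set l := 2 / c * A with hl
  have hl0 : 0 < l := by positivity
  set q : EuclideanSpace ℝ (Fin d) → ℝ := fun u => min (‖u - x₀‖ ^ 2 / r ^ 2) 16 with hq
  have hqc : Continuous q := by fun_prop
  have hq0 : ∀ u, 0 ≤ q u := fun u => le_min (by positivity) (by norm_num)
  have hqB : ∃ B, ∀ u, |q u| ≤ B := ⟨16, fun u => by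
    rw [abs_of_nonneg (hq0 u)]; exact min_le_right _ _⟩
  by_contra hcon
  push Not at hcon
  have hlq : ∀ u, l * q u ≤ 16 * l := fun u => by
    have := mul_le_mul_of_nonneg_left (min_le_right (‖u - x₀‖ ^ 2 / r ^ 2) 16) hl0.le
    linarith
  have hul : A + 16 * l < w u + l * q u := by
    have := mul_nonneg hl0.le (hq0 u)
    rw [hl] at this ⊢
    linarith
  have hout : ∀ v, r ≤ ‖v - x₀‖ → w v + l * q v ≤ A + 16 * l := fun v hv =>
    add_le_add ((abs_le.1 (hwA v hv)).2) (hlq v)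
  have hur : ‖u - x₀‖ ≤ r := by
    by_contra h
    push Not at h
    linarith [hout u h.le]
  obtain ⟨x, hx, hmax⟩ := (isCompact_closedBall x₀ r).exists_isMaxOn
    ⟨u, by simpa [dist_eq_norm] using hur⟩ (f := fun v => w v + l * q v) (by fun_prop)
  have hxr : ‖x - x₀‖ ≤ r := by simpa [dist_eq_norm] using hx
  have hgl : ∀ v, w v + l * q v ≤ w x + l * q x := fun v => by
    rcases le_or_gt ‖v - x₀‖ r with h | h
    · exact hmax (show v ∈ _ by simpa [dist_eq_norm] using h)
    · have h1 : w u + l * q u ≤ w x + l * q x :=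
        hmax (show u ∈ _ by simpa [dist_eq_norm] using hur)
      linarith [hout v h.le]
  obtain ⟨ε₀, hε₀, hbar⟩ := hbar r hr hr1
  set e := min (ε₀ / 2) 1
  have he : 0 < e := by positivity
  have h1 := hbar e he ((min_le_left _ _).trans_lt (by linarith)) x x₀ hxr
  have h2 := (abs_le.1 (hL' e he (min_le_right _ _) x)).1
  have h3 := H.Leps_nonpos_of_max he hgl
  rw [H.Leps_add_mul he hw hB hqc hqB] at h3
  have h4 := mul_le_mul_of_nonneg_left h1 hl0.le
  have h5 : l * (c / Phi φ r) = 2 * (A / Phi φ r) := by rw [hl]; field_simp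
  have h6 : 0 < A / Phi φ r := by positivity
  linarith

end HKAssumptions

namespace GoodHeatKernel

variable {p : ℝ → EuclideanSpace ℝ (Fin d) → EuclideanSpace ℝ (Fin d) → ℝ}

lemma bounded (H : HKAssumptions d φ J a₁ α₁ C₀ a b β κ κ₀ κ₁ κ₂ δ)
    (G : GoodHeatKernel d φ J b β Φinv κ p) {t : ℝ} (ht : 0 < t)
    (y : EuclideanSpace ℝ (Fin d)) : ∃ B, ∀ x, |p t x y| ≤ B := by
  obtain ⟨c, hc, hle⟩ := G.abs_le_profile H (le_max_left 1 t)
  obtain ⟨B, hB⟩ := (isCompact_closedBall y 1).exists_bound_of_continuousOn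
    (G.cont_fst ht y).continuousOn
  refine ⟨max B (c * t * profile d φ 1), fun x => ?_⟩
  rcases le_or_gt ‖x - y‖ 1 with h | h
  · exact (hB x (by simpa [dist_eq_norm] using h)).trans (le_max_left _ _)
  · refine le_trans ((hle t ht (le_max_right _ _) x y ?_).trans ?_) (le_max_right _ _)
    · rintro rfl
      simp at h
      linarith
    · have := H.profile_anti one_pos h.le
      gcongr

/-- Two-sided on-diagonal bound. -/
lemma abs_le_scale (H : HKAssumptions d φ J a₁ α₁ C₀ a b β κ κ₀ κ₁ κ₂ δ)
    (S : PhiInvSpec φ Φinv)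
    (G : GoodHeatKernel d φ J b β Φinv κ p) {T : ℝ} (hT : 1 ≤ T) :
    ∃ c, 0 < c ∧ ∀ t, 0 < t → t ≤ T → ∀ x y, |p t x y| ≤ c * (1 / scale Φinv t ^ d) := by
  obtain ⟨c, hc, hle⟩ := G.abs_le_profile H hT
  obtain ⟨K, hK, hscale⟩ := H.exists_scale S T
  obtain ⟨c', hc', hfrac⟩ := G.frac T hT
  obtain ⟨C, hC, hmain⟩ := H.abs_le_of_Leps
  have hK0 : 0 < K := by linarith
  refine ⟨C * (c * K + c'), by positivity, fun t ht htT x y => ?_⟩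
  set r := scale Φinv t with hr
  have hr0 : 0 < r := HKAssumptions.scale_pos S ht
  have hP := H.Phi_pos hr0
  have h1 := hmain ((c * K + c') * (1 / r ^ d)) r y (fun x => p t x y) (by positivity) hr0
    (min_le_left _ _) (G.cont_fst ht y) (G.bounded H ht y) (fun u hu => ?_)
    (fun ε hε hε1 u hu => ?_) x
  · exact h1.trans_eq (by ring)
  · have hne : u ≠ y := by
      rintro rfl
      simp at hu
      linarith
    refine (hle t ht htT u y hne).trans ?_
    have h2 := H.profile_anti hr0 hu
    have h3 := (hscale t ht htT).2
    have h4 := H.profile_pos (hr0.trans_le hu)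
    calc c * t * profile d φ ‖u - y‖ ≤ c * (K * Phi φ r) * profile d φ r := by gcongr
      _ = c * K * (1 / r ^ d) := by unfold profile; field_simp
      _ ≤ _ := by gcongr; linarith
  · refine (hfrac ε hε hε1 t ht htT u y hu).trans ?_
    have h2 := HKAssumptions.Gtil_le (d := d) S ht (u - y)
    have h3 := H.Phi_scale_le S ht
    calc c' * Gtil d φ Φinv t (u - y) ≤ c' * (1 / (Phi φ r * r ^ d)) := by
          gcongr
          refine h2.trans ?_
          gcongr
      _ = c' * (1 / r ^ d) / Phi φ r := by field_simp
      _ ≤ _ := by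
          gcongr
          linarith [show 0 < c * K by positivity]

end GoodHeatKernel

namespace HKAssumptions

lemma integrableOn_profile (H : HKAssumptions d φ J a₁ α₁ C₀ a b β κ κ₀ κ₁ κ₂ δ) {r R : ℝ}
    (hr : 0 < r) : IntegrableOn (fun z : EuclideanSpace ℝ (Fin d) => profile d φ ‖z‖)
      (annulus d r R) := by
  have hanti : Antitone fun s => profile d φ (max s r) := fun s s' h =>
    H.profile_anti (hr.trans_le (le_max_right _ _)) (max_le_max h le_rfl)
  have hm : Measurable fun z : EuclideanSpace ℝ (Fin d) => profile d φ (max ‖z‖ r) :=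
    hanti.measurable.comp measurable_norm
  have hfin : volume (annulus d r R) < ⊤ :=
    (measure_mono (t := Metric.closedBall 0 R) fun z hz => by simpa using hz.2).trans_lt
      measure_closedBall_lt_top
  refine IntegrableOn.congr_fun (f := fun z => profile d φ (max ‖z‖ r)) ?_ (fun z hz => ?_)
    measurableSet_annulus
  · refine IntegrableOn.of_bound hfin hm.aestronglyMeasurable (profile d φ r)
      (Eventually.of_forall fun z => ?_)
    have := H.profile_pos (hr.trans_le (le_max_right ‖z‖ r))
    rw [Real.norm_eq_abs, abs_of_pos this]
    exact H.profile_anti hr (le_max_right _ _)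
  · simp only [max_eq_left (show r ≤ ‖z‖ from hz.1.le)]

lemma integral_profile_le (H : HKAssumptions d φ J a₁ α₁ C₀ a b β κ κ₀ κ₁ κ₂ δ) :
    ∃ C, 0 < C ∧ ∀ ρ, 0 < ρ → ρ ≤ 1 →
      ∫ z in annulus d ρ 1, profile d φ ‖z‖ ≤ C / Phi φ ρ := by
  have hσ := sphereConst_pos H.hd
  have ha1 := H.a₁_pos
  have hα := H.α₁_pos
  refine ⟨sphereConst d * (1 / (a₁ * (α₁ - 0))), by rw [sub_zero]; positivity, fun ρ hρ hρ1 => ?_⟩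
  have hP := H.Phi_pos hρ
  have h0 := setIntegral_radial H.hd (S := Ioc ρ 1) measurableSet_Ioc
    (fun y hy => hρ.trans hy.1) (fun y => profile d φ y)
  rw [annulus, h0]
  have h1 : ∫ y in Ioc ρ 1, y ^ (d - 1) * profile d φ y =
      ∫ y in Ioc ρ 1, y ^ ((0:ℝ) - 1) / Phi φ y := by
    refine setIntegral_congr_fun measurableSet_Ioc fun y hy => ?_
    have hy0 := hρ.trans hy.1
    have hφ := H.Phi_pos hy0
    obtain ⟨k, rfl⟩ : ∃ k, d = k + 1 := ⟨d - 1, (Nat.sub_add_cancel H.hd).symm⟩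
    simp only [profile]
    rw [Real.rpow_sub hy0, Real.rpow_one, Real.rpow_zero]
    simp only [Nat.add_sub_cancel]
    field_simp
    ring
  have h2 := integral_rpow_div_le (h := Phi φ) (γ := 0) ha1 hα hρ hP fun s h1 h2 =>
    H.Phi_lower hρ h1 h2
  rw [h1]
  rw [Real.rpow_zero] at h2
  calc _ ≤ sphereConst d * (1 / (a₁ * (α₁ - 0)) * (1 / Phi φ ρ)) := by gcongr
    _ = _ := by ring

/-- The jump contribution from a ball, when the jump kernel is bounded there. -/
lemma integral_jump_to_ball_le (H : HKAssumptions d φ J a₁ α₁ C₀ a b β κ κ₀ κ₁ κ₂ δ) {R ρ j : ℝ}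
    (hR : 0 < R) (hj : 0 ≤ j) {f : EuclideanSpace ℝ (Fin d) → ℝ} (hf : Continuous f)
    (x y : EuclideanSpace ℝ (Fin d))
    (hJ : ∀ z, R < ‖z‖ → ‖x + z - y‖ ≤ ρ → J ‖z‖ ≤ j) :
    ∫ z in {z | R < ‖z‖} ∩ {z | ‖x + z - y‖ ≤ ρ}, |f (x + z)| * J ‖z‖ ≤
      j * ∫ w in Metric.closedBall y ρ, |f w| := by
  have hpre : {z | ‖x + z - y‖ ≤ ρ} = (fun z => x + z) ⁻¹' Metric.closedBall y ρ := by
    ext z; simp only [mem_preimage, Metric.mem_closedBall, dist_eq_norm, mem_ofPred_eq]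
  have hmeas : MeasurableSet {z : EuclideanSpace ℝ (Fin d) | ‖x + z - y‖ ≤ ρ} := by
    rw [hpre]
    exact (measurable_const_add x) measurableSet_closedBall
  have htr := (measurePreserving_add_left volume x).setIntegral_preimage_emb
    (measurableEmbedding_addLeft x) (fun w => |f w|) (Metric.closedBall y ρ)
  rw [← hpre] at htr
  have hInt : IntegrableOn (fun z => |f (x + z)|) {z | ‖x + z - y‖ ≤ ρ} := by
    rw [hpre]
    refine ((measurePreserving_add_left volume x).integrableOn_comp_preimage
      (measurableEmbedding_addLeft x) (f := fun w => |f w|)).2 ?_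
    exact hf.abs.continuousOn.integrableOn_compact (isCompact_closedBall _ _)
  rw [← htr, ← integral_const_mul]
  calc ∫ z in {z | R < ‖z‖} ∩ {z | ‖x + z - y‖ ≤ ρ}, |f (x + z)| * J ‖z‖
      ≤ ∫ z in {z | R < ‖z‖} ∩ {z | ‖x + z - y‖ ≤ ρ}, j * |f (x + z)| := by
        refine integral_mono_of_nonneg ?_ ((hInt.mono_set inter_subset_right).const_mul j) ?_
        · filter_upwards [ae_restrict_mem (measurableSet_norm_gt.inter hmeas)] with z hz
          exact mul_nonneg (abs_nonneg _) (H.J_nonneg hR.le hz.1)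
        · filter_upwards [ae_restrict_mem (measurableSet_norm_gt.inter hmeas)] with z hz
          rw [mul_comm]
          exact mul_le_mul_of_nonneg_right (hJ z hz.1 hz.2) (abs_nonneg _)
    _ ≤ ∫ z in {z | ‖x + z - y‖ ≤ ρ}, j * |f (x + z)| := by
        refine setIntegral_mono_set (hInt.const_mul j)
          (Eventually.of_forall fun z => mul_nonneg hj (abs_nonneg _))
          inter_subset_right.eventuallyLE

end HKAssumptions

namespace GoodHeatKernel

variable {p : ℝ → EuclideanSpace ℝ (Fin d) → EuclideanSpace ℝ (Fin d) → ℝ}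

/-- The kernel has uniformly bounded mass near its pole. -/
lemma integral_abs_le (H : HKAssumptions d φ J a₁ α₁ C₀ a b β κ κ₀ κ₁ κ₂ δ)
    (S : PhiInvSpec φ Φinv)
    (G : GoodHeatKernel d φ J b β Φinv κ p) {T : ℝ} (hT : 1 ≤ T) :
    ∃ C, 0 < C ∧ ∀ t, 0 < t → t ≤ T → ∀ y,
      ∫ w in Metric.closedBall y 1, |p t w y| ≤ C := by
  obtain ⟨c, hc, hle⟩ := G.abs_le_profile H hT
  obtain ⟨c', hc', hle'⟩ := G.abs_le_scale H S hT
  obtain ⟨K, hK, hscale⟩ := H.exists_scale S T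
  obtain ⟨C, hC, hprof⟩ := H.integral_profile_le
  set V := volume.real (Metric.ball (0 : EuclideanSpace ℝ (Fin d)) 1) with hV
  have hV0 : 0 ≤ V := measureReal_nonneg
  have hK0 : 0 < K := by linarith
  refine ⟨c' * V + c * K * C, by positivity, fun t ht htT y => ?_⟩
  set r := scale Φinv t with hr
  have hr0 : 0 < r := HKAssumptions.scale_pos S ht
  have hr1 : r ≤ 1 := min_le_left _ _
  have hP := H.Phi_pos hr0
  have hcont : Continuous fun z => |p t (y + z) y| :=
    ((G.cont_fst ht y).comp (continuous_const.add continuous_id)).abs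
  have htr := (measurePreserving_add_left volume y).setIntegral_preimage_emb
    (measurableEmbedding_addLeft y) (fun w => |p t w y|) (Metric.closedBall y 1)
  have hpre : (fun z => y + z) ⁻¹' Metric.closedBall y 1 =
      Metric.closedBall (0 : EuclideanSpace ℝ (Fin d)) r ∪ annulus d r 1 := by
    ext z
    simp only [mem_preimage, Metric.mem_closedBall, dist_eq_norm, add_sub_cancel_left, sub_zero,
      mem_union, annulus, mem_ofPred_eq, mem_Ioc]
    constructor
    · intro h
      rcases le_or_gt ‖z‖ r with h' | h'
      · exact Or.inl h'
      · exact Or.inr ⟨h', h⟩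
    · rintro (h | h)
      · exact h.trans hr1
      · exact h.2
  have hI : ∀ R, IntegrableOn (fun z => |p t (y + z) y|)
      (Metric.closedBall (0 : EuclideanSpace ℝ (Fin d)) R) := fun R =>
    hcont.continuousOn.integrableOn_compact (isCompact_closedBall _ _)
  have hI' : IntegrableOn (fun z => |p t (y + z) y|) (annulus d r 1) :=
    (hI 1).mono_set fun z hz => by simpa using hz.2
  rw [← htr, hpre, setIntegral_union (by
    rw [Set.disjoint_left]
    intro z hz hz'
    simp only [Metric.mem_closedBall, dist_zero_right] at hz
    linarith [hz'.1]) measurableSet_annulus (hI r) hI']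
  refine add_le_add ?_ ?_
  · have h1 := norm_setIntegral_le_of_norm_le_const (f := fun z => |p t (y + z) y|)
      (measure_closedBall_lt_top (μ := volume) (x := (0 : EuclideanSpace ℝ (Fin d))) (r := r))
      (C := c' * (1 / r ^ d)) (fun z _ => by
        rw [Real.norm_eq_abs, abs_abs]
        exact hle' t ht htT _ _)
    rw [Measure.addHaar_real_closedBall _ _ hr0.le, finrank_euclideanSpace_fin] at h1
    refine (Real.le_norm_self _).trans (h1.trans_eq ?_)
    field_simp
    rfl
  · have hi := (H.integrableOn_profile (R := 1) hr0).const_mul (c * t)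
    calc ∫ z in annulus d r 1, |p t (y + z) y|
        ≤ ∫ z in annulus d r 1, c * t * profile d φ ‖z‖ := by
          refine setIntegral_mono_on hI' hi measurableSet_annulus fun z hz => ?_
          have hz0 : z ≠ 0 := by
            rintro rfl
            have := hz.1
            rw [norm_zero] at this
            linarith
          have := hle t ht htT (y + z) y (by simpa using hz0)
          rwa [add_sub_cancel_left] at this
      _ = c * t * ∫ z in annulus d r 1, profile d φ ‖z‖ := integral_const_mul _ _
      _ ≤ c * (K * Phi φ r) * (C / Phi φ r) := by
          have h1 := hprof r hr0 hr1
          have h2 := (hscale t ht htT).2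
          have h3 : 0 ≤ C / Phi φ r := by positivity
          calc _ ≤ c * t * (C / Phi φ r) := mul_le_mul_of_nonneg_left h1 (by positivity)
            _ ≤ _ := by gcongr
      _ = c * K * C := by field_simp

end GoodHeatKernel

/-- The smooth radial weight with stretched-exponential decay. -/
noncomputable def weight (d : ℕ) (q c β : ℝ) (x : EuclideanSpace ℝ (Fin d)) : ℝ :=
  Real.exp (-(q / 2 * Real.log (1 + ‖x‖ ^ 2) + c * (1 + ‖x‖ ^ 2) ^ (β / 2)))

section Weight

variable {q c : ℝ}

lemma weight_pos (x : EuclideanSpace ℝ (Fin d)) : 0 < weight d q c β x := Real.exp_pos _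

lemma continuous_weight : Continuous (weight d q c β) := by
  have h : ∀ x : EuclideanSpace ℝ (Fin d), 1 + ‖x‖ ^ 2 ≠ 0 := fun x => by positivity
  unfold weight
  refine Real.continuous_exp.comp (Continuous.neg (Continuous.add ?_ ?_))
  · exact continuous_const.mul (Continuous.log (by fun_prop) h)
  · exact continuous_const.mul (Continuous.rpow_const (by fun_prop) fun x => Or.inl (h x))

lemma weight_le_one (hq : 0 ≤ q) (hc : 0 ≤ c) (x : EuclideanSpace ℝ (Fin d)) :
    weight d q c β x ≤ 1 := by
  rw [weight, Real.exp_le_one_iff, neg_nonpos]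
  have : 0 ≤ Real.log (1 + ‖x‖ ^ 2) := Real.log_nonneg (by nlinarith [norm_nonneg x])
  positivity

/-- One-sided exponential Taylor bound for the weight. -/
lemma weight_add_le (hq : 0 ≤ q) (hc : 0 ≤ c) (hβ0 : 0 < β) (hβ1 : β ≤ 1)
    (x : EuclideanSpace ℝ (Fin d)) :
    ∃ m : ℝ, ∀ z : EuclideanSpace ℝ (Fin d), ‖z‖ ≤ 1 →
      |m * inner ℝ x z| ≤ 2 * (c + q) * ‖z‖ ∧
      weight d q c β (x + z) ≤
        weight d q c β x * Real.exp (m * inner ℝ x z + 27 * (c + q) * ‖z‖ ^ 2) := by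
  set N := 1 + ‖x‖ ^ 2 with hN
  have hN1 : 1 ≤ N := by nlinarith [norm_nonneg x]
  have hN0 : 0 < N := by linarith
  set n := √N with hn
  have hn1 : 1 ≤ n := Real.one_le_sqrt.2 hN1
  have hnN : n ^ 2 = N := Real.sq_sqrt hN0.le
  have hxn : ‖x‖ ≤ n := Real.le_sqrt_of_sq_le (by linarith)
  have hpow : N ^ (β / 2) ≤ n := by
    rw [hn, Real.sqrt_eq_rpow]
    exact Real.rpow_le_rpow_of_exponent_le hN1 (by linarith)
  have hpow0 : 0 < N ^ (β / 2) := by positivity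
  set k := c * (β / 2 * N ^ (β / 2)) + q / 2 with hk
  have hk0 : 0 ≤ k := by positivity
  have hkn : k ≤ (c + q) * n := by
    have h1 : β / 2 * N ^ (β / 2) ≤ n := by nlinarith
    have h2 := mul_le_mul_of_nonneg_left h1 hc
    have h3 : q / 2 ≤ q * n := by nlinarith
    linarith
  refine ⟨-(2 * k / N), fun z hz => ⟨?_, ?_⟩⟩
  · have h1 := abs_real_inner_le_norm x z
    rw [abs_mul, abs_neg, abs_of_nonneg (by positivity)]
    calc 2 * k / N * |inner ℝ x z| ≤ 2 * ((c + q) * n) / N * (n * ‖z‖) := by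
          gcongr
          exact h1.trans (by gcongr)
      _ = 2 * (c + q) * ‖z‖ * (n ^ 2 / N) := by ring
      _ = 2 * (c + q) * ‖z‖ := by rw [hnN, div_self hN0.ne', mul_one]
  · set N' := 1 + ‖x + z‖ ^ 2 with hN'
    have hN'0 : 0 < N' := by positivity
    set D := 2 * inner ℝ x z + ‖z‖ ^ 2 with hD
    have hND : N' = N + D := by rw [hN', norm_add_sq_real]; ring
    have hNN : N ≤ 3 * N' := by
      have h1 : ‖x‖ ≤ ‖x + z‖ + ‖z‖ := by
        simpa using norm_sub_le (x + z) z
      have h2 : ‖x‖ ^ 2 ≤ (‖x + z‖ + 1) ^ 2 := by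
        gcongr
        linarith
      nlinarith [sq_nonneg (‖x + z‖ - 1)]
    have hD2 : D ^ 2 ≤ 9 * N * ‖z‖ ^ 2 := by
      have h1 := abs_real_inner_le_norm x z
      have h2 : |D| ≤ 3 * n * ‖z‖ := by
        rw [hD]
        refine (abs_add_le _ _).trans ?_
        rw [abs_mul, abs_two, abs_of_nonneg (sq_nonneg ‖z‖)]
        have h3 : ‖x‖ * ‖z‖ ≤ n * ‖z‖ := by gcongr
        have h4 : ‖z‖ ^ 2 ≤ n * ‖z‖ := by
          rw [sq]
          gcongr
          linarith
        linarith
      calc D ^ 2 = |D| ^ 2 := (sq_abs _).symm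
        _ ≤ (3 * n * ‖z‖) ^ 2 := by gcongr
        _ = 9 * n ^ 2 * ‖z‖ ^ 2 := by ring
        _ = _ := by rw [hnN]
    -- lower bound of the exponent increment by the logarithm
    set ℓ := Real.log (N' / N) with hℓ
    have hlog : Real.log N' = Real.log N + ℓ := by
      rw [hℓ, Real.log_div hN'0.ne' hN0.ne']; ring
    have hrp : N ^ (β / 2) * (1 + β / 2 * ℓ) ≤ N' ^ (β / 2) := by
      have h1 : N' ^ (β / 2) = N ^ (β / 2) * Real.exp (ℓ * (β / 2)) := by
        rw [Real.rpow_def_of_pos hN'0, Real.rpow_def_of_pos hN0, ← Real.exp_add, hlog]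
        ring_nf
      rw [h1]
      gcongr
      linarith [Real.add_one_le_exp (ℓ * (β / 2))]
    have hℓ1 : D / N - D ^ 2 / (N * N') ≤ ℓ := by
      have h1 := Real.one_sub_inv_le_log_of_pos (div_pos hN'0 hN0)
      refine le_trans (le_of_eq ?_) h1
      have : D = N' - N := by linarith
      rw [this]
      field_simp
      ring
    have hkD : k * (D ^ 2 / (N * N')) ≤ 27 * (c + q) * ‖z‖ ^ 2 := by
      have h1 : n ≤ N := by nlinarith
      calc k * (D ^ 2 / (N * N')) ≤ ((c + q) * (3 * N')) * (9 * N * ‖z‖ ^ 2 / (N * N')) := by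
            gcongr
            refine hkn.trans ?_
            gcongr
            linarith
        _ = _ := by field_simp; ring
    rw [weight, weight, ← Real.exp_add, Real.exp_le_exp]
    rw [← hN, ← hN', hlog]
    have h1 := mul_le_mul_of_nonneg_left hrp hc
    have h2 := mul_le_mul_of_nonneg_left hℓ1 hk0
    have h3 : k * (D / N) = 2 * k / N * inner ℝ x z + k * ‖z‖ ^ 2 / N := by
      rw [hD]; ring
    have h4 : 0 ≤ k * ‖z‖ ^ 2 / N := by positivity
    have h5 : k * ℓ = c * (β / 2 * N ^ (β / 2)) * ℓ + q / 2 * ℓ := by rw [hk]; ring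
    linarith

lemma weight_harnack (hq : 0 ≤ q) (hc : 0 ≤ c) (hβ0 : 0 < β) (hβ1 : β ≤ 1)
    (x z : EuclideanSpace ℝ (Fin d)) (hz : ‖z‖ ≤ 1) :
    weight d q c β (x + z) ≤ Real.exp (29 * (c + q)) * weight d q c β x := by
  obtain ⟨m, hm⟩ := weight_add_le (d := d) hq hc hβ0 hβ1 x
  obtain ⟨h1, h2⟩ := hm z hz
  refine h2.trans ?_
  rw [mul_comm]
  have h3 := weight_pos (q := q) (c := c) (β := β) x
  gcongr
  have h4 := le_abs_self (m * inner ℝ x z)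
  have h5 : (c + q) * ‖z‖ ≤ c + q := mul_le_of_le_one_right (by positivity) hz
  have h6 : (c + q) * ‖z‖ ^ 2 ≤ c + q :=
    mul_le_of_le_one_right (by positivity) (pow_le_one₀ (norm_nonneg z) hz)
  linarith

lemma weight_second_diff (hq : 0 ≤ q) (hc : 0 ≤ c) (hβ0 : 0 < β) (hβ1 : β ≤ 1) :
    ∃ C, 0 < C ∧ ∀ x z : EuclideanSpace ℝ (Fin d), ‖z‖ ≤ 1 →
      weight d q c β (x + z) + weight d q c β (x - z) - 2 * weight d q c β x ≤
        2 * (C * ‖z‖ ^ 2 * weight d q c β x) := by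
  set B := 2 * (c + q) ^ 2 + 27 * (c + q) + 1 with hB
  have hB0 : 0 < B := by positivity
  refine ⟨B * Real.exp B, by positivity, fun x z hz => ?_⟩
  obtain ⟨m, hm⟩ := weight_add_le (d := d) hq hc hβ0 hβ1 x
  obtain ⟨h1, h2⟩ := hm z hz
  obtain ⟨-, h3⟩ := hm (-z) (by rwa [norm_neg])
  rw [norm_neg, inner_neg_right, ← sub_eq_add_neg] at h3
  have hw := weight_pos (q := q) (c := c) (β := β) x
  set s := m * inner ℝ x z with hs
  set e := 27 * (c + q) * ‖z‖ ^ 2 with he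
  have h4 : Real.exp (s + e) + Real.exp (m * -inner ℝ x z + e) ≤ 2 * Real.exp (B * ‖z‖ ^ 2) := by
    have h5 : m * -inner ℝ x z = -s := by rw [hs]; ring
    rw [h5, Real.exp_add, Real.exp_add, ← add_mul]
    have h6 : Real.exp s + Real.exp (-s) = 2 * Real.cosh s := by rw [Real.cosh_eq]; ring
    rw [h6]
    calc 2 * Real.cosh s * Real.exp e ≤ 2 * Real.exp (s ^ 2 / 2) * Real.exp e := by
          gcongr; exact Real.cosh_le_exp_half_sq s
      _ = 2 * Real.exp (s ^ 2 / 2 + e) := by rw [mul_assoc, Real.exp_add]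
      _ ≤ 2 * Real.exp (B * ‖z‖ ^ 2) := by
          gcongr
          have h7 : s ^ 2 ≤ (2 * (c + q) * ‖z‖) ^ 2 := by
            rw [← sq_abs]; gcongr
          rw [hB, he]
          nlinarith [sq_nonneg ‖z‖]
  have h8 : Real.exp (B * ‖z‖ ^ 2) - 1 ≤ B * Real.exp B * ‖z‖ ^ 2 := by
    set u := B * ‖z‖ ^ 2 with hu
    have hu0 : 0 ≤ u := by positivity
    have huB : u ≤ B := mul_le_of_le_one_right hB0.le (pow_le_one₀ (norm_nonneg z) hz)
    have h9 := Real.add_one_le_exp (-u)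
    have h10 : Real.exp u * (1 - u) ≤ 1 := by
      calc Real.exp u * (1 - u) ≤ Real.exp u * Real.exp (-u) := by gcongr; linarith
        _ = 1 := by rw [← Real.exp_add]; simp
    have h11 : u * Real.exp u ≤ u * Real.exp B := by gcongr
    calc Real.exp u - 1 ≤ u * Real.exp u := by linarith
      _ ≤ u * Real.exp B := h11
      _ = _ := by rw [hu]; ring
  have h12 := mul_le_mul_of_nonneg_left h4 hw.le
  have h13 := mul_le_mul_of_nonneg_left h8 hw.le
  linarith

end Weight

/-- A positive continuous function comparable with the tail of `theta` that is stable under the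
jumps of `J`. -/
structure DecayWeight (d : ℕ) (φ J : ℝ → ℝ) (b β : ℝ) (g : EuclideanSpace ℝ (Fin d) → ℝ)
    (C : ℝ) : Prop where
  one_le : 1 ≤ C
  cont : Continuous g
  pos : ∀ x, 0 < g x
  le_one : ∀ x, g x ≤ 1
  theta_le : ∀ x, 1 ≤ ‖x‖ → theta d φ b β ‖x‖ ≤ C * g x
  le_theta : ∀ x, 1 ≤ ‖x‖ → g x ≤ C * theta d φ b β ‖x‖
  harnack : ∀ x z, ‖z‖ ≤ 1 → g (x + z) ≤ C * g x
  second_diff : ∀ x z, ‖z‖ ≤ 1 → g (x + z) + g (x - z) - 2 * g x ≤ 2 * (C * ‖z‖ ^ 2 * g x)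
  tail : ∀ x, ∫ z in {z : EuclideanSpace ℝ (Fin d) | 1 < ‖z‖}, g (x + z) * J ‖z‖ ≤ C * g x
  jump : ∀ x s, 1 ≤ s → ‖x‖ - 1 ≤ s → J s ≤ C * g x

lemma add_rpow_add_mul_rpow_le {A B : ℝ} (hβ0 : 0 < β) (hβ1 : β ≤ 1) (hB : 0 ≤ B) (hAB : B ≤ A) :
    (A + B) ^ β + (2 - 2 ^ β) * B ^ β ≤ A ^ β + B ^ β := by
  rcases hB.eq_or_lt with rfl | hB
  · simp [Real.zero_rpow hβ0.ne']
  have hA : 0 < A := hB.trans_le hAB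
  have hc := Real.concaveOn_rpow hβ0.le hβ1
  set l := B / A with hl
  have hl0 : 0 ≤ l := by positivity
  have hl1 : l ≤ 1 := (div_le_one hA).2 hAB
  have hlA : l * A = B := by rw [hl]; field_simp
  have h1 := hc.2 (x := B) (y := A + B) hB.le (by positivity : (0:ℝ) ≤ A + B) hl0
    (sub_nonneg.2 hl1) (by ring)
  have h2 := hc.2 (x := B) (y := A + B) hB.le (by positivity : (0:ℝ) ≤ A + B)
    (sub_nonneg.2 hl1) hl0 (by ring)
  simp only [smul_eq_mul] at h1 h2
  have h3 : l * B + (1 - l) * (A + B) = A := by linear_combination -hlA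
  have h4 : (1 - l) * B + l * (A + B) = 2 * B := by linear_combination hlA
  rw [h3] at h1
  rw [h4, Real.mul_rpow (by norm_num) hB.le] at h2
  linarith

lemma one_add_sq_rpow_le (hβ0 : 0 < β) (hβ1 : β ≤ 1) {r : ℝ} (hr : 0 ≤ r) :
    (1 + r ^ 2) ^ (β / 2) ≤ r ^ β + 1 := by
  have h := Real.rpow_add_le_add_rpow zero_le_one (sq_nonneg r) (by positivity : 0 ≤ β / 2)
    (by linarith)
  rw [Real.one_rpow, ← Real.rpow_natCast_mul hr] at h
  norm_num at h
  rw [show (2:ℝ) * (β / 2) = β by ring] at h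
  linarith

lemma le_one_add_sq_rpow (hβ0 : 0 < β) {r : ℝ} (hr : 0 ≤ r) :
    r ^ β ≤ (1 + r ^ 2) ^ (β / 2) := by
  calc r ^ β = (r ^ 2) ^ (β / 2) := by
        rw [← Real.rpow_natCast_mul hr]
        congr 1
        push_cast
        ring
    _ ≤ (1 + r ^ 2) ^ (β / 2) := by gcongr; linarith

lemma rpow_le_rpow_sub_one_add (hβ0 : 0 < β) (hβ1 : β ≤ 1) {r s : ℝ} (hr : 0 ≤ r) (hs : 0 ≤ s)
    (h : r - 1 ≤ s) : r ^ β ≤ s ^ β + 1 := by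
  calc r ^ β ≤ (s + 1) ^ β := by gcongr; linarith
    _ ≤ s ^ β + 1 ^ β := Real.rpow_add_le_add_rpow hs zero_le_one hβ0.le hβ1
    _ = _ := by rw [Real.one_rpow]

lemma weight_zero_le {c : ℝ} (hc : 0 ≤ c) (hβ0 : 0 < β) (x : EuclideanSpace ℝ (Fin d)) :
    weight d 0 c β x ≤ Real.exp (-c * ‖x‖ ^ β) := by
  rw [weight, Real.exp_le_exp]
  have := mul_le_mul_of_nonneg_left (le_one_add_sq_rpow hβ0 (norm_nonneg x)) hc
  linarith

lemma le_weight_zero {c : ℝ} (hc : 0 ≤ c) (hβ0 : 0 < β) (hβ1 : β ≤ 1)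
    (x : EuclideanSpace ℝ (Fin d)) :
    Real.exp (-c * ‖x‖ ^ β) ≤ Real.exp c * weight d 0 c β x := by
  rw [weight, ← Real.exp_add, Real.exp_le_exp]
  have := mul_le_mul_of_nonneg_left (one_add_sq_rpow_le hβ0 hβ1 (norm_nonneg x)) hc
  linarith

namespace HKAssumptions

lemma weight_zero_tail (H : HKAssumptions d φ J a₁ α₁ C₀ a b β κ κ₀ κ₁ κ₂ δ) (hβ : β < 1) :
    ∃ C, 0 < C ∧ ∀ x, ∫ z in {z : EuclideanSpace ℝ (Fin d) | 1 < ‖z‖},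
      weight d 0 b β (x + z) * J ‖z‖ ≤ C * weight d 0 b β x := by
  have hb := H.hb
  have hβ0 := H.β_pos
  obtain ⟨C, hC, hJ⟩ := H.J_le_exp zero_lt_one
  set c₀ := b * (2 - 2 ^ β) with hc₀
  have h2 : (2:ℝ) ^ β < 2 := by
    calc (2:ℝ) ^ β < 2 ^ (1:ℝ) := Real.rpow_lt_rpow_of_exponent_lt (by norm_num) hβ
      _ = 2 := Real.rpow_one 2
  have hc₀0 : 0 < c₀ := mul_pos hb (by linarith)
  have hi := integrable_exp_neg_norm_rpow H.hd hc₀0 hβ0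
  set E : EuclideanSpace ℝ (Fin d) → ℝ := fun z => Real.exp (-c₀ * ‖z‖ ^ β) with hE
  have hi' : Integrable E := by simpa only [neg_mul, hE] using hi
  have hE0 : 0 ≤ ∫ z, E z := integral_nonneg fun z => (Real.exp_pos _).le
  refine ⟨C * Real.exp b * (2 * (∫ z, E z) + 1), by positivity, fun x => ?_⟩
  set gx := weight d 0 b β x with hgx
  have hg0 : 0 < gx := weight_pos x
  have hix : Integrable fun z => E (x + z) := hi'.comp_add_left x
  have hpt : ∀ z ∈ {z : EuclideanSpace ℝ (Fin d) | 1 < ‖z‖},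
      weight d 0 b β (x + z) * J ‖z‖ ≤ C * Real.exp b * gx * (E (x + z) + E z) := by
    intro z hz
    have key : Real.exp (-b * ‖x + z‖ ^ β) * Real.exp (-b * ‖z‖ ^ β) ≤
        Real.exp (-b * ‖x‖ ^ β) * (E (x + z) + E z) := by
      have hx : ‖x‖ ≤ ‖x + z‖ + ‖z‖ := by simpa using norm_sub_le (x + z) z
      have hxp : ‖x‖ ^ β ≤ (‖x + z‖ + ‖z‖) ^ β := by gcongr
      have hxb := mul_le_mul_of_nonneg_left hxp hb.le
      rw [← Real.exp_add, mul_add, hE]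
      simp only
      rw [← Real.exp_add, ← Real.exp_add]
      rcases le_total ‖z‖ ‖x + z‖ with h | h
      · have h3 := mul_le_mul_of_nonneg_left
          (add_rpow_add_mul_rpow_le hβ0 H.β_le (norm_nonneg z) h) hb.le
        refine le_add_of_nonneg_of_le (Real.exp_pos _).le (Real.exp_le_exp.2 ?_)
        rw [hc₀]
        linarith
      · have h3 := mul_le_mul_of_nonneg_left
          (add_rpow_add_mul_rpow_le hβ0 H.β_le (norm_nonneg (x + z)) h) hb.le
        rw [add_comm ‖z‖] at h3
        refine le_add_of_le_of_nonneg (Real.exp_le_exp.2 ?_) (Real.exp_pos _).le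
        rw [hc₀]
        linarith
    have hz1 : (1:ℝ) ≤ ‖z‖ := le_of_lt hz
    have hEE : 0 ≤ E (x + z) + E z := add_nonneg (Real.exp_pos _).le (Real.exp_pos _).le
    calc weight d 0 b β (x + z) * J ‖z‖
        ≤ Real.exp (-b * ‖x + z‖ ^ β) * (C * Real.exp (-b * ‖z‖ ^ β)) := by
          refine mul_le_mul (weight_zero_le hb.le hβ0 _) (hJ _ hz1) ?_ (Real.exp_pos _).le
          exact (H.J_pos _ (by linarith)).le
      _ = C * (Real.exp (-b * ‖x + z‖ ^ β) * Real.exp (-b * ‖z‖ ^ β)) := by ring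
      _ ≤ C * (Real.exp (-b * ‖x‖ ^ β) * (E (x + z) + E z)) := by gcongr
      _ ≤ C * ((Real.exp b * gx) * (E (x + z) + E z)) := by
          gcongr
          exact le_weight_zero hb.le hβ0 H.β_le x
      _ = _ := by ring
  have hsum : Integrable fun z => E (x + z) + E z := hix.add hi'
  calc ∫ z in {z : EuclideanSpace ℝ (Fin d) | 1 < ‖z‖}, weight d 0 b β (x + z) * J ‖z‖
      ≤ ∫ z in {z : EuclideanSpace ℝ (Fin d) | 1 < ‖z‖},
          C * Real.exp b * gx * (E (x + z) + E z) := by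
        refine integral_mono_of_nonneg ?_ (hsum.const_mul _).integrableOn ?_
        · filter_upwards [ae_restrict_mem measurableSet_norm_gt] with z hz
          exact mul_nonneg (weight_pos _).le (H.J_nonneg zero_le_one hz)
        · filter_upwards [ae_restrict_mem measurableSet_norm_gt] with z hz
          exact hpt z hz
    _ ≤ ∫ z, C * Real.exp b * gx * (E (x + z) + E z) := by
        refine setIntegral_le_integral (hsum.const_mul _) (Eventually.of_forall fun z => ?_)
        have : 0 ≤ E (x + z) + E z := add_nonneg (Real.exp_pos _).le (Real.exp_pos _).le
        exact mul_nonneg (by positivity) this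
    _ = C * Real.exp b * gx * (2 * ∫ z, E z) := by
        rw [integral_const_mul, integral_add hix hi', integral_add_left_eq_self E x]
        ring
    _ ≤ C * Real.exp b * gx * (2 * (∫ z, E z) + 1) := by gcongr; linarith
    _ = _ := by ring

end HKAssumptions

lemma weight_one_eq {q c : ℝ} (x : EuclideanSpace ℝ (Fin d)) :
    weight d q c 1 x = Real.exp (-(q * Real.log √(1 + ‖x‖ ^ 2) + c * √(1 + ‖x‖ ^ 2))) := by
  rw [weight, Real.log_sqrt (by positivity), Real.sqrt_eq_rpow]
  ring_nf

lemma sqrt_one_add_norm_sq_le_add (x z : EuclideanSpace ℝ (Fin d)) :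
    √(1 + ‖x‖ ^ 2) ≤ √(1 + ‖x + z‖ ^ 2) + ‖z‖ := by
  have hx : ‖x‖ ≤ ‖x + z‖ + ‖z‖ := by simpa using norm_sub_le (x + z) z
  set n := √(1 + ‖x + z‖ ^ 2) with hn
  have hn2 : n ^ 2 = 1 + ‖x + z‖ ^ 2 := Real.sq_sqrt (by positivity)
  have hn0 : 0 ≤ n := Real.sqrt_nonneg _
  have hxn : ‖x + z‖ ≤ n := Real.le_sqrt_of_sq_le (by linarith)
  refine Real.sqrt_le_iff.2 ⟨by positivity, ?_⟩
  have h1 : ‖x‖ ^ 2 ≤ (‖x + z‖ + ‖z‖) ^ 2 := by gcongr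
  have h2 : ‖x + z‖ * ‖z‖ ≤ n * ‖z‖ := by gcongr
  linarith

lemma weight_one_translate {q c : ℝ} (hq : 0 < q) (hc : 0 < c) :
    ∃ C, 0 < C ∧ ∀ x z : EuclideanSpace ℝ (Fin d),
      weight d q c 1 (x + z) ≤ C * Real.exp (2 * c * ‖z‖) * weight d q c 1 x := by
  set m := c / q with hm
  have hm0 : 0 < m := div_pos hc hq
  refine ⟨Real.exp (q * (m - 1 - Real.log m)), Real.exp_pos _, fun x z => ?_⟩
  rw [weight_one_eq, weight_one_eq, ← Real.exp_add, ← Real.exp_add, Real.exp_le_exp]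
  have h1 := sqrt_one_add_norm_sq_le_add x z
  set n := √(1 + ‖x‖ ^ 2) with hn
  set n' := √(1 + ‖x + z‖ ^ 2) with hn'
  have hn0 : 0 < n := Real.sqrt_pos.2 (by positivity)
  have hn1 : 1 ≤ n' := Real.one_le_sqrt.2 (by nlinarith [norm_nonneg (x + z)])
  have hz := norm_nonneg z
  have h2 : n ≤ n' * (1 + ‖z‖) := by nlinarith
  have h3 : Real.log n ≤ Real.log n' + Real.log (1 + ‖z‖) := by
    rw [← Real.log_mul (by linarith) (by linarith)]
    exact Real.log_le_log hn0 h2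
  have h4 : Real.log (1 + ‖z‖) ≤ m * (1 + ‖z‖) - 1 - Real.log m := by
    have h5 := Real.log_le_sub_one_of_pos (show 0 < m * (1 + ‖z‖) by positivity)
    rw [Real.log_mul hm0.ne' (by linarith)] at h5
    linarith
  have h6 := mul_le_mul_of_nonneg_left (h3.trans (add_le_add_right h4 _)) hq.le
  have h7 := mul_le_mul_of_nonneg_left h1 hc.le
  have h8 : q * (m * ‖z‖) = c * ‖z‖ := by rw [hm]; field_simp
  linarith

lemma weight_one_le {q c : ℝ} (hq : 0 ≤ q) (hc : 0 ≤ c) {x : EuclideanSpace ℝ (Fin d)}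
    (hx : 0 < ‖x‖) : weight d q c 1 x ≤ ‖x‖ ^ (-q) * Real.exp (-c * ‖x‖) := by
  have h1 : ‖x‖ ≤ √(1 + ‖x‖ ^ 2) := Real.le_sqrt_of_sq_le (by linarith)
  have h2 := mul_le_mul_of_nonneg_left (Real.log_le_log hx h1) hq
  have h3 := mul_le_mul_of_nonneg_left h1 hc
  rw [weight_one_eq, Real.rpow_def_of_pos hx, ← Real.exp_add, Real.exp_le_exp]
  linarith

lemma le_weight_one {q c : ℝ} (hq : 0 ≤ q) (hc : 0 ≤ c) {x : EuclideanSpace ℝ (Fin d)}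
    (hx : 1 ≤ ‖x‖) :
    ‖x‖ ^ (-q) * Real.exp (-c * ‖x‖) ≤ Real.exp (q * Real.log 2 + c) * weight d q c 1 x := by
  have hx0 : 0 < ‖x‖ := by linarith
  have h1 : √(1 + ‖x‖ ^ 2) ≤ ‖x‖ + 1 := Real.sqrt_le_iff.2 ⟨by positivity, by nlinarith⟩
  have h4 : Real.log √(1 + ‖x‖ ^ 2) ≤ Real.log 2 + Real.log ‖x‖ := by
    rw [← Real.log_mul (by norm_num) hx0.ne']
    exact Real.log_le_log (Real.sqrt_pos.2 (by positivity)) (by linarith)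
  have h2 := mul_le_mul_of_nonneg_left h4 hq
  have h3 := mul_le_mul_of_nonneg_left h1 hc
  rw [weight_one_eq, Real.rpow_def_of_pos hx0, ← Real.exp_add, ← Real.exp_add, Real.exp_le_exp]
  linarith

/-- Assemble a `DecayWeight` from the estimates that depend on the value of `β`. -/
lemma weight_decayWeight (H : HKAssumptions d φ J a₁ α₁ C₀ a b β κ κ₀ κ₁ κ₂ δ) {q c D : ℝ}
    (hq : 0 ≤ q) (hc : 0 ≤ c)
    (h_le : ∀ x : EuclideanSpace ℝ (Fin d), 1 < ‖x‖ → theta d φ b β ‖x‖ ≤ D * weight d q c β x)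
    (h_ge : ∀ x : EuclideanSpace ℝ (Fin d), 1 < ‖x‖ → weight d q c β x ≤ theta d φ b β ‖x‖)
    (h_tail : ∀ x, ∫ z in {z : EuclideanSpace ℝ (Fin d) | 1 < ‖z‖},
      weight d q c β (x + z) * J ‖z‖ ≤ D * weight d q c β x)
    (h_jump : ∀ (x : EuclideanSpace ℝ (Fin d)) s, 1 ≤ s → ‖x‖ - 1 ≤ s →
      J s ≤ D * weight d q c β x) :
    ∃ C, DecayWeight d φ J b β (weight d q c β) C := by
  have hβ0 := H.β_pos
  have hβ1 := H.β_le
  obtain ⟨C₂, hC₂, hsd⟩ := weight_second_diff (d := d) hq hc hβ0 hβ1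
  have hP := H.Phi_pos one_pos
  set E := Real.exp (29 * (c + q)) with hE
  have hE0 : 0 < E := Real.exp_pos _
  set m := Real.exp (-(q / 2 * Real.log 2 + c * 2 ^ (β / 2))) with hm
  have hm0 : 0 < m := Real.exp_pos _
  have hθ : theta d φ b β 1 = 1 / Phi φ 1 := by simp [theta]
  have hw1 : ∀ x : EuclideanSpace ℝ (Fin d), ‖x‖ = 1 → weight d q c β x = m := by
    intro x hx
    rw [weight, hx, hm]
    norm_num
  set M := 1 + |D| + C₂ + E + 1 / (Phi φ 1 * m) + Phi φ 1 with hM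
  have hm1 : 0 < 1 / (Phi φ 1 * m) := by positivity
  have hD := abs_nonneg D
  have hDM : D ≤ M := by linarith [le_abs_self D]
  have hw := fun x => weight_pos (d := d) (q := q) (c := c) (β := β) x
  refine ⟨M, by linarith, continuous_weight, hw, weight_le_one hq hc, ?_, ?_, ?_, ?_, ?_, ?_⟩
  · intro x hx
    rcases hx.eq_or_lt with h | h
    · rw [← h, hw1 x h.symm, hθ]
      calc 1 / Phi φ 1 = 1 / (Phi φ 1 * m) * m := by field_simp
        _ ≤ M * m := by gcongr; linarith
    · exact (h_le x h).trans (by have := hw x; gcongr)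
  · intro x hx
    rcases hx.eq_or_lt with h | h
    · rw [← h, hθ]
      calc weight d q c β x ≤ 1 := weight_le_one hq hc x
        _ = Phi φ 1 * (1 / Phi φ 1) := by field_simp
        _ ≤ M * (1 / Phi φ 1) := by gcongr; linarith
    · have h1 := h_ge x h
      refine h1.trans (le_mul_of_one_le_left ((hw x).le.trans h1) (by linarith))
  · intro x z hz
    refine (weight_harnack hq hc hβ0 hβ1 x z hz).trans ?_
    have := hw x
    gcongr
    linarith
  · intro x z hz
    refine (hsd x z hz).trans ?_
    have := hw x
    gcongr
    linarith
  · intro x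
    exact (h_tail x).trans (by have := hw x; gcongr)
  · intro x s h1 h2
    exact (h_jump x s h1 h2).trans (by have := hw x; gcongr)

namespace HKAssumptions

lemma weight_one_tail (H : HKAssumptions d φ J a₁ α₁ C₀ a b 1 κ κ₀ κ₁ κ₂ δ) {q : ℝ} (hq : 0 < q) :
    ∃ C, 0 < C ∧ ∀ x, ∫ z in {z : EuclideanSpace ℝ (Fin d) | 1 < ‖z‖},
      weight d q (b / 5) 1 (x + z) * J ‖z‖ ≤ C * weight d q (b / 5) 1 x := by
  have hb := H.hb
  obtain ⟨C, hC, hJ⟩ := H.J_le_exp zero_lt_one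
  obtain ⟨D, hD, hw⟩ := weight_one_translate (d := d) hq (show 0 < b / 5 by positivity)
  have hi := integrable_exp_neg_norm_rpow H.hd (show 0 < 3 * b / 5 by positivity) one_pos
  simp only [Real.rpow_one] at hi hJ
  set E : EuclideanSpace ℝ (Fin d) → ℝ := fun z => Real.exp (-(3 * b / 5) * ‖z‖) with hE
  have hi' : Integrable E := by simpa only [neg_mul, hE] using hi
  have hE0 : 0 ≤ ∫ z, E z := integral_nonneg fun z => (Real.exp_pos _).le
  refine ⟨C * D * ((∫ z, E z) + 1), by positivity, fun x => ?_⟩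
  set gx := weight d q (b / 5) 1 x with hgx
  have hg0 : 0 < gx := weight_pos x
  calc ∫ z in {z : EuclideanSpace ℝ (Fin d) | 1 < ‖z‖}, weight d q (b / 5) 1 (x + z) * J ‖z‖
      ≤ ∫ z in {z : EuclideanSpace ℝ (Fin d) | 1 < ‖z‖}, C * D * gx * E z := by
        refine integral_mono_of_nonneg ?_ (hi'.const_mul _).integrableOn ?_
        · filter_upwards [ae_restrict_mem measurableSet_norm_gt] with z hz
          exact mul_nonneg (weight_pos _).le (H.J_nonneg zero_le_one hz)
        · filter_upwards [ae_restrict_mem measurableSet_norm_gt] with z hz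
          have hz1 : (1:ℝ) ≤ ‖z‖ := le_of_lt hz
          calc weight d q (b / 5) 1 (x + z) * J ‖z‖
              ≤ (D * Real.exp (2 * (b / 5) * ‖z‖) * gx) * (C * Real.exp (-b * ‖z‖)) :=
                mul_le_mul (hw x z) (hJ _ hz1) (H.J_nonneg zero_le_one hz) (by positivity)
            _ = C * D * gx * (Real.exp (2 * (b / 5) * ‖z‖) * Real.exp (-b * ‖z‖)) := by ring
            _ = C * D * gx * E z := by
                rw [← Real.exp_add, hE]
                ring_nf
    _ ≤ ∫ z, C * D * gx * E z := by
        refine setIntegral_le_integral (hi'.const_mul _) (Eventually.of_forall fun z => ?_)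
        exact mul_nonneg (by positivity) (Real.exp_pos _).le
    _ = C * D * gx * ∫ z, E z := by rw [integral_const_mul]
    _ ≤ C * D * gx * ((∫ z, E z) + 1) := by gcongr; linarith
    _ = _ := by ring

lemma exists_decayWeight_of_lt (H : HKAssumptions d φ J a₁ α₁ C₀ a b β κ κ₀ κ₁ κ₂ δ)
    (hβ : β < 1) : ∃ g C, DecayWeight d φ J b β g C := by
  have hb := H.hb
  have hβ0 := H.β_pos
  obtain ⟨C, hC, hJ⟩ := H.J_le_exp zero_lt_one
  obtain ⟨D, hD, hD'⟩ := H.weight_zero_tail hβ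
  have he := Real.exp_pos b
  have hw := fun x => weight_pos (d := d) (q := 0) (c := b) (β := β) x
  refine ⟨weight d 0 b β, weight_decayWeight H (D := Real.exp b + D + C * Real.exp b * Real.exp b)
    le_rfl hb.le ?_ ?_ ?_ ?_⟩
  · intro x hx
    rw [theta, if_neg hx.not_ge, if_pos hβ]
    refine (le_weight_zero hb.le hβ0 H.β_le x).trans ?_
    have := hw x
    gcongr
    have : 0 < C * Real.exp b * Real.exp b := by positivity
    linarith
  · intro x hx
    rw [theta, if_neg hx.not_ge, if_pos hβ]
    exact weight_zero_le hb.le hβ0 x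
  · intro x
    refine (hD' x).trans ?_
    have := hw x
    gcongr
    have : 0 < C * Real.exp b * Real.exp b := by positivity
    linarith
  · intro x s hs hxs
    have h1 := rpow_le_rpow_sub_one_add hβ0 H.β_le (norm_nonneg x) (by linarith) hxs
    have h2 := mul_le_mul_of_nonneg_left h1 hb.le
    calc J s ≤ C * Real.exp (-b * s ^ β) := hJ s hs
      _ ≤ C * (Real.exp b * Real.exp (-b * ‖x‖ ^ β)) := by
          gcongr
          rw [← Real.exp_add]
          exact Real.exp_le_exp.2 (by linarith)
      _ ≤ C * (Real.exp b * (Real.exp b * weight d 0 b β x)) := by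
          gcongr
          exact le_weight_zero hb.le hβ0 H.β_le x
      _ = C * Real.exp b * Real.exp b * weight d 0 b β x := by ring
      _ ≤ _ := by
          have := hw x
          gcongr
          linarith

lemma exists_decayWeight_of_eq (H : HKAssumptions d φ J a₁ α₁ C₀ a b 1 κ κ₀ κ₁ κ₂ δ) :
    ∃ g C, DecayWeight d φ J b 1 g C := by
  have hb := H.hb
  set q : ℝ := (d : ℝ) + 1 with hq
  have hq0 : 0 < q := by positivity
  have hqd : -(d : ℝ) - 1 = -q := by rw [hq]; ring
  obtain ⟨C, hC, hJ⟩ := H.J_le_exp zero_lt_one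
  obtain ⟨D, hD, hD'⟩ := H.weight_one_tail hq0
  obtain ⟨A, hA, hA'⟩ := weight_one_translate (d := d) hq0 (show 0 < b / 5 by positivity)
  set e := Real.exp (q * Real.log 2 + b / 5) with he
  have he0 : 0 < e := Real.exp_pos _
  have hw := fun x => weight_pos (d := d) (q := q) (c := b / 5) (β := 1) x
  set w₀ := weight d q (b / 5) 1 (0 : EuclideanSpace ℝ (Fin d)) with hw₀
  have hw₀0 : 0 < w₀ := hw 0
  set K := C * Real.exp b * (A / w₀) with hK
  have hK0 : 0 < K := by positivity
  refine ⟨weight d q (b / 5) 1, weight_decayWeight H (D := e + D + K) hq0.le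
    (by positivity) ?_ ?_ ?_ ?_⟩
  · intro x hx
    rw [theta, if_neg hx.not_ge, if_neg (lt_irrefl _), hqd]
    refine (le_weight_one hq0.le (by positivity) hx.le).trans ?_
    have := hw x
    gcongr
    linarith
  · intro x hx
    rw [theta, if_neg hx.not_ge, if_neg (lt_irrefl _), hqd]
    exact weight_one_le hq0.le (by positivity) (by linarith)
  · intro x
    refine (hD' x).trans ?_
    have := hw x
    gcongr
    linarith
  · intro x s hs hxs
    have h1 : 1 ≤ A / w₀ * Real.exp (b * ‖x‖) * weight d q (b / 5) 1 x := by
      have h2 := hA' x (-x)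
      rw [add_neg_cancel, norm_neg, ← hw₀] at h2
      have h3 : Real.exp (2 * (b / 5) * ‖x‖) ≤ Real.exp (b * ‖x‖) := by
        gcongr
        linarith
      have h4 : w₀ ≤ A * Real.exp (b * ‖x‖) * weight d q (b / 5) 1 x := by
        refine h2.trans ?_
        have := hw x
        gcongr
      calc 1 = w₀ / w₀ := (div_self hw₀0.ne').symm
        _ ≤ A * Real.exp (b * ‖x‖) * weight d q (b / 5) 1 x / w₀ := by gcongr
        _ = _ := by ring
    have h5 := mul_le_mul_of_nonneg_left hxs hb.le
    calc J s ≤ C * Real.exp (-b * s ^ (1:ℝ)) := hJ s hs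
      _ ≤ C * (Real.exp b * Real.exp (-(b * ‖x‖))) := by
          gcongr
          rw [← Real.exp_add, Real.rpow_one]
          exact Real.exp_le_exp.2 (by linarith)
      _ ≤ C * (Real.exp b * Real.exp (-(b * ‖x‖))) *
            (A / w₀ * Real.exp (b * ‖x‖) * weight d q (b / 5) 1 x) :=
          le_mul_of_one_le_right (by positivity) h1
      _ = K * weight d q (b / 5) 1 x * (Real.exp (-(b * ‖x‖)) * Real.exp (b * ‖x‖)) := by
          rw [hK]; ring
      _ = K * weight d q (b / 5) 1 x := by rw [← Real.exp_add]; simp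
      _ ≤ _ := by
          have := hw x
          gcongr
          linarith

lemma exists_decayWeight (H : HKAssumptions d φ J a₁ α₁ C₀ a b β κ κ₀ κ₁ κ₂ δ) :
    ∃ g C, DecayWeight d φ J b β g C := by
  rcases H.β_le.lt_or_eq with h | rfl
  · exact H.exists_decayWeight_of_lt h
  · exact H.exists_decayWeight_of_eq

variable {g : EuclideanSpace ℝ (Fin d) → ℝ} {C : ℝ}

lemma Leps_weight_le (H : HKAssumptions d φ J a₁ α₁ C₀ a b β κ κ₀ κ₁ κ₂ δ)
    (W : DecayWeight d φ J b β g C) :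
    ∃ Λ, 0 < Λ ∧ ∀ ε, 0 < ε → ε ≤ 1 → ∀ x y,
      Leps d κ J ε (fun u => g (u - y)) x ≤ Λ * g (x - y) := by
  obtain ⟨D, hD, hsq⟩ := H.integral_sq_mul_J_le
  have hP := H.Phi_pos one_pos
  have hC : 0 < C := one_pos.trans_le W.one_le
  have hk1 := H.κ₁_pos
  refine ⟨κ₁ * C * (D / Phi φ 1) + κ₁ * C, by positivity, fun ε hε hε1 x y => ?_⟩
  have hg := W.pos (x - y)
  have hcont := W.cont
  have hb : ∃ B, ∀ u, |g (u - y)| ≤ B := ⟨1, fun u => by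
    rw [abs_of_pos (W.pos _)]; exact W.le_one _⟩
  have hk := H.measurable_kappa x
  have hkn : ∀ z, 0 ≤ κ x z := fun z => H.κ₀_pos.le.trans (H.κ_low x z)
  have hkΛ : ∀ z, |κ x z| ≤ κ₁ := fun z => by rw [abs_of_nonneg (hkn z)]; exact H.κ_up x z
  rw [H.Leps_split hε hε1 (by fun_prop) hb x, add_mul]
  have e : ∀ z, x + z - y = x - y + z := fun z => by abel
  refine add_le_add ?_ ?_
  · have h1 := setIntegral_annulus_symm_le (d := d) (ε := ε) (ρ := 1)
      (f := fun z => g (x + z - y) - g (x - y)) (B := fun z => C * ‖z‖ ^ 2 * g (x - y))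
      (q := fun z => κ x z * J ‖z‖)
      (H.integrableOn_annulus hε (by fun_prop) hk hkΛ)
      (H.integrableOn_annulus hε (by fun_prop) hk hkΛ)
      (fun z => by rw [norm_neg, ← H.κ_sym])
      (fun z hz => mul_nonneg (hkn z) (H.J_nonneg hε.le hz.1))
      (fun z hz => by
        have := W.second_diff (x - y) z hz.2
        rw [e, e, ← sub_eq_add_neg]
        linarith)
    refine h1.trans ?_
    have i2 : IntegrableOn (fun z : EuclideanSpace ℝ (Fin d) => ‖z‖ ^ 2 * J ‖z‖)
        (annulus d ε 1) := by
      simpa using H.integrableOn_annulus (f := fun z => ‖z‖ ^ 2) (q := fun _ => 1) (Λ := 1)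
        hε (by fun_prop) measurable_const (by simp)
    have h2 : ∫ z in annulus d ε 1, C * ‖z‖ ^ 2 * g (x - y) * (κ x z * J ‖z‖) ≤
        ∫ z in annulus d ε 1, κ₁ * C * g (x - y) * (‖z‖ ^ 2 * J ‖z‖) := by
      refine setIntegral_mono_on (H.integrableOn_annulus hε (by fun_prop) hk hkΛ)
        (i2.const_mul _) measurableSet_annulus fun z hz => ?_
      have hJ := H.J_nonneg hε.le hz.1
      calc C * ‖z‖ ^ 2 * g (x - y) * (κ x z * J ‖z‖)
          ≤ C * ‖z‖ ^ 2 * g (x - y) * (κ₁ * J ‖z‖) := by gcongr; exact H.κ_up x z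
        _ = _ := by ring
    refine h2.trans ?_
    rw [integral_const_mul]
    have h3 := hsq ε 1 hε one_pos le_rfl
    calc κ₁ * C * g (x - y) * ∫ z in annulus d ε 1, ‖z‖ ^ 2 * J ‖z‖
        ≤ κ₁ * C * g (x - y) * (D * (1 ^ 2 / Phi φ 1)) :=
          mul_le_mul_of_nonneg_left h3 (by positivity)
      _ = _ := by ring
  · have i3 := H.integrableOn_abs_mul_J one_pos (w := fun u => g (u - y)) (by fun_prop) hb x
    simp only [abs_of_pos (W.pos _)] at i3
    calc ∫ z in {z : EuclideanSpace ℝ (Fin d) | 1 < ‖z‖},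
          (g (x + z - y) - g (x - y)) * (κ x z * J ‖z‖)
        ≤ ∫ z in {z : EuclideanSpace ℝ (Fin d) | 1 < ‖z‖}, κ₁ * (g (x + z - y) * J ‖z‖) := by
          refine setIntegral_mono_on
            (H.integrableOn_Leps one_pos (w := fun u => g (u - y)) (by fun_prop) hb x)
            (i3.const_mul _) measurableSet_norm_gt fun z hz => ?_
          have hJ := H.J_nonneg zero_le_one hz
          have h0 := W.pos (x + z - y)
          calc (g (x + z - y) - g (x - y)) * (κ x z * J ‖z‖)
              ≤ g (x + z - y) * (κ x z * J ‖z‖) :=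
                mul_le_mul_of_nonneg_right (by linarith) (mul_nonneg (hkn z) hJ)
            _ ≤ g (x + z - y) * (κ₁ * J ‖z‖) := by gcongr; exact H.κ_up x z
            _ = _ := by ring
      _ = κ₁ * ∫ z in {z : EuclideanSpace ℝ (Fin d) | 1 < ‖z‖}, g (x - y + z) * J ‖z‖ := by
          rw [integral_const_mul]
          simp only [e]
      _ ≤ κ₁ * (C * g (x - y)) := mul_le_mul_of_nonneg_left (W.tail _) hk1.le
      _ = _ := by ring

/-- Lower bound for the nonlocal operator at a minimum taken outside the unit ball around `y`. -/
lemma le_Leps_of_min_off_ball (H : HKAssumptions d φ J a₁ α₁ C₀ a b β κ κ₀ κ₁ κ₂ δ)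
    (W : DecayWeight d φ J b β g C) {w f : EuclideanSpace ℝ (Fin d) → ℝ} (hw : Continuous w)
    (hwB : ∃ B, ∀ u, |w u| ≤ B) (hf : Continuous f) (hfB : ∃ B, ∀ u, |f u| ≤ B)
    {x y : EuclideanSpace ℝ (Fin d)} (hxy : 2 ≤ ‖x - y‖)
    (hout : ∀ u, 1 ≤ ‖u - y‖ → w x ≤ w u) (hin : ∀ u, w x - |f u| ≤ w u)
    {ε : ℝ} (hε : 0 < ε) :
    -(κ₁ * (C * g (x - y) * ∫ u in Metric.closedBall y 1, |f u|)) ≤ Leps d κ J ε w x := by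
  have hk1 := H.κ₁_pos
  have hC : 0 < C := one_pos.trans_le W.one_le
  have hg := W.pos (x - y)
  set A : Set (EuclideanSpace ℝ (Fin d)) := {z | ‖x + z - y‖ ≤ 1} with hA
  have hAm : MeasurableSet A := measurableSet_le (by fun_prop) measurable_const
  have h1 := H.integral_jump_to_ball_le (R := ε) (ρ := 1) (j := C * g (x - y)) hε
    (by positivity) hf x y (fun z hz hzy => by
      have h2 : ‖x - y‖ ≤ ‖x + z - y‖ + ‖z‖ := by
        have := norm_sub_le (x + z - y) z
        rwa [show x + z - y - z = x - y by abel] at this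
      exact W.jump (x - y) ‖z‖ (by linarith) (by linarith))
  have i1 := H.integrableOn_abs_mul_J hε hf hfB x
  rw [← hA, ← setIntegral_indicator hAm] at h1
  have h3 : ∫ z in {z : EuclideanSpace ℝ (Fin d) | ε < ‖z‖},
      -(κ₁ * A.indicator (fun z => |f (x + z)| * J ‖z‖) z) ≤ Leps d κ J ε w x := by
    refine setIntegral_mono_on (((i1.indicator hAm).const_mul _).neg)
      (H.integrableOn_Leps hε hw hwB x) measurableSet_norm_gt fun z hz => ?_
    have hJ := H.J_nonneg hε.le hz
    have hk := H.κ₀_pos.le.trans (H.κ_low x z)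
    by_cases hz' : z ∈ A
    · rw [indicator_of_mem hz']
      have h4 := hin (x + z)
      calc -(κ₁ * (|f (x + z)| * J ‖z‖)) = -|f (x + z)| * (κ₁ * J ‖z‖) := by ring
        _ ≤ -|f (x + z)| * (κ x z * J ‖z‖) := by
            refine mul_le_mul_of_nonpos_left ?_ (neg_nonpos.2 (abs_nonneg _))
            gcongr
            exact H.κ_up x z
        _ ≤ _ := mul_le_mul_of_nonneg_right (by linarith) (mul_nonneg hk hJ)
    · rw [indicator_of_notMem hz', mul_zero, neg_zero]
      have h4 := hout (x + z) (le_of_lt (by simpa [hA] using hz'))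
      exact mul_nonneg (by linarith) (mul_nonneg hk hJ)
  refine le_trans ?_ h3
  rw [integral_neg, integral_const_mul]
  exact neg_le_neg (mul_le_mul_of_nonneg_left h1 hk1.le)

end HKAssumptions

namespace GoodHeatKernel

variable {p : ℝ → EuclideanSpace ℝ (Fin d) → EuclideanSpace ℝ (Fin d) → ℝ}
  {g : EuclideanSpace ℝ (Fin d) → ℝ} {C : ℝ}

/-- A good heat kernel is bounded below by a multiple of the decay weight. -/
lemma neg_weight_le (H : HKAssumptions d φ J a₁ α₁ C₀ a b β κ κ₀ κ₁ κ₂ δ)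
    (S : PhiInvSpec φ Φinv) (G : GoodHeatKernel d φ J b β Φinv κ p)
    (W : DecayWeight d φ J b β g C) {T : ℝ} (hT : 1 ≤ T) :
    ∃ K, 0 < K ∧ ∀ t, 0 < t → t ≤ T → ∀ x y, 1 ≤ ‖x - y‖ →
      -(K * t * g (x - y)) ≤ p t x y := by
  obtain ⟨c, hc, hle⟩ := G.abs_le_profile H hT
  obtain ⟨I, hI, hInt⟩ := G.integral_abs_le H S hT
  obtain ⟨Λ, hΛ, hLg⟩ := H.Leps_weight_le W
  have hC : 0 < C := one_pos.trans_le W.one_le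
  have hk1 := H.κ₁_pos
  have hp1 := H.profile_pos one_pos
  obtain ⟨m, hm, hgm⟩ : ∃ m, 0 < m ∧ ∀ z : EuclideanSpace ℝ (Fin d), ‖z‖ ≤ 2 → m ≤ g z := by
    obtain ⟨z₀, -, hz₀⟩ := (isCompact_closedBall (0 : EuclideanSpace ℝ (Fin d)) 2).exists_isMinOn
      ⟨0, by simp⟩ W.cont.continuousOn
    exact ⟨g z₀, W.pos _, fun z hz => hz₀ (show z ∈ _ by simpa using hz)⟩
  set K := κ₁ * (C * I) + c * profile d φ 1 / m with hK
  have hK0 : 0 < K := by positivity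
  refine ⟨K * Real.exp (Λ * T), by positivity, fun t ht htT x y hxy => ?_⟩
  have hmain : ∀ η, 0 < η → 0 ≤ p t x y + K * t * Real.exp (Λ * t) * g (x - y) + η * t := by
    intro η hη
    by_contra hcon
    push Not at hcon
    set F : ℝ × EuclideanSpace ℝ (Fin d) → ℝ := fun q =>
      p q.1 q.2 y + K * q.1 * Real.exp (Λ * q.1) * g (q.2 - y) + η * q.1 with hF
    set M := -F (t, x) with hM
    have hM0 : 0 < M := by rw [hM]; linarith
    have hne : ∀ u : EuclideanSpace ℝ (Fin d), 1 ≤ ‖u - y‖ → u ≠ y := by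
      rintro u hu rfl
      simp at hu
      linarith
    have hFlow : ∀ s, 0 < s → s ≤ T → ∀ u, 1 ≤ ‖u - y‖ →
        -(c * s * profile d φ ‖u - y‖) + K * s * g (u - y) + η * s ≤ F (s, u) := by
      intro s hs hsT u hu
      have h1 := (abs_le.1 (hle s hs hsT u y (hne u hu))).1
      have h2 := W.pos (u - y)
      have h3 : K * s * g (u - y) ≤ K * s * Real.exp (Λ * s) * g (u - y) := by
        refine mul_le_mul_of_nonneg_right ?_ h2.le
        exact le_mul_of_one_le_right (by positivity) (Real.one_le_exp (by positivity))
      simp only [hF]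
      linarith
    have hFlow1 : ∀ s, 0 < s → s ≤ T → ∀ u, 1 ≤ ‖u - y‖ → -(c * s * profile d φ 1) ≤ F (s, u) := by
      intro s hs hsT u hu
      have h1 := hFlow s hs hsT u hu
      have h2 := H.profile_anti one_pos hu
      have h3 := W.pos (u - y)
      have h4 : c * s * profile d φ ‖u - y‖ ≤ c * s * profile d φ 1 := by gcongr
      have h5 : 0 ≤ K * s * g (u - y) := by positivity
      have h6 : 0 < η * s := by positivity
      linarith
    have hnear : ∀ s, 0 < s → s ≤ T → ∀ u, 1 ≤ ‖u - y‖ → ‖u - y‖ ≤ 2 → 0 ≤ F (s, u) := by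
      intro s hs hsT u hu hu2
      have h1 := hFlow s hs hsT u hu
      have h2 := H.profile_anti one_pos hu
      have h4 : c * s * profile d φ ‖u - y‖ ≤ c * s * profile d φ 1 := by gcongr
      have h5 : c * s * profile d φ 1 ≤ K * s * g (u - y) := by
        calc c * s * profile d φ 1 = c * profile d φ 1 / m * s * m := by field_simp
          _ ≤ K * s * g (u - y) := by
              have := hgm (u - y) hu2
              gcongr
              rw [hK]
              linarith [show 0 < κ₁ * (C * I) by positivity]
      have h6 : 0 < η * s := by positivity
      linarith
    -- beyond a large radius the function is nonnegative
    obtain ⟨R, hR2, hR⟩ : ∃ R, ‖x - y‖ ≤ R ∧ ∀ s, 0 < s → s ≤ T → ∀ u, R ≤ ‖u - y‖ →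
        0 ≤ F (s, u) := by
      refine ⟨max ‖x - y‖ (c * profile d φ 1 / η), le_max_left _ _, fun s hs hsT u hu => ?_⟩
      have hu1 : 1 ≤ ‖u - y‖ := hxy.trans ((le_max_left _ _).trans hu)
      have hu0 : 0 < ‖u - y‖ := by linarith
      have h1 := hFlow s hs hsT u hu1
      have h2 := W.pos (u - y)
      have h3 : 0 ≤ K * s * g (u - y) := by positivity
      have h4 : profile d φ ‖u - y‖ ≤ profile d φ 1 / ‖u - y‖ := by
        have hPm := H.Phi_mono one_pos hu1
        have hP1 := H.Phi_pos one_pos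
        unfold profile
        rw [div_div]
        refine one_div_le_one_div_of_le (by positivity) ?_
        calc (1:ℝ) ^ d * Phi φ 1 * ‖u - y‖ = ‖u - y‖ * Phi φ 1 := by rw [one_pow]; ring
          _ ≤ ‖u - y‖ ^ d * Phi φ ‖u - y‖ := by
              gcongr
              exact le_self_pow₀ hu1 (by have := H.hd; omega)
      have h5 : c * profile d φ ‖u - y‖ ≤ η := by
        have h6 : c * profile d φ 1 / η ≤ ‖u - y‖ := (le_max_right _ _).trans hu
        rw [div_le_iff₀ hη] at h6
        calc c * profile d φ ‖u - y‖ ≤ c * (profile d φ 1 / ‖u - y‖) := by gcongr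
          _ = c * profile d φ 1 / ‖u - y‖ := by ring
          _ ≤ η := by rw [div_le_iff₀ hu0]; linarith
      have h7 := mul_le_mul_of_nonneg_right h5 hs.le
      linarith
    set s₀ := min (t / 2) (M / (2 * (c * profile d φ 1))) with hs₀
    have hs₀0 : 0 < s₀ := by positivity
    have hs₀t : s₀ ≤ t := (min_le_left _ _).trans (by linarith)
    have hs₀M : c * s₀ * profile d φ 1 ≤ M / 2 := by
      calc c * s₀ * profile d φ 1 ≤ c * (M / (2 * (c * profile d φ 1))) * profile d φ 1 := by
            gcongr
            exact min_le_right _ _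
        _ = M / 2 := by field_simp
    set Q : Set (ℝ × EuclideanSpace ℝ (Fin d)) :=
      Icc s₀ t ×ˢ (Metric.closedBall y R ∩ {u | 1 ≤ ‖u - y‖}) with hQ
    have hQc : IsCompact Q := isCompact_Icc.prod ((isCompact_closedBall y R).inter_right
      (isClosed_le continuous_const (by fun_prop)))
    have hFc : ContinuousOn F Q := by
      have h1 : ContinuousOn (fun q : ℝ × EuclideanSpace ℝ (Fin d) => p q.1 q.2 y) Q :=
        (G.cont_prod y).mono fun q hq => ⟨hs₀0.trans_le hq.1.1, mem_univ _⟩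
      have hgc := W.cont
      exact (h1.add (Continuous.continuousOn (by fun_prop))).add
        (Continuous.continuousOn (by fun_prop))
    have hxQ : (t, x) ∈ Q := ⟨⟨hs₀t, le_rfl⟩, by simpa [dist_eq_norm] using hR2, hxy⟩
    obtain ⟨⟨s, x'⟩, hsQ, hmin⟩ := hQc.exists_isMinOn ⟨_, hxQ⟩ hFc
    have hFs : F (s, x') ≤ -M := by
      have : F (s, x') ≤ F (t, x) := hmin hxQ
      rw [hM]
      linarith
    have hs0 : 0 < s := hs₀0.trans_le hsQ.1.1
    have hsT : s ≤ T := hsQ.1.2.trans htT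
    have hx1 : 1 ≤ ‖x' - y‖ := hsQ.2.2
    have hx2 : 2 < ‖x' - y‖ := by
      by_contra h
      push Not at h
      linarith [hnear s hs0 hsT x' hx1 h]
    have hss₀ : s₀ < s := by
      refine lt_of_le_of_ne hsQ.1.1 ?_
      rintro rfl
      linarith [hFlow1 _ hs0 hsT x' hx1]
    -- the time derivative at the minimum
    obtain ⟨L, hL, hD⟩ := G.eqn s hs0 x' y (hne x' hx1)
    have hD2 : HasDerivAt (fun s => K * s * Real.exp (Λ * s) * g (x' - y) + η * s)
        ((K * Real.exp (Λ * s) + K * s * (Real.exp (Λ * s) * Λ)) * g (x' - y) + η) s := by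
      have e1 : HasDerivAt (fun s : ℝ => K * s) K s := by simpa using (hasDerivAt_id s).const_mul K
      have e2 : HasDerivAt (fun s : ℝ => Real.exp (Λ * s)) (Real.exp (Λ * s) * Λ) s :=
        HasDerivAt.exp (by simpa using (hasDerivAt_id s).const_mul Λ)
      have e3 : HasDerivAt (fun s : ℝ => η * s) η s := by simpa using (hasDerivAt_id s).const_mul η
      exact ((e1.mul e2).mul_const _).add e3
    have h1 := HasDerivAt.nonneg_of_left_max (hD.add hD2).neg hss₀ (fun u hu => by
      have h2 : F (s, x') ≤ F (u, x') := hmin (show (u, x') ∈ Q from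
        ⟨⟨hu.1, hu.2.trans hsQ.1.2⟩, hsQ.2⟩)
      simp only [hF] at h2
      simp only [Pi.neg_apply, Pi.add_apply]
      linarith)
    -- the spatial estimate at the minimum
    set l := K * s * Real.exp (Λ * s) with hl
    have hl0 : 0 < l := by positivity
    have hgc := W.cont
    have hgB : ∃ B, ∀ u, |g (u - y)| ≤ B := ⟨1, fun u => by
      rw [abs_of_pos (W.pos _)]; exact W.le_one _⟩
    have hpc := G.cont_fst hs0 y
    obtain ⟨B, hB⟩ := G.bounded H hs0 y
    have hFout : ∀ u, 1 ≤ ‖u - y‖ → F (s, x') ≤ F (s, u) := by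
      intro u hu
      rcases le_total ‖u - y‖ R with h | h
      · exact hmin (show (s, u) ∈ Q from ⟨hsQ.1, by simpa [dist_eq_norm] using h, hu⟩)
      · linarith [hR s hs0 hsT u h]
    have hηs : 0 < η * s := by positivity
    have hlow : ∀ ε, 0 < ε → ε ≤ 1 →
        -(κ₁ * (C * g (x' - y) * I)) - l * (Λ * g (x' - y)) ≤
          Leps d κ J ε (fun u => p s u y) x' := by
      intro ε hε hε1
      have h2 := H.le_Leps_of_min_off_ball W (w := fun u => p s u y + l * g (u - y))
        (f := fun u => p s u y) (by fun_prop) ⟨B + l, fun u => by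
          refine (abs_add_le _ _).trans (add_le_add (hB u) ?_)
          rw [abs_of_pos (mul_pos hl0 (W.pos _))]
          exact mul_le_of_le_one_right hl0.le (W.le_one _)⟩ hpc ⟨B, hB⟩ hx2.le
        (fun u hu => by
          have := hFout u hu
          simp only [hF] at this
          rw [← hl] at this
          linarith)
        (fun u => by
          have h3 := mul_pos hl0 (W.pos (u - y))
          have h4 := neg_abs_le (p s u y)
          simp only [hF] at hFs
          rw [← hl] at hFs
          linarith) hε
      rw [H.Leps_add_mul hε hpc ⟨B, hB⟩ (by fun_prop) hgB] at h2
      have h5 := mul_le_mul_of_nonneg_left (hLg ε hε hε1 x' y) hl0.le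
      have h6 : κ₁ * (C * g (x' - y) * ∫ u in Metric.closedBall y 1, |p s u y|) ≤
          κ₁ * (C * g (x' - y) * I) := by
        have := W.pos (x' - y)
        have := hInt s hs0 hsT y
        gcongr
      linarith
    have hLlow : -(κ₁ * (C * g (x' - y) * I)) - l * (Λ * g (x' - y)) ≤ L := by
      refine ge_of_tendsto hL ?_
      filter_upwards [Ioc_mem_nhdsGT one_pos] with ε hε
      exact hlow ε hε.1 hε.2
    have hgx := W.pos (x' - y)
    have h8 : κ₁ * (C * I) * g (x' - y) ≤ K * Real.exp (Λ * s) * g (x' - y) := by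
      refine mul_le_mul_of_nonneg_right ?_ hgx.le
      calc κ₁ * (C * I) ≤ K := by
            rw [hK]
            linarith [show 0 < c * profile d φ 1 / m by positivity]
        _ ≤ K * Real.exp (Λ * s) :=
            le_mul_of_one_le_right hK0.le (Real.one_le_exp (by positivity))
    have h9 : (K * Real.exp (Λ * s) + K * s * (Real.exp (Λ * s) * Λ)) * g (x' - y) =
        K * Real.exp (Λ * s) * g (x' - y) + l * (Λ * g (x' - y)) := by rw [hl]; ring
    linarith
  have h0 : 0 ≤ p t x y + K * t * Real.exp (Λ * t) * g (x - y) := by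
    refine le_of_forall_pos_le_add fun η hη => ?_
    have := hmain (η / t) (by positivity)
    rwa [div_mul_cancel₀ _ ht.ne'] at this
  have h1 : K * t * Real.exp (Λ * t) * g (x - y) ≤ K * Real.exp (Λ * T) * t * g (x - y) := by
    have := W.pos (x - y)
    calc K * t * Real.exp (Λ * t) * g (x - y) ≤ K * t * Real.exp (Λ * T) * g (x - y) := by gcongr
      _ = _ := by ring
  linarith

end GoodHeatKernel

namespace HKAssumptions

/-- Splitting the tail integral according to whether the jump lands near `y`. -/
lemma integral_tail_le_of_split (H : HKAssumptions d φ J a₁ α₁ C₀ a b β κ κ₀ κ₁ κ₂ δ) {R ρ j : ℝ}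
    (hR : 0 < R) (hj : 0 ≤ j) (hρ : ρ ≤ 1) {f h : EuclideanSpace ℝ (Fin d) → ℝ}
    (hf : Continuous f)
    (hfB : ∃ B, ∀ u, |f u| ≤ B) (hh : Continuous h) (hhB : ∃ B, ∀ u, |h u| ≤ B)
    (hh0 : ∀ u, 0 ≤ h u) (x y : EuclideanSpace ℝ (Fin d))
    (hJ : ∀ z, R < ‖z‖ → ‖x + z - y‖ ≤ ρ → J ‖z‖ ≤ j)
    (hfh : ∀ u, ρ < ‖u - y‖ → |f u| ≤ h u) :
    ∫ z in {z : EuclideanSpace ℝ (Fin d) | R < ‖z‖}, |f (x + z)| * J ‖z‖ ≤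
      (j * ∫ w in Metric.closedBall y 1, |f w|) +
        ∫ z in {z : EuclideanSpace ℝ (Fin d) | R < ‖z‖}, h (x + z) * J ‖z‖ := by
  set A : Set (EuclideanSpace ℝ (Fin d)) := {z | ‖x + z - y‖ ≤ ρ} with hA
  have hAm : MeasurableSet A := measurableSet_le (by fun_prop) measurable_const
  have h1 := H.integral_jump_to_ball_le hR hj hf x y hJ
  rw [← hA] at h1
  have i1 := H.integrableOn_abs_mul_J hR hf hfB x
  have i2 := H.integrableOn_abs_mul_J hR hh hhB x
  simp only [abs_of_nonneg (hh0 _)] at i2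
  have h2 : ∫ w in Metric.closedBall y ρ, |f w| ≤ ∫ w in Metric.closedBall y 1, |f w| := by
    refine setIntegral_mono_set ?_ (Eventually.of_forall fun w => abs_nonneg _)
      (Metric.closedBall_subset_closedBall hρ).eventuallyLE
    exact hf.abs.continuousOn.integrableOn_compact (isCompact_closedBall y 1)
  have h3 : ∫ z in {z : EuclideanSpace ℝ (Fin d) | R < ‖z‖} \ A, |f (x + z)| * J ‖z‖ ≤
      ∫ z in {z : EuclideanSpace ℝ (Fin d) | R < ‖z‖}, h (x + z) * J ‖z‖ := by
    calc ∫ z in {z : EuclideanSpace ℝ (Fin d) | R < ‖z‖} \ A, |f (x + z)| * J ‖z‖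
        ≤ ∫ z in {z : EuclideanSpace ℝ (Fin d) | R < ‖z‖} \ A, h (x + z) * J ‖z‖ := by
          refine setIntegral_mono_on (i1.mono_set sdiff_subset) (i2.mono_set sdiff_subset)
            (measurableSet_norm_gt.diff hAm) fun z hz => ?_
          refine mul_le_mul_of_nonneg_right (hfh _ ?_) (H.J_nonneg hR.le hz.1)
          simpa [hA] using hz.2
      _ ≤ _ := by
          refine setIntegral_mono_set i2 ?_ sdiff_subset.eventuallyLE
          filter_upwards [ae_restrict_mem measurableSet_norm_gt] with z hz
          exact mul_nonneg (hh0 _) (H.J_nonneg hR.le hz)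
  rw [← integral_inter_add_sdiff hAm i1]
  exact add_le_add (h1.trans (mul_le_mul_of_nonneg_left h2 hj)) h3

/-- To bound a quantity by `t * Gfun`, bound it by both competitors. -/
lemma le_mul_Gfun (S : PhiInvSpec φ Φinv) {K M t X : ℝ} (hK : 1 ≤ K) (hM : 0 ≤ M)
    (ht : 0 < t) (hs : Φinv t ≤ K * scale Φinv t) {x : EuclideanSpace ℝ (Fin d)}
    (h1 : X ≤ M * (1 / scale Φinv t ^ d)) (h2 : x ≠ 0 → X ≤ M * t * theta d φ b β ‖x‖)
    (hθ : x ≠ 0 → 0 ≤ theta d φ b β ‖x‖) :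
    X ≤ M * K ^ d * t * Gfun d φ b β Φinv t x := by
  have hpos := scale_pos S ht
  have hinv := S.pos t ht
  have hK0 : 0 < K := by linarith
  have hKd : 1 ≤ K ^ d := one_le_pow₀ hK
  have e1 : X ≤ M * K ^ d * t * (1 / (t * Φinv t ^ d)) := by
    calc X ≤ M * (1 / scale Φinv t ^ d) := h1
      _ ≤ M * (K ^ d / Φinv t ^ d) := by
          refine mul_le_mul_of_nonneg_left ?_ hM
          rw [div_le_div_iff₀ (by positivity) (by positivity), one_mul, ← mul_pow]
          gcongr
      _ = _ := by field_simp
  rw [Gfun]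
  split_ifs with hx
  · exact e1
  · rw [mul_min_of_nonneg _ _ (by positivity)]
    refine le_min e1 ((h2 hx).trans ?_)
    have := hθ hx
    gcongr
    exact le_mul_of_one_le_right hM hKd

lemma theta_pos (H : HKAssumptions d φ J a₁ α₁ C₀ a b β κ κ₀ κ₁ κ₂ δ) {r : ℝ} (hr : 0 < r) :
    0 < theta d φ b β r := by
  have := H.Phi_pos hr
  unfold theta
  split_ifs <;> positivity

end HKAssumptions

namespace GoodHeatKernel

variable {p : ℝ → EuclideanSpace ℝ (Fin d) → EuclideanSpace ℝ (Fin d) → ℝ}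
  {g : EuclideanSpace ℝ (Fin d) → ℝ} {C : ℝ}

lemma abs_le_weight (H : HKAssumptions d φ J a₁ α₁ C₀ a b β κ κ₀ κ₁ κ₂ δ)
    (S : PhiInvSpec φ Φinv) (G : GoodHeatKernel d φ J b β Φinv κ p)
    (W : DecayWeight d φ J b β g C) {T : ℝ} (hT : 1 ≤ T) :
    ∃ K, 0 < K ∧ ∀ t, 0 < t → t ≤ T → ∀ x y, 1 ≤ ‖x - y‖ →
      |p t x y| ≤ K * t * g (x - y) := by
  obtain ⟨K, hK, hlow⟩ := G.neg_weight_le H S W hT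
  obtain ⟨c, hc, hup⟩ := G.upper T hT
  have hC : 0 < C := one_pos.trans_le W.one_le
  refine ⟨K + c * C, by positivity, fun t ht htT x y hxy => ?_⟩
  have hg := W.pos (x - y)
  have h1 : p t x y ≤ c * t * (C * g (x - y)) := by
    refine (hup t ht htT x y).trans ?_
    gcongr
    have hne : x - y ≠ 0 := norm_pos_iff.1 (by linarith)
    rw [Gfun, if_neg hne]
    exact (min_le_right _ _).trans (W.theta_le _ hxy)
  have h2 := hlow t ht htT x y hxy
  have h3 : 0 < c * t * (C * g (x - y)) := by positivity
  have h4 : 0 < K * t * g (x - y) := by positivity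
  rw [abs_le]
  constructor <;> linarith

/-- Near-diagonal upper bound in a form without a singularity. -/
lemma abs_le_profile_max (H : HKAssumptions d φ J a₁ α₁ C₀ a b β κ κ₀ κ₁ κ₂ δ)
    (S : PhiInvSpec φ Φinv) (G : GoodHeatKernel d φ J b β Φinv κ p) {T : ℝ} (hT : 1 ≤ T) :
    ∃ c, 0 < c ∧ ∀ t, 0 < t → t ≤ T → ∀ x y,
      |p t x y| ≤ c * (t * profile d φ (max ‖x - y‖ (scale Φinv t))) := by
  obtain ⟨c, hc, hle⟩ := G.abs_le_profile H hT
  obtain ⟨c', hc', hle'⟩ := G.abs_le_scale H S hT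
  refine ⟨c + c', by positivity, fun t ht htT x y => ?_⟩
  have hr := HKAssumptions.scale_pos S ht
  set r := scale Φinv t
  have hm := H.profile_pos (d := d) (hr.trans_le (le_max_right ‖x - y‖ r))
  rcases le_total r ‖x - y‖ with h | h
  · rw [max_eq_left h] at hm ⊢
    have hne : x ≠ y := by
      rintro rfl
      simp at h
      linarith
    refine (hle t ht htT x y hne).trans ?_
    rw [mul_assoc]
    gcongr
    linarith
  · rw [max_eq_right h] at hm ⊢
    refine (hle' t ht htT x y).trans ?_
    have h2 := H.Phi_scale_le S ht
    have hP := H.Phi_pos hr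
    have h3 : 1 / r ^ d ≤ t * profile d φ r := by
      calc 1 / r ^ d = Phi φ r * profile d φ r := by unfold profile; field_simp
        _ ≤ _ := by gcongr
    calc c' * (1 / r ^ d) ≤ c' * (t * profile d φ r) := by gcongr
      _ ≤ _ := by gcongr; linarith

lemma abs_Leps_le_profile_max (H : HKAssumptions d φ J a₁ α₁ C₀ a b β κ κ₀ κ₁ κ₂ δ)
    (S : PhiInvSpec φ Φinv) (G : GoodHeatKernel d φ J b β Φinv κ p) {T : ℝ} (hT : 1 ≤ T) :
    ∃ c, 0 < c ∧ ∀ ε, 0 < ε → ε ≤ 1 → ∀ t, 0 < t → t ≤ T → ∀ x y,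
      |Leps d κ J ε (fun x' => p t x' y) x| ≤
        c * profile d φ (max ‖x - y‖ (scale Φinv t)) := by
  obtain ⟨c, hc, hfrac⟩ := G.frac T hT
  refine ⟨c, hc, fun ε hε hε1 t ht htT x y => ?_⟩
  have hr := HKAssumptions.scale_pos S ht
  have hP := H.Phi_pos hr
  set r := scale Φinv t with hrdef
  have hr_le : ∀ u, u ≠ y → |Leps d κ J ε (fun x' => p t x' y) u| ≤ c * profile d φ r := by
    intro u hu
    refine (hfrac ε hε hε1 t ht htT u y hu).trans ?_
    gcongr
    refine (HKAssumptions.Gtil_le S ht _).trans ?_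
    have := H.Phi_scale_le S ht
    rw [profile, mul_comm (r ^ d)]
    gcongr
  rcases le_total r ‖x - y‖ with h | h
  · rw [max_eq_left h]
    have hne : x ≠ y := by
      rintro rfl
      simp at h
      linarith
    refine (hfrac ε hε hε1 t ht htT x y hne).trans ?_
    gcongr
    exact HKAssumptions.Gtil_le_profile (sub_ne_zero.2 hne)
  · rw [max_eq_right h]
    have := nontrivial_euclideanSpace H.hd
    have hcl : IsClosed {u | |Leps d κ J ε (fun x' => p t x' y) u| ≤ c * profile d φ r} :=
      isClosed_le (H.continuous_Leps hε (G.cont_fst ht y) (G.bounded H ht y)).abs continuous_const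
    have hd : Dense ({y}ᶜ : Set (EuclideanSpace ℝ (Fin d))) := dense_compl_singleton y
    exact hcl.closure_subset_iff.2 (fun u hu => hr_le u hu) (hd x)

lemma tail_le_profile_max (H : HKAssumptions d φ J a₁ α₁ C₀ a b β κ κ₀ κ₁ κ₂ δ)
    (S : PhiInvSpec φ Φinv) (G : GoodHeatKernel d φ J b β Φinv κ p) {T : ℝ} (hT : 1 ≤ T) :
    ∃ D, 0 < D ∧ ∀ t, 0 < t → t ≤ T → ∀ x u y, ‖x - y‖ ≤ 3 → ‖u - x‖ ≤ scale Φinv t / 2 →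
      ∫ z in {z : EuclideanSpace ℝ (Fin d) | scale Φinv t / 2 < ‖z‖}, |p t (u + z) y| * J ‖z‖ ≤
        D * (t * profile d φ (max ‖x - y‖ (scale Φinv t))) / Phi φ (scale Φinv t) := by
  obtain ⟨c, hc, hle⟩ := G.abs_le_profile_max H S hT
  obtain ⟨I, hI, hInt⟩ := G.integral_abs_le H S hT
  obtain ⟨E, hE, hJ⟩ := H.integral_J_le
  have ha : 0 < a := one_pos.trans_le H.ha
  set N : ℝ := 8 ^ (d + 2) with hN
  have hN0 : 0 < N := by positivity
  refine ⟨a * N * I + 4 * (c * N * E), by positivity, fun t ht htT x u y hxy hux => ?_⟩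
  have hr := HKAssumptions.scale_pos S ht
  have hrt := H.Phi_scale_le S ht
  have hr1 : scale Φinv t ≤ 1 := min_le_left _ _
  set r := scale Φinv t with hrdef
  set ρ := max ‖x - y‖ r with hρ
  have hrρ : r ≤ ρ := le_max_right _ _
  have hρ0 : 0 < ρ := hr.trans_le hrρ
  have hρ3 : ρ ≤ 3 := max_le hxy (by linarith)
  have hP := H.Phi_pos hr
  have hprof := H.profile_pos (d := d) hρ0
  have hpc := G.cont_fst ht y
  have hpB := G.bounded H ht y
  have hJr : ∫ z in {z : EuclideanSpace ℝ (Fin d) | r / 2 < ‖z‖}, J ‖z‖ ≤ 4 * E / Phi φ r := by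
    refine (hJ (r / 2) (by positivity) (by linarith)).trans ?_
    have h1 := H.Phi_half hr
    have h2 := H.Phi_pos (half_pos hr)
    rw [div_le_div_iff₀ h2 hP]
    have := mul_le_mul_of_nonneg_left h1 hE.le
    linarith
  -- values of the kernel off a small ball around `y`
  have hval : ∀ v, ρ ≤ 8 * max ‖v - y‖ r → |p t v y| ≤ c * (t * (N * profile d φ ρ)) := by
    intro v hv
    refine (hle t ht htT v y).trans ?_
    gcongr
    have h0 : 0 < max ‖v - y‖ r := hr.trans_le (le_max_right _ _)
    calc profile d φ (max ‖v - y‖ r) ≤ profile d φ (ρ / 8) :=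
          H.profile_anti (by positivity) (by linarith)
      _ ≤ (ρ / (ρ / 8)) ^ (d + 2) * profile d φ ρ :=
          H.profile_upper (by positivity) (by linarith)
      _ = _ := by rw [show ρ / (ρ / 8) = 8 by field_simp]
  set h := c * (t * (N * profile d φ ρ)) with hh
  have hh0 : 0 < h := by positivity
  obtain ⟨σ, hσ1, hσJ, hσv⟩ : ∃ σ ≤ (1:ℝ),
      (∀ z, r / 2 < ‖z‖ → ‖u + z - y‖ ≤ σ → J ‖z‖ ≤ a * (N * profile d φ ρ)) ∧
      ∀ v, σ < ‖v - y‖ → |p t v y| ≤ h := by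
    rcases le_total ρ (8 * r) with hcase | hcase
    · refine ⟨-1, by norm_num, fun z _ hz => ?_, fun v _ => hval v ?_⟩
      · linarith [norm_nonneg (u + z - y)]
      · exact hcase.trans (by gcongr; exact le_max_right _ _)
    · refine ⟨ρ / 8, by linarith, fun z _ hz => ?_, fun v hv => hval v ?_⟩
      · have hρx : ρ = ‖x - y‖ := by
          rw [hρ]
          refine max_eq_left ?_
          by_contra hcon
          push Not at hcon
          have : ρ = r := max_eq_right hcon.le
          linarith
        have h1 : ‖x - y‖ ≤ ‖u + z - y‖ + ‖z‖ + ‖u - x‖ := by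
          have := norm_add₃_le (a := u + z - y) (b := -z) (c := -(u - x))
          rwa [norm_neg, norm_neg, show u + z - y + -z + -(u - x) = x - y by abel] at this
        have hz4 : ρ / 4 ≤ ‖z‖ := by linarith
        have h4 : 0 < ρ / 4 := by positivity
        have h41 : ρ / 4 ≤ 1 := by linarith
        have hφ := H.phi_pos h4 h41
        have hPφ := H.Phi_le_phi h4 h41
        have hP4 := H.Phi_pos h4
        calc J ‖z‖ ≤ J (ρ / 4) := H.J_anti h4 (h4.trans_le hz4) hz4
          _ ≤ a / ((ρ / 4) ^ d * φ (ρ / 4)) := H.hJ1_up _ h4 h41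
          _ ≤ a / ((ρ / 4) ^ d * Phi φ (ρ / 4)) := by gcongr
          _ = a * profile d φ (ρ / 4) := by rw [profile]; ring
          _ ≤ a * profile d φ (ρ / 8) := by
              have := H.profile_anti (d := d) (show 0 < ρ / 8 by positivity)
                (show ρ / 8 ≤ ρ / 4 by linarith)
              gcongr
          _ ≤ a * ((ρ / (ρ / 8)) ^ (d + 2) * profile d φ ρ) :=
              mul_le_mul_of_nonneg_left (H.profile_upper (by positivity) (by linarith)) ha.le
          _ = _ := by rw [show ρ / (ρ / 8) = 8 by field_simp]
      · have := le_max_left ‖v - y‖ r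
        linarith
  have hmain := H.integral_tail_le_of_split (R := r / 2) (ρ := σ) (j := a * (N * profile d φ ρ))
    (f := fun v => p t v y) (h := fun _ => h) (by positivity) (by positivity) hσ1 hpc hpB
    continuous_const ⟨h, fun _ => by rw [abs_of_pos hh0]⟩ (fun _ => hh0.le) u y hσJ hσv
  refine hmain.trans ?_
  rw [integral_const_mul]
  have e1 : a * (N * profile d φ ρ) * ∫ w in Metric.closedBall y 1, |p t w y| ≤
      a * (N * profile d φ ρ) * I := mul_le_mul_of_nonneg_left (hInt t ht htT y) (by positivity)
  have e2 : h * ∫ z in {z : EuclideanSpace ℝ (Fin d) | r / 2 < ‖z‖}, J ‖z‖ ≤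
      h * (4 * E / Phi φ r) := mul_le_mul_of_nonneg_left hJr hh0.le
  have e3 : a * (N * profile d φ ρ) * I ≤ a * (N * profile d φ ρ) * I * (t / Phi φ r) :=
    le_mul_of_one_le_right (by positivity) ((one_le_div hP).2 hrt)
  calc _ ≤ a * (N * profile d φ ρ) * I * (t / Phi φ r) + h * (4 * E / Phi φ r) :=
        add_le_add (e1.trans e3) e2
    _ = _ := by rw [hh]; ring

/-- Interior Hölder estimate in the near-diagonal regime. -/
lemma holder_near (H : HKAssumptions d φ J a₁ α₁ C₀ a b β κ κ₀ κ₁ κ₂ δ)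
    (S : PhiInvSpec φ Φinv) (G : GoodHeatKernel d φ J b β Φinv κ p) {T : ℝ} (hT : 1 ≤ T)
    {γ : ℝ} (hγ0 : 0 < γ) (hγ1 : γ ≤ 1) (hγ : γ < α₁) :
    ∃ K, 0 < K ∧ ∀ t, 0 < t → t ≤ T → ∀ x x' y, ‖x - y‖ ≤ 3 → ‖x' - x‖ ≤ scale Φinv t →
      |p t x y - p t x' y| ≤ K * (t * profile d φ (max ‖x - y‖ (scale Φinv t))) *
        (‖x - x'‖ / scale Φinv t) ^ γ := by
  obtain ⟨M, hM, hmain⟩ := H.holder_elliptic hγ0 hγ1 hγ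
  obtain ⟨c, hc, hle⟩ := G.abs_le_profile_max H S hT
  obtain ⟨c', hc', hfrac⟩ := G.abs_Leps_le_profile_max H S hT
  obtain ⟨D, hD, htail⟩ := G.tail_le_profile_max H S hT
  set N : ℝ := 2 ^ (d + 2) with hN
  have hN0 : 0 < N := by positivity
  refine ⟨(c * N + c' * N + D) * M, by positivity, fun t ht htT x x' y hxy hx' => ?_⟩
  have hr := HKAssumptions.scale_pos S ht
  have hrt := H.Phi_scale_le S ht
  have hr1 : scale Φinv t ≤ 1 := min_le_left _ _
  have htail := htail t ht htT x
  set r := scale Φinv t with hrdef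
  set ρ := max ‖x - y‖ r with hρ
  have hrρ : r ≤ ρ := le_max_right _ _
  have hρ0 : 0 < ρ := hr.trans_le hrρ
  have hP := H.Phi_pos hr
  have hprof := H.profile_pos (d := d) hρ0
  have hcmp : ∀ u, ‖u - x‖ ≤ r → profile d φ (max ‖u - y‖ r) ≤ N * profile d φ ρ := by
    intro u hu
    have h1 : ‖x - y‖ ≤ ‖u - y‖ + ‖u - x‖ := by
      have := norm_sub_le (u - y) (u - x)
      rwa [show u - y - (u - x) = x - y by abel] at this
    have h2 : ρ / 2 ≤ max ‖u - y‖ r := by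
      have h3 := le_max_left ‖u - y‖ r
      have h4 := le_max_right ‖u - y‖ r
      have : ρ ≤ 2 * max ‖u - y‖ r := max_le (by linarith) (by linarith)
      linarith
    calc profile d φ (max ‖u - y‖ r) ≤ profile d φ (ρ / 2) := H.profile_anti (by positivity) h2
      _ ≤ (ρ / (ρ / 2)) ^ (d + 2) * profile d φ ρ := H.profile_upper (by positivity) (by linarith)
      _ = _ := by rw [show ρ / (ρ / 2) = 2 by field_simp]
  have hcN : 0 < c * N := by positivity
  have hcN' : 0 < c' * N := by positivity
  have h := hmain ((c * N + c' * N + D) * (t * profile d φ ρ)) r x (fun u => p t u y)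
    (by positivity) hr hr1 (G.cont_fst ht y) (G.bounded H ht y)
    (fun u hu => by
      calc |p t u y| ≤ c * (t * profile d φ (max ‖u - y‖ r)) := hle t ht htT u y
        _ ≤ c * (t * (N * profile d φ ρ)) := by
            have := hcmp u hu
            gcongr
        _ = c * N * (t * profile d φ ρ) := by ring
        _ ≤ _ := by gcongr; linarith)
    (fun u hu => by
      refine (htail u y hxy hu).trans ?_
      gcongr
      linarith)
    (fun ε hε hε1 u hu => by
      calc |Leps d κ J ε (fun u => p t u y) u| ≤ c' * profile d φ (max ‖u - y‖ r) :=
            hfrac ε hε hε1 t ht htT u y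
        _ ≤ c' * (N * profile d φ ρ) := by
            have := hcmp u hu
            gcongr
        _ ≤ c' * (N * profile d φ ρ) * (t / Phi φ r) :=
            le_mul_of_one_le_right (by positivity) ((one_le_div hP).2 hrt)
        _ = c' * N * (t * profile d φ ρ) / Phi φ r := by ring
        _ ≤ _ := by gcongr; linarith) x' hx'
  exact h.trans_eq (by ring)

/-- Interior Hölder estimate in the far regime. -/
lemma holder_far (H : HKAssumptions d φ J a₁ α₁ C₀ a b β κ κ₀ κ₁ κ₂ δ)
    (S : PhiInvSpec φ Φinv) (G : GoodHeatKernel d φ J b β Φinv κ p)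
    (W : DecayWeight d φ J b β g C) {T : ℝ} (hT : 1 ≤ T)
    {γ : ℝ} (hγ0 : 0 < γ) (hγ1 : γ ≤ 1) (hγ : γ < α₁) :
    ∃ K, 0 < K ∧ ∀ t, 0 < t → t ≤ T → ∀ x x' y, 3 ≤ ‖x - y‖ → ‖x' - x‖ ≤ scale Φinv t →
      |p t x y - p t x' y| ≤ K * (t * g (x - y)) * (‖x - x'‖ / scale Φinv t) ^ γ := by
  obtain ⟨M, hM, hmain⟩ := H.holder_parabolic hγ0 hγ1 hγ
  obtain ⟨c, hc, hle⟩ := G.abs_le_weight H S W hT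
  obtain ⟨I, hI, hInt⟩ := G.integral_abs_le H S hT
  obtain ⟨E, hE, hJ⟩ := H.integral_J_le
  have hC : 0 < C := one_pos.trans_le W.one_le
  have hP1 := H.Phi_pos one_pos
  set D := C * C * I + c * C * C * (4 * E + Phi φ 1) with hD
  have hD0 : 0 < D := by positivity
  refine ⟨(c * C + D) * M, by positivity, fun t ht htT x x' y hxy hx' => ?_⟩
  have hr := HKAssumptions.scale_pos S ht
  have hrt := H.Phi_scale_le S ht
  have hr1 : scale Φinv t ≤ 1 := min_le_left _ _
  set r := scale Φinv t with hrdef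
  have hP := H.Phi_pos hr
  have hg := W.pos (x - y)
  have hgc := W.cont
  have hgB : ∃ B, ∀ u, |g (u - y)| ≤ B := ⟨1, fun u => by
    rw [abs_of_pos (W.pos _)]; exact W.le_one _⟩
  have hcmp : ∀ u, ‖u - x‖ ≤ r → g (u - y) ≤ C * g (x - y) ∧ 2 ≤ ‖u - y‖ := by
    intro u hu
    have h1 := W.harnack (x - y) (u - x) (hu.trans hr1)
    rw [show x - y + (u - x) = u - y by abel] at h1
    have h2 : ‖x - y‖ ≤ ‖u - y‖ + ‖u - x‖ := by
      have := norm_sub_le (u - y) (u - x)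
      rwa [show u - y - (u - x) = x - y by abel] at this
    exact ⟨h1, by linarith⟩
  have hJr : ∫ z in {z : EuclideanSpace ℝ (Fin d) | r / 2 < ‖z‖}, J ‖z‖ ≤ 4 * E / Phi φ r := by
    refine (hJ (r / 2) (by positivity) (by linarith)).trans ?_
    have h1 := H.Phi_half hr
    have h2 := H.Phi_pos (half_pos hr)
    rw [div_le_div_iff₀ h2 hP]
    have := mul_le_mul_of_nonneg_left h1 hE.le
    linarith
  -- jumps weighted by the decay weight
  have hgJ : ∀ u, ∫ z in {z : EuclideanSpace ℝ (Fin d) | r / 2 < ‖z‖}, g (u + z - y) * J ‖z‖ ≤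
      C * g (u - y) * ((4 * E + Phi φ 1) / Phi φ r) := by
    intro u
    have hgu := W.pos (u - y)
    have i1 := H.integrableOn_abs_mul_J (half_pos hr) (w := fun u => g (u - y)) (by fun_prop) hgB u
    simp only [abs_of_pos (W.pos _)] at i1
    have i2 := H.integrableOn_abs_mul_J one_pos (w := fun u => g (u - y)) (by fun_prop) hgB u
    simp only [abs_of_pos (W.pos _)] at i2
    have hr2 : r / 2 ≤ 1 := by linarith
    have e : ∀ z, u + z - y = u - y + z := fun z => by abel
    have h1 : ∫ z in annulus d (r / 2) 1, g (u + z - y) * J ‖z‖ ≤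
        C * g (u - y) * (4 * E / Phi φ r) := by
      calc ∫ z in annulus d (r / 2) 1, g (u + z - y) * J ‖z‖
          ≤ ∫ z in annulus d (r / 2) 1, C * g (u - y) * J ‖z‖ := by
            refine setIntegral_mono_on (i1.mono_set annulus_subset)
              (((H.integrableOn_J (half_pos hr)).mono_set annulus_subset).const_mul _)
              measurableSet_annulus fun z hz => ?_
            refine mul_le_mul_of_nonneg_right ?_ (H.J_nonneg (half_pos hr).le hz.1)
            rw [e]
            exact W.harnack _ _ hz.2
        _ = C * g (u - y) * ∫ z in annulus d (r / 2) 1, J ‖z‖ := by rw [integral_const_mul]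
        _ ≤ C * g (u - y) * ∫ z in {z : EuclideanSpace ℝ (Fin d) | r / 2 < ‖z‖}, J ‖z‖ := by
            refine mul_le_mul_of_nonneg_left ?_ (by positivity)
            refine setIntegral_mono_set (H.integrableOn_J (half_pos hr)) ?_
              annulus_subset.eventuallyLE
            filter_upwards [ae_restrict_mem measurableSet_norm_gt] with z hz
            exact H.J_nonneg (half_pos hr).le hz
        _ ≤ _ := mul_le_mul_of_nonneg_left hJr (by positivity)
    have h2 : ∫ z in {z : EuclideanSpace ℝ (Fin d) | 1 < ‖z‖}, g (u + z - y) * J ‖z‖ ≤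
        C * g (u - y) * (Phi φ 1 / Phi φ r) := by
      simp only [e]
      refine (W.tail (u - y)).trans (le_mul_of_one_le_right (by positivity) ?_)
      exact (one_le_div hP).2 (H.Phi_mono hr hr1)
    rw [norm_gt_eq_union hr2, setIntegral_union disjoint_annulus_norm_gt measurableSet_norm_gt
      (i1.mono_set annulus_subset) i2]
    refine (add_le_add h1 h2).trans_eq (by ring)
  have hcC : 0 < c * C := by positivity
  have hpos : ∀ s ∈ Icc (t / 2) t, 0 < s := fun s hs => (half_pos ht).trans_le hs.1
  have h := hmain ((c * C + D) * (t * g (x - y))) r t x (fun s u => p s u y)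
    (by positivity) hr hr1 ht hrt
    ((G.cont_prod y).mono fun q hq => ⟨hpos _ hq.1, mem_univ _⟩)
    (fun s hs => G.bounded H (hpos s hs) y)
    (fun s hs u hu => by
      obtain ⟨h1, h2⟩ := hcmp u hu
      have hs0 := hpos s hs
      have hst := hs.2
      have hgu := W.pos (u - y)
      calc |p s u y| ≤ c * s * g (u - y) := hle s hs0 (hst.trans htT) u y (by linarith)
        _ ≤ c * t * (C * g (x - y)) := by gcongr
        _ = c * C * (t * g (x - y)) := by ring
        _ ≤ _ := by gcongr; linarith)
    (fun s hs u hu => by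
      obtain ⟨h1, h2⟩ := hcmp u (by linarith)
      have hs0 := hpos s hs
      have hst := hs.2
      have hgu := W.pos (u - y)
      have hct : 0 < c * t := by positivity
      have hsplit := H.integral_tail_le_of_split (R := r / 2) (ρ := 1) (j := C * g (u - y))
        (f := fun v => p s v y) (h := fun v => c * t * g (v - y)) (half_pos hr) (by positivity)
        le_rfl (G.cont_fst hs0 y) (G.bounded H hs0 y) (by fun_prop)
        ⟨c * t, fun v => by
          rw [abs_of_pos (mul_pos hct (W.pos _))]
          exact mul_le_of_le_one_right hct.le (W.le_one _)⟩
        (fun v => (mul_pos hct (W.pos _)).le) u y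
        (fun z _ hz => by
          have h3 : ‖u - y‖ ≤ ‖u + z - y‖ + ‖z‖ := by
            have := norm_sub_le (u + z - y) z
            rwa [show u + z - y - z = u - y by abel] at this
          exact W.jump (u - y) ‖z‖ (by linarith) (by linarith))
        (fun v hv => by
          have := W.pos (v - y)
          refine (hle s hs0 (hst.trans htT) v y hv.le).trans ?_
          gcongr)
      refine hsplit.trans ?_
      simp only [mul_assoc (c * t)]
      rw [integral_const_mul]
      have e1 : C * g (u - y) * ∫ w in Metric.closedBall y 1, |p s w y| ≤
          C * (C * g (x - y)) * I * (t / Phi φ r) := by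
        calc C * g (u - y) * ∫ w in Metric.closedBall y 1, |p s w y| ≤ C * g (u - y) * I :=
              mul_le_mul_of_nonneg_left (hInt s hs0 (hst.trans htT) y) (by positivity)
          _ ≤ C * (C * g (x - y)) * I := by gcongr
          _ ≤ _ := le_mul_of_one_le_right (by positivity) ((one_le_div hP).2 hrt)
      have e2 : c * t * ∫ z in {z : EuclideanSpace ℝ (Fin d) | r / 2 < ‖z‖},
          g (u + z - y) * J ‖z‖ ≤
          c * t * (C * (C * g (x - y)) * ((4 * E + Phi φ 1) / Phi φ r)) := by
        refine mul_le_mul_of_nonneg_left ((hgJ u).trans ?_) hct.le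
        gcongr
      calc _ ≤ C * (C * g (x - y)) * I * (t / Phi φ r) +
            c * t * (C * (C * g (x - y)) * ((4 * E + Phi φ 1) / Phi φ r)) := add_le_add e1 e2
        _ = D * (t * g (x - y)) / Phi φ r := by rw [hD]; ring
        _ ≤ _ := by
            gcongr
            linarith)
    (fun s hs u hu => by
      obtain ⟨-, h2⟩ := hcmp u hu
      refine G.eqn s (hpos s hs) u y ?_
      rintro rfl
      simp at h2
      linarith) x' hx'
  exact h.trans_eq (by ring)

end GoodHeatKernel

namespace HKAssumptions

variable {g : EuclideanSpace ℝ (Fin d) → ℝ} {C : ℝ}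

lemma Gfun_pos (H : HKAssumptions d φ J a₁ α₁ C₀ a b β κ κ₀ κ₁ κ₂ δ)
    (S : PhiInvSpec φ Φinv) {t : ℝ} (ht : 0 < t) (x : EuclideanSpace ℝ (Fin d)) :
    0 < Gfun d φ b β Φinv t x := by
  have := S.pos t ht
  unfold Gfun
  split_ifs with hx
  · positivity
  · exact lt_min (by positivity) (H.theta_pos (norm_pos_iff.2 hx))

lemma profile_max_le_Gfun (H : HKAssumptions d φ J a₁ α₁ C₀ a b β κ κ₀ κ₁ κ₂ δ)
    (S : PhiInvSpec φ Φinv) (W : DecayWeight d φ J b β g C) (T : ℝ) :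
    ∃ K, 0 < K ∧ ∀ t, 0 < t → t ≤ T → ∀ x : EuclideanSpace ℝ (Fin d), ‖x‖ ≤ 3 →
      t * profile d φ (max ‖x‖ (scale Φinv t)) ≤ K * t * Gfun d φ b β Φinv t x := by
  obtain ⟨K, hK, hs⟩ := H.exists_scale S T
  obtain ⟨x₀, -, hx₀⟩ := (isCompact_closedBall (0 : EuclideanSpace ℝ (Fin d)) 3).exists_isMinOn
    ⟨0, by simp⟩ W.cont.continuousOn
  have hC : 0 < C := one_pos.trans_le W.one_le
  have hg₀ := W.pos x₀
  have hp1 := H.profile_pos (d := d) one_pos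
  set M := K + 1 + profile d φ 1 * C / g x₀ with hM
  have hterm : 0 < profile d φ 1 * C / g x₀ := by positivity
  have hMpos : 0 < M := by positivity
  refine ⟨M * K ^ d, by positivity, fun t ht htT x hx => ?_⟩
  have hr := scale_pos S ht
  obtain ⟨hs1, hs2⟩ := hs t ht htT
  refine le_mul_Gfun S hK hMpos.le ht hs1 ?_ ?_
    (fun h => (H.theta_pos (norm_pos_iff.2 h)).le)
  · set r := scale Φinv t
    have hP := H.Phi_pos hr
    calc t * profile d φ (max ‖x‖ r) ≤ t * profile d φ r :=
          mul_le_mul_of_nonneg_left (H.profile_anti hr (le_max_right _ _)) ht.le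
      _ ≤ K * Phi φ r * profile d φ r :=
          mul_le_mul_of_nonneg_right hs2 (H.profile_pos hr).le
      _ = K * (1 / r ^ d) := by unfold profile; field_simp
      _ ≤ M * (1 / r ^ d) := by
          refine mul_le_mul_of_nonneg_right ?_ (by positivity)
          linarith
  · intro hne
    have hx0 := norm_pos_iff.2 hne
    have hθ := H.theta_pos hx0
    have h1 := H.profile_anti (d := d) hx0 (le_max_left ‖x‖ (scale Φinv t))
    rw [mul_comm M t, mul_assoc]
    refine mul_le_mul_of_nonneg_left (h1.trans ?_) ht.le
    rcases le_or_gt ‖x‖ 1 with h | h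
    · have : profile d φ ‖x‖ = theta d φ b β ‖x‖ := by rw [theta, if_pos h, profile]
      rw [this]
      exact le_mul_of_one_le_left hθ.le (by linarith)
    · have h2 := H.profile_anti (d := d) one_pos h.le
      have h3 : g x₀ ≤ C * theta d φ b β ‖x‖ :=
        (hx₀ (by simpa using hx)).trans (W.le_theta x h.le)
      calc profile d φ ‖x‖ ≤ profile d φ 1 * (g x₀ / g x₀) := by rwa [div_self hg₀.ne', mul_one]
        _ ≤ profile d φ 1 * (C * theta d φ b β ‖x‖ / g x₀) := by gcongr
        _ = profile d φ 1 * C / g x₀ * theta d φ b β ‖x‖ := by ring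
        _ ≤ M * theta d φ b β ‖x‖ := mul_le_mul_of_nonneg_right (by linarith) hθ.le

lemma weight_le_Gfun (H : HKAssumptions d φ J a₁ α₁ C₀ a b β κ κ₀ κ₁ κ₂ δ)
    (S : PhiInvSpec φ Φinv) (W : DecayWeight d φ J b β g C) {T : ℝ} (hT : 1 ≤ T) :
    ∃ K, 0 < K ∧ ∀ t, 0 < t → t ≤ T → ∀ x : EuclideanSpace ℝ (Fin d), 1 ≤ ‖x‖ →
      t * g x ≤ K * t * Gfun d φ b β Φinv t x := by
  obtain ⟨K, hK, hs⟩ := H.exists_scale S T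
  have hC : 0 < C := one_pos.trans_le W.one_le
  refine ⟨(T + C) * K ^ d, by positivity, fun t ht htT x hx => ?_⟩
  have hr := scale_pos S ht
  have hr1 : scale Φinv t ≤ 1 := min_le_left _ _
  refine le_mul_Gfun S hK (by positivity) ht (hs t ht htT).1 ?_ (fun h => ?_)
    (fun h => (H.theta_pos (norm_pos_iff.2 h)).le)
  · calc t * g x ≤ T * 1 := mul_le_mul htT (W.le_one x) (W.pos x).le (by linarith)
      _ ≤ (T + C) * (1 / scale Φinv t ^ d) := by
          refine mul_le_mul (by linarith) ?_ zero_le_one (by linarith)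
          exact one_le_one_div (by positivity) (pow_le_one₀ hr.le hr1)
  · have hθ := H.theta_pos (norm_pos_iff.2 h)
    rw [mul_comm (T + C) t, mul_assoc]
    refine mul_le_mul_of_nonneg_left ((W.le_theta x hx).trans ?_) ht.le
    exact mul_le_mul_of_nonneg_right (by linarith) hθ.le

end HKAssumptions

namespace GoodHeatKernel

variable {p : ℝ → EuclideanSpace ℝ (Fin d) → EuclideanSpace ℝ (Fin d) → ℝ}

/-- The upper bound of a good heat kernel also holds for its absolute value. -/
lemma abs_le_Gfun (H : HKAssumptions d φ J a₁ α₁ C₀ a b β κ κ₀ κ₁ κ₂ δ)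
    (S : PhiInvSpec φ Φinv) (G : GoodHeatKernel d φ J b β Φinv κ p) {T : ℝ} (hT : 1 ≤ T) :
    ∃ K, 0 < K ∧ ∀ t, 0 < t → t ≤ T → ∀ x y,
      |p t x y| ≤ K * t * Gfun d φ b β Φinv t (x - y) := by
  obtain ⟨g, C, W⟩ := H.exists_decayWeight
  obtain ⟨A, hA, hnear⟩ := H.profile_max_le_Gfun S W T
  obtain ⟨B, hB, hfar⟩ := H.weight_le_Gfun S W hT
  obtain ⟨c, hc, hcn⟩ := G.abs_le_profile_max H S hT
  obtain ⟨e, he, hef⟩ := G.abs_le_weight H S W hT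
  refine ⟨c * A + e * B, by positivity, fun t ht htT x y => ?_⟩
  have hG := H.Gfun_pos S ht (x - y)
  rcases le_total ‖x - y‖ 1 with h | h
  · calc |p t x y| ≤ c * (A * t * Gfun d φ b β Φinv t (x - y)) :=
          (hcn t ht htT x y).trans
            (mul_le_mul_of_nonneg_left (hnear t ht htT _ (by linarith)) hc.le)
      _ = (c * A) * (t * Gfun d φ b β Φinv t (x - y)) := by ring
      _ ≤ (c * A + e * B) * (t * Gfun d φ b β Φinv t (x - y)) :=
          mul_le_mul_of_nonneg_right (le_add_of_nonneg_right (by positivity)) (by positivity)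
      _ = _ := by ring
  · calc |p t x y| ≤ e * (t * g (x - y)) := (hef t ht htT x y h).trans_eq (by ring)
      _ ≤ e * (B * t * Gfun d φ b β Φinv t (x - y)) :=
          mul_le_mul_of_nonneg_left (hfar t ht htT _ h) he.le
      _ = (e * B) * (t * Gfun d φ b β Φinv t (x - y)) := by ring
      _ ≤ (c * A + e * B) * (t * Gfun d φ b β Φinv t (x - y)) :=
          mul_le_mul_of_nonneg_right (le_add_of_nonneg_left (by positivity)) (by positivity)
      _ = _ := by ring

/-- Hölder estimate for increments below the spatial scale. -/
lemma holder_of_le_scale (H : HKAssumptions d φ J a₁ α₁ C₀ a b β κ κ₀ κ₁ κ₂ δ)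
    (S : PhiInvSpec φ Φinv) (G : GoodHeatKernel d φ J b β Φinv κ p) {T : ℝ} (hT : 1 ≤ T)
    {γ : ℝ} (hγ0 : 0 < γ) (hγ1 : γ ≤ 1) (hγ : γ < α₁) :
    ∃ K, 0 < K ∧ ∀ t, 0 < t → t ≤ T → ∀ x x' y, ‖x - x'‖ ≤ scale Φinv t →
      |p t x y - p t x' y| ≤
        K * t * Gfun d φ b β Φinv t (x - y) * (‖x - x'‖ / scale Φinv t) ^ γ := by
  obtain ⟨g, C, W⟩ := H.exists_decayWeight
  obtain ⟨A, hA, hnear⟩ := H.profile_max_le_Gfun S W T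
  obtain ⟨B, hB, hfar⟩ := H.weight_le_Gfun S W hT
  obtain ⟨c, hc, hcn⟩ := G.holder_near H S hT hγ0 hγ1 hγ
  obtain ⟨e, he, hef⟩ := G.holder_far H S W hT hγ0 hγ1 hγ
  refine ⟨c * A + e * B, by positivity, fun t ht htT x x' y hxx => ?_⟩
  have hG := H.Gfun_pos S ht (x - y)
  have hr := HKAssumptions.scale_pos S ht
  have hq : 0 ≤ (‖x - x'‖ / scale Φinv t) ^ γ := by positivity
  rcases le_total ‖x - y‖ 3 with h | h
  · refine (hcn t ht htT x x' y h (by rwa [norm_sub_rev])).trans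
      (mul_le_mul_of_nonneg_right ?_ hq)
    calc _ ≤ c * (A * t * Gfun d φ b β Φinv t (x - y)) :=
          mul_le_mul_of_nonneg_left (hnear t ht htT _ h) hc.le
      _ = (c * A) * (t * Gfun d φ b β Φinv t (x - y)) := by ring
      _ ≤ (c * A + e * B) * (t * Gfun d φ b β Φinv t (x - y)) :=
          mul_le_mul_of_nonneg_right (le_add_of_nonneg_right (by positivity)) (by positivity)
      _ = _ := by ring
  · refine (hef t ht htT x x' y h (by rwa [norm_sub_rev])).trans
      (mul_le_mul_of_nonneg_right ?_ hq)
    calc _ ≤ e * (B * t * Gfun d φ b β Φinv t (x - y)) :=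
          mul_le_mul_of_nonneg_left (hfar t ht htT _ (by linarith)) he.le
      _ = (e * B) * (t * Gfun d φ b β Φinv t (x - y)) := by ring
      _ ≤ (c * A + e * B) * (t * Gfun d φ b β Φinv t (x - y)) :=
          mul_le_mul_of_nonneg_right (le_add_of_nonneg_left (by positivity)) (by positivity)
      _ = _ := by ring

end GoodHeatKernel

/-- Hölder continuity of the good heat kernel in the space variable. -/
theorem heat_kernel_holder
    (d : ℕ) (φ J : ℝ → ℝ) (a₁ α₁ C₀ a b β : ℝ)
    (κ : EuclideanSpace ℝ (Fin d) → EuclideanSpace ℝ (Fin d) → ℝ)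
    (κ₀ κ₁ κ₂ δ : ℝ)
    (H : HKAssumptions d φ J a₁ α₁ C₀ a b β κ κ₀ κ₁ κ₂ δ)
    (Φinv : ℝ → ℝ) (HΦ : PhiInvSpec φ Φinv)
    (p : ℝ → EuclideanSpace ℝ (Fin d) → EuclideanSpace ℝ (Fin d) → ℝ)
    (hp : GoodHeatKernel d φ J b β Φinv κ p) :
    ∀ T : ℝ, 1 ≤ T → ∀ γ : ℝ, 0 < γ → γ < α₁ → γ ≤ 1 →
      ∃ c₁ : ℝ, 0 < c₁ ∧ ∀ t : ℝ, 0 < t → t ≤ T →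
      ∀ x x' y : EuclideanSpace ℝ (Fin d), (x ≠ y ∨ x' ≠ y) →
      |p t x y - p t x' y| ≤
        c₁ * ‖x - x'‖ ^ γ * t * Φinv t ^ (-γ) *
          max (Gfun d φ b β Φinv t (x - y)) (Gfun d φ b β Φinv t (x' - y)) := by
  intro T hT γ hγ0 hγ hγ1
  obtain ⟨K, hK, hs⟩ := H.exists_scale HΦ T
  obtain ⟨A, hA, habs⟩ := hp.abs_le_Gfun H HΦ hT
  obtain ⟨B, hB, hloc⟩ := hp.holder_of_le_scale H HΦ hT hγ0 hγ1 hγ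
  have hK0 : 0 < K := one_pos.trans_le hK
  refine ⟨(2 * A + B) * K ^ γ, by positivity, fun t ht htT x x' y _ => ?_⟩
  have hr := HKAssumptions.scale_pos HΦ ht
  have hinv := HΦ.pos t ht
  have hG := H.Gfun_pos HΦ ht (x - y)
  set m := max (Gfun d φ b β Φinv t (x - y)) (Gfun d φ b β Φinv t (x' - y)) with hm
  have hm1 : Gfun d φ b β Φinv t (x - y) ≤ m := le_max_left _ _
  have hm2 : Gfun d φ b β Φinv t (x' - y) ≤ m := le_max_right _ _
  have hm0 : 0 < m := hG.trans_le hm1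
  have hq : (‖x - x'‖ / scale Φinv t) ^ γ ≤ K ^ γ * ‖x - x'‖ ^ γ * Φinv t ^ (-γ) := by
    rw [Real.rpow_neg hinv.le, ← Real.inv_rpow hinv.le, ← Real.mul_rpow hK0.le (norm_nonneg _),
      ← Real.mul_rpow (by positivity) (by positivity)]
    refine Real.rpow_le_rpow (by positivity) ?_ hγ0.le
    rw [← div_eq_mul_inv, div_le_div_iff₀ hr hinv]
    calc ‖x - x'‖ * Φinv t ≤ ‖x - x'‖ * (K * scale Φinv t) :=
          mul_le_mul_of_nonneg_left (hs t ht htT).1 (norm_nonneg _)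
      _ = _ := by ring
  have hmain : |p t x y - p t x' y| ≤
      (2 * A + B) * t * m * (‖x - x'‖ / scale Φinv t) ^ γ := by
    rcases le_total ‖x - x'‖ (scale Φinv t) with h | h
    · refine (hloc t ht htT x x' y h).trans (mul_le_mul_of_nonneg_right ?_ (by positivity))
      exact mul_le_mul (mul_le_mul_of_nonneg_right (by linarith) ht.le) hm1 hG.le (by positivity)
    · have hone : 1 ≤ (‖x - x'‖ / scale Φinv t) ^ γ :=
        Real.one_le_rpow ((one_le_div hr).2 h) hγ0.le
      have h1 := (habs t ht htT x y).trans
        (mul_le_mul_of_nonneg_left hm1 (by positivity : 0 ≤ A * t))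
      have h2 := (habs t ht htT x' y).trans
        (mul_le_mul_of_nonneg_left hm2 (by positivity : 0 ≤ A * t))
      have h3 : 0 < B * t * m := by positivity
      calc |p t x y - p t x' y| ≤ |p t x y| + |p t x' y| := abs_sub _ _
        _ ≤ (2 * A + B) * t * m := by linarith
        _ ≤ _ := le_mul_of_one_le_right (by positivity) hone
  calc |p t x y - p t x' y| ≤ (2 * A + B) * t * m * (‖x - x'‖ / scale Φinv t) ^ γ := hmain
    _ ≤ (2 * A + B) * t * m * (K ^ γ * ‖x - x'‖ ^ γ * Φinv t ^ (-γ)) :=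
        mul_le_mul_of_nonneg_left hq (by positivity)
    _ = _ := by ring
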